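/- Let G=(V,E) be a finite simple graph. Then the globally 2-linked clusters of G of size at least four are precisely the vertex sets of the ℛ₂-blocks of G. Furthermore, an edge e of glc₂(G) is not induced by any globally 2-linked cluster of size at least four if and only if e is an ℛ₂-bridge of G. -/

import Mathlib

open scoped BigOperators

noncomputable section

namespace Rigidity

variable {V : Type*}

/-- Euclidean distance between two points of `ℝ^d` (given as coordinate functions). -/
def eDist {d : ℕ} (x y : Fin d → ℝ) : ℝ := Real.sqrt (∑ i, (x i - y i) ^ 2)

/-- Two frameworks `(G,p)` and `(G,q)` are equivalent if corresponding edge lengths agree. -/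
def Equivalent {d : ℕ} (G : SimpleGraph V) (p q : V → Fin d → ℝ) : Prop :=
  ∀ u v : V, G.Adj u v → eDist (p u) (p v) = eDist (q u) (q v)

/-- Two placements are congruent if all pairwise distances agree. -/
def Congruent {d : ℕ} (p q : V → Fin d → ℝ) : Prop :=
  ∀ u v : V, eDist (p u) (p v) = eDist (q u) (q v)

/-- A placement is generic if the multiset of its coordinates is algebraically
independent over `ℚ`. -/
def Generic {d : ℕ} (p : V → Fin d → ℝ) : Prop :=
  AlgebraicIndependent ℚ (fun vi : V × Fin d => p vi.1 vi.2)

/-- `{u,v}` is globally linked in the framework `(G,p)`. -/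
def GloballyLinkedIn {d : ℕ} (G : SimpleGraph V) (p : V → Fin d → ℝ) (u v : V) : Prop :=
  ∀ q : V → Fin d → ℝ, Equivalent G p q → eDist (q u) (q v) = eDist (p u) (p v)

/-- `{u,v}` is globally `d`-linked in `G`. -/
def GloballyLinked (d : ℕ) (G : SimpleGraph V) (u v : V) : Prop :=
  ∀ p : V → Fin d → ℝ, Generic p → GloballyLinkedIn G p u v

/-- The framework `(G,p)` is rigid. -/
def RigidFramework {d : ℕ} (G : SimpleGraph V) (p : V → Fin d → ℝ) : Prop :=
  ∃ ε > (0:ℝ), ∀ q : V → Fin d → ℝ, Equivalent G p q →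
    (∀ v, eDist (p v) (q v) < ε) → Congruent p q

/-- `G` is `d`-rigid: every generic framework of `G` in `ℝ^d` is rigid. -/
def IsRigidGraph (d : ℕ) (G : SimpleGraph V) : Prop :=
  ∀ p : V → Fin d → ℝ, Generic p → RigidFramework G p

/-- The framework `(G,p)` is globally rigid. -/
def GloballyRigidFramework {d : ℕ} (G : SimpleGraph V) (p : V → Fin d → ℝ) : Prop :=
  ∀ q : V → Fin d → ℝ, Equivalent G p q → Congruent p q

/-- The row of the rigidity matrix corresponding to the (ordered) edge `(u,v)`. -/
def edgeVec [DecidableEq V] {d : ℕ} (p : V → Fin d → ℝ) (u v : V) : V × Fin d → ℝ :=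
  fun wi => if wi.1 = u then p u wi.2 - p v wi.2
            else if wi.1 = v then p v wi.2 - p u wi.2 else 0

/-- The rank of the set of rows of the rigidity matrix of `(·,p)` indexed by `F`. -/
def rankAt [DecidableEq V] (d : ℕ) (p : V → Fin d → ℝ) (F : Set (Sym2 V)) : ℕ :=
  Module.finrank ℝ (Submodule.span ℝ
    {x : V × Fin d → ℝ | ∃ u v : V, s(u, v) ∈ F ∧ x = edgeVec p u v})

/-- `r_d(F)`: the rank of the set of rows indexed by `F` of the rigidity matrix of a
generic framework, equivalently the maximum of this rank over all placements. -/
def rd [DecidableEq V] (d : ℕ) (F : Set (Sym2 V)) : ℕ :=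
  sSup {n : ℕ | ∃ p : V → Fin d → ℝ, n = rankAt d p F}

/-- An edge set is `ℛ_d`-independent if its rank equals its cardinality. -/
def RdIndep [DecidableEq V] (d : ℕ) (F : Set (Sym2 V)) : Prop := rd d F = F.ncard

/-- An `ℛ_d`-circuit: not independent, but every proper subset is independent. -/
def RdCircuit [DecidableEq V] (d : ℕ) (C : Set (Sym2 V)) : Prop :=
  ¬ RdIndep d C ∧ ∀ C' : Set (Sym2 V), C' ⊂ C → RdIndep d C'

/-- An `ℛ_d`-circuit of the graph `G`. -/
def RdCircuitOf [DecidableEq V] (d : ℕ) (G : SimpleGraph V) (C : Set (Sym2 V)) : Prop :=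
  C ⊆ G.edgeSet ∧ RdCircuit d C

/-- `F` is (the edge set of) an `ℛ_d`-component of `G`: an equivalence class of the
relation "`e = f` or some `ℛ_d`-circuit of `G` contains both `e` and `f`". -/
def IsRdComponent [DecidableEq V] (d : ℕ) (G : SimpleGraph V) (F : Set (Sym2 V)) : Prop :=
  ∃ e ∈ G.edgeSet, F = {f | f ∈ G.edgeSet ∧
    (e = f ∨ ∃ C, RdCircuitOf d G C ∧ e ∈ C ∧ f ∈ C)}

/-- The set of vertices covered by an edge set. -/
def vertexSpan (F : Set (Sym2 V)) : Set V := {v | ∃ e ∈ F, v ∈ e}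

/-- A nonempty edge set is `ℛ_d`-connected if any two of its edges lie on a common
`ℛ_d`-circuit contained in it (or are equal). -/
def RdConnectedSet [DecidableEq V] (d : ℕ) (F : Set (Sym2 V)) : Prop :=
  F.Nonempty ∧ ∀ e ∈ F, ∀ f ∈ F, e = f ∨ ∃ C, C ⊆ F ∧ RdCircuit d C ∧ e ∈ C ∧ f ∈ C

/-- A graph (with at least one edge) is `ℛ_d`-connected. -/
def RdConnected [DecidableEq V] (d : ℕ) (H : SimpleGraph V) : Prop :=
  RdConnectedSet d H.edgeSet

/-- `e` is an `ℛ_d`-bridge of `G`: `r_d(E ∖ {e}) = r_d(E) − 1`. -/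
def IsRdBridge [DecidableEq V] (d : ℕ) (G : SimpleGraph V) (e : Sym2 V) : Prop :=
  e ∈ G.edgeSet ∧ rd d (G.edgeSet \ {e}) + 1 = rd d G.edgeSet

/-- `G + uv`. -/
def addEdge (G : SimpleGraph V) (u v : V) : SimpleGraph V :=
  G ⊔ SimpleGraph.fromEdgeSet {s(u, v)}

/-- `{u,v}` is `d`-linked in `G` if `r_d(G+uv) = r_d(G)`. -/
def IsLinked [DecidableEq V] (d : ℕ) (G : SimpleGraph V) (u v : V) : Prop :=
  rd d (addEdge G u v).edgeSet = rd d G.edgeSet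

/-- There exist `k` pairwise internally vertex-disjoint `u`–`v` paths in `H`
(i.e. `κ_H(u,v) ≥ k`). -/
def InternallyDisjointPaths (H : SimpleGraph V) (u v : V) (k : ℕ) : Prop :=
  ∃ P : Fin k → H.Walk u v, (∀ i, (P i).IsPath) ∧
    ∀ i j, i ≠ j → ∀ w, w ∈ (P i).support → w ∈ (P j).support → w = u ∨ w = v

/-- An unordered pair forming a 2-separator: two distinct vertices whose deletion
disconnects the graph. -/
def TwoSepPair (H : SimpleGraph V) (e : Sym2 V) : Prop :=
  ¬ e.IsDiag ∧ ¬ (H.induce {v | v ∉ e}).Connected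

/-- The augmented graph `Ĥ`: add an edge for every 2-separator. -/
def aug (H : SimpleGraph V) : SimpleGraph V :=
  H ⊔ SimpleGraph.fromEdgeSet {e | TwoSepPair H e}

/-- A subgraph is 3-connected: at least 4 vertices, and deleting fewer than 3
vertices leaves it connected. -/
def IsThreeConnectedSubgraph {G : SimpleGraph V} (J : G.Subgraph) : Prop :=
  4 ≤ J.verts.ncard ∧ ∀ S : Set V, S.ncard < 3 → (J.deleteVerts S).coe.Connected

/-- A 3-block of `H`: a maximal 3-connected subgraph of the augmented graph `Ĥ`. -/
def IsThreeBlock (H : SimpleGraph V) (J : (aug H).Subgraph) : Prop :=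
  IsThreeConnectedSubgraph J ∧
    ∀ J' : (aug H).Subgraph, IsThreeConnectedSubgraph J' → J ≤ J' → J = J'

/-- `h_H(e)`: the number of 3-blocks of `H` containing both vertices of `e`. -/
def numBlocksOn (H : SimpleGraph V) (e : Sym2 V) : ℕ :=
  {J : (aug H).Subgraph | IsThreeBlock H J ∧ ∀ v ∈ e, v ∈ J.verts}.ncard

open Classical in
/-- `k(H) = Σ (h_H(ab) − 1)` over all 2-separators `{a,b}` of `H`. -/
def kGraph [Fintype V] [DecidableEq V] (H : SimpleGraph V) : ℕ :=
  ∑ e : Sym2 V, if TwoSepPair H e then numBlocksOn H e - 1 else 0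

/-- The graph of an `ℛ₂`-component, on its own vertex set. -/
def componentGraph [DecidableEq V] (F : Set (Sym2 V)) :
    SimpleGraph (vertexSpan F) :=
  (SimpleGraph.fromEdgeSet F).induce (vertexSpan F)

/-- `X` is the vertex set of an `ℛ_d`-block of `G`: a 3-block of a non-trivial
`ℛ_d`-component of `G`. -/
def IsRdBlockVerts [DecidableEq V] (d : ℕ) (G : SimpleGraph V) (X : Set V) : Prop :=
  ∃ F : Set (Sym2 V), IsRdComponent d G F ∧ 2 ≤ F.ncard ∧
    ∃ J : (aug (componentGraph F)).Subgraph,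
      IsThreeBlock (componentGraph F) J ∧ X = Subtype.val '' J.verts

/-- The globally linked closure of `G` in `ℝ^d`. -/
def glc (d : ℕ) (G : SimpleGraph V) : SimpleGraph V :=
  G ⊔ SimpleGraph.fromEdgeSet {e | ∃ u v : V, e = s(u, v) ∧ GloballyLinked d G u v}

/-- A globally `d`-linked cluster: the vertex set of a maximal complete subgraph of
`glc_d(G)`. -/
def IsCluster (d : ℕ) (G : SimpleGraph V) (X : Set V) : Prop :=
  (∀ a ∈ X, ∀ b ∈ X, a ≠ b → (glc d G).Adj a b) ∧
    ∀ Y : Set V, X ⊆ Y → (∀ a ∈ Y, ∀ b ∈ Y, a ≠ b → (glc d G).Adj a b) → Y = X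

/-- Equilibrium stress of a framework, encoded as a symmetric function vanishing on
non-edges. -/
def IsEqStress [Fintype V] {d : ℕ} (G : SimpleGraph V) (p : V → Fin d → ℝ)
    (ω : V → V → ℝ) : Prop :=
  (∀ u v, ω u v = ω v u) ∧ (∀ u v, ¬ G.Adj u v → ω u v = 0) ∧
    ∀ u, ∑ v, ω u v • (p u - p v) = 0

/-- `{u,v}` is `d`-stress-linked in `G`. -/
def StressLinked [Fintype V] (d : ℕ) (G : SimpleGraph V) (u v : V) : Prop :=
  ∀ p : V → Fin d → ℝ, Generic p → ∀ q : V → Fin d → ℝ,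
    (∀ ω, IsEqStress G p ω → IsEqStress G q ω) →
    ∀ ω, IsEqStress (addEdge G u v) p ω → IsEqStress (addEdge G u v) q ω

/-- Equivalence of complex frameworks. -/
def CEquivalent {d : ℕ} (G : SimpleGraph V) (p q : V → Fin d → ℂ) : Prop :=
  ∀ u v : V, G.Adj u v →
    ∑ i, (p u i - p v i) ^ 2 = ∑ i, (q u i - q v i) ^ 2

/-- Generic complex placement. -/
def CGeneric {d : ℕ} (p : V → Fin d → ℂ) : Prop :=
  AlgebraicIndependent ℚ (fun vi : V × Fin d => p vi.1 vi.2)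

/-- `{u,v}` is globally linked in `G` in `ℂ^d`. -/
def CGloballyLinked (d : ℕ) (G : SimpleGraph V) (u v : V) : Prop :=
  ∀ p : V → Fin d → ℂ, CGeneric p → ∀ q : V → Fin d → ℂ, CEquivalent G p q →
    ∑ i, (q u i - q v i) ^ 2 = ∑ i, (p u i - p v i) ^ 2

/-- A flexing of the framework `(G,q)`. -/
def IsFlexing {d : ℕ} (G : SimpleGraph V) (q : V → Fin d → ℝ)
    (φ : Set.Icc (0:ℝ) 1 → V → Fin d → ℝ) : Prop :=
  Continuous φ ∧ φ ⟨0, Set.left_mem_Icc.mpr zero_le_one⟩ = q ∧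
    (∀ t, Equivalent G q (φ t)) ∧
    ∀ t : Set.Icc (0:ℝ) 1, 0 < (t : ℝ) → ¬ Congruent q (φ t)

/-- A finite loopless multigraph on vertex type `V` with edge type `E`. -/
structure Multigraph (V : Type*) (E : Type*) where
  ends : E → Sym2 V
  loopless : ∀ e, ¬ (ends e).IsDiag

/-- The data `(B, bar)` exhibits `G` as a body-bar graph induced by `H`. -/
def IsBodyBar {V E W : Type*} (H : Multigraph V E) (G : SimpleGraph W)
    (B : V → Set W) (bar : E → W × W) : Prop :=
  (∀ w : W, ∃! v : V, w ∈ B v) ∧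
  (∀ v : V, (B v).ncard = {e : E | v ∈ H.ends e}.ncard) ∧
  (∀ e : E, ∃ w z : V, H.ends e = s(w, z) ∧ (bar e).1 ∈ B w ∧ (bar e).2 ∈ B z) ∧
  (∀ e : E, (bar e).1 ≠ (bar e).2) ∧
  (∀ e e' : E, e ≠ e' →
    ({(bar e).1, (bar e).2} ∩ {(bar e').1, (bar e').2} : Set W) = ∅) ∧
  (∀ a b : W, G.Adj a b ↔ a ≠ b ∧
    ((∃ v : V, a ∈ B v ∧ b ∈ B v) ∨ ∃ e : E, s(a, b) = s((bar e).1, (bar e).2)))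

/-- `P` is a partition of the set `X`. -/
def IsPartitionOf {V : Type*} (X : Set V) (P : Set (Set V)) : Prop :=
  (∀ p ∈ P, p.Nonempty ∧ p ⊆ X) ∧ ∀ v ∈ X, ∃! p, p ∈ P ∧ v ∈ p

/-- The subgraph `(X,F)` of the multigraph `H` is `k`-tree-connected. -/
def SubTreeConnected {V E : Type*} (k : ℕ) (H : Multigraph V E)
    (X : Set V) (F : Set E) : Prop :=
  X.Nonempty ∧ (∀ e ∈ F, ∀ v ∈ H.ends e, v ∈ X) ∧
    ∀ P : Set (Set V), IsPartitionOf X P →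
      k * (P.ncard - 1) ≤ {e | e ∈ F ∧ ¬ ∃ p ∈ P, ∀ v ∈ H.ends e, v ∈ p}.ncard

/-- `(X,F)` is a `k`-superbrick of `H`: a maximal `k`-tree-connected subgraph. -/
def IsSuperbrick {V E : Type*} (k : ℕ) (H : Multigraph V E)
    (X : Set V) (F : Set E) : Prop :=
  SubTreeConnected k H X F ∧
    ∀ X' F', SubTreeConnected k H X' F' → X ⊆ X' → F ⊆ F' → X = X' ∧ F = F'

set_option linter.unusedSectionVars false

section LinearMatroid

variable {E W : Type*} [AddCommGroup W] [Module ℝ W] (r : E → W →ₗ[ℝ] ℝ)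

/-- `e` lies in the closure of `F`: every vector annihilated by the functionals of `F` is
annihilated by that of `e`. -/
def Cl (F : Set E) (e : E) : Prop := ∀ d, (∀ f ∈ F, r f d = 0) → r e d = 0

/-- The functionals indexed by `F` can be prescribed arbitrarily. -/
def Reg (F : Set E) : Prop := ∀ c : E → ℝ, ∃ d, ∀ e ∈ F, r e d = c e

/-- Circuits of the matroid of the family `r`. -/
def Circ (C : Set E) : Prop := ¬ Reg r C ∧ ∀ C' : Set E, C' ⊂ C → Reg r C'

/-- Connected sets of the matroid of the family `r`. -/
def RConn (F : Set E) : Prop :=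
  F.Nonempty ∧ ∀ e ∈ F, ∀ f ∈ F, e = f ∨ ∃ C, C ⊆ F ∧ Circ r C ∧ e ∈ C ∧ f ∈ C

variable {r} {F F' C C' I : Set E} {e f g : E}

theorem Cl.mono (h : Cl r F e) (hF : F ⊆ F') : Cl r F' e :=
  fun d hd => h d fun f hf => hd f (hF hf)

theorem Cl.of_mem (h : e ∈ F) : Cl r F e := fun _ hd => hd e h

theorem Cl.trans (h : Cl r F e) (hF : ∀ f ∈ F, Cl r F' f) : Cl r F' e :=
  fun d hd => h d fun f hf => hF f hf d hd

theorem Reg.mono (h : Reg r F) (hF : F' ⊆ F) : Reg r F' := fun c =>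
  (h c).imp fun _ hd e he => hd e (hF he)

theorem Reg.not_cl (h : Reg r F) (he : e ∈ F) : ¬ Cl r (F \ {e}) e := by
  classical
  intro hc
  obtain ⟨d, hd⟩ := h (fun f => if f = e then 1 else 0)
  have := hc d fun f hf => by simpa [show f ≠ e from hf.2] using hd f hf.1
  simp [hd e he] at this

theorem reg_empty : Reg r (∅ : Set E) := fun _ => ⟨0, by simp⟩

theorem Reg.insert (h : Reg r F) (he : ¬ Cl r F e) : Reg r (insert e F) := by
  simp only [Cl, not_forall] at he
  obtain ⟨d₀, hd₀, hne⟩ := he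
  intro c
  obtain ⟨d, hd⟩ := h c
  refine ⟨d + ((c e - r e d) / r e d₀) • d₀, ?_⟩
  rintro f (rfl | hf)
  · simp [hne]
  · simp [hd f hf, hd₀ f hf]

theorem exists_basis_superset [Finite E] (hI : Reg r I) (hIF : I ⊆ F) :
    ∃ B, I ⊆ B ∧ B ⊆ F ∧ Reg r B ∧ ∀ f ∈ F, Cl r B f := by
  obtain ⟨B, hB⟩ := (Set.toFinite {B | I ⊆ B ∧ B ⊆ F ∧ Reg r B}).exists_maximal
    ⟨I, le_rfl, hIF, hI⟩
  refine ⟨B, hB.1.1, hB.1.2.1, hB.1.2.2, fun f hf => ?_⟩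
  by_contra hc
  have := hB.2 ⟨hB.1.1.trans (Set.subset_insert f B), Set.insert_subset hf hB.1.2.1,
    hB.1.2.2.insert hc⟩ (Set.subset_insert f B)
  exact hc (Cl.of_mem (this (Set.mem_insert f B)))

theorem exists_basis [Finite E] (F : Set E) :
    ∃ B, B ⊆ F ∧ Reg r B ∧ ∀ f ∈ F, Cl r B f := by
  obtain ⟨B, -, h⟩ := exists_basis_superset (r := r) reg_empty (Set.empty_subset F)
  exact ⟨B, h⟩

theorem Circ.cl [Finite E] (h : Circ r C) (he : e ∈ C) : Cl r (C \ {e}) e := by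
  by_contra hc
  refine h.1 ?_
  have := (h.2 (C \ {e}) ⟨Set.sdiff_subset, fun h' => (h' he).2 rfl⟩).insert hc
  rwa [Set.insert_sdiff_singleton, Set.insert_eq_of_mem he] at this

theorem exists_circ_of_not_reg [Finite E] (h : ¬ Reg r F) : ∃ C, C ⊆ F ∧ Circ r C := by
  obtain ⟨C, hC⟩ := (Set.toFinite {C | C ⊆ F ∧ ¬ Reg r C}).exists_minimal ⟨F, le_rfl, h⟩
  refine ⟨C, hC.1.1, hC.1.2, fun C' hC' => ?_⟩
  by_contra hn
  exact hC'.2 (hC.2 ⟨hC'.1.trans hC.1.1, hn⟩ hC'.1)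

theorem exists_circ_of_cl [Finite E] (h : Cl r F e) (he : e ∉ F) :
    ∃ C, C ⊆ insert e F ∧ e ∈ C ∧ Circ r C := by
  obtain ⟨B, hBF, hB, hcl⟩ := exists_basis (r := r) F
  have hn : ¬ Reg r (insert e B) := fun hr => by
    have := hr.not_cl (Set.mem_insert e B)
    rw [Set.insert_sdiff_self_of_notMem (fun h => he (hBF h))] at this
    exact this (h.trans hcl)
  obtain ⟨C, hC, hCirc⟩ := exists_circ_of_not_reg hn
  refine ⟨C, hC.trans (Set.insert_subset_insert hBF), ?_, hCirc⟩
  by_contra heC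
  exact hCirc.1 (hB.mono fun x hx => (hC hx).resolve_left fun h => heC (h ▸ hx))

theorem Circ.eq_of_subset (h : Circ r C) (h' : Circ r C') (hs : C ⊆ C') : C = C' := by
  by_contra hne
  exact h.1 (h'.2 C (hs.ssubset_of_ne hne))

theorem Circ.nonempty (h : Circ r C) : C.Nonempty := by
  rw [Set.nonempty_iff_ne_empty]
  rintro rfl
  exact h.1 reg_empty

theorem Circ.strong_elim [Finite E] (h : Circ r C) (h' : Circ r C') (hf : f ∈ C) (hf' : f ∈ C')
    (he : e ∈ C) (he' : e ∉ C') : ∃ D, D ⊆ (C ∪ C') \ {f} ∧ e ∈ D ∧ Circ r D := by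
  have hef : e ≠ f := by rintro rfl; exact he' hf'
  have hc : Cl r ((C ∪ C') \ {e, f}) e := by
    refine (h.cl he).trans fun g hg => ?_
    by_cases hgf : g = f
    · subst hgf
      refine (h'.cl hf').mono fun x hx => ⟨Or.inr hx.1, ?_⟩
      rintro (rfl | rfl)
      exacts [he' hx.1, hx.2 rfl]
    · exact Cl.of_mem ⟨Or.inl hg.1, by rintro (rfl | rfl); exacts [hg.2 rfl, hgf rfl]⟩
  obtain ⟨D, hD, heD, hDc⟩ := exists_circ_of_cl hc (by simp)
  refine ⟨D, fun x hx => ?_, heD, hDc⟩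
  rcases hD hx with rfl | hx'
  · exact ⟨Or.inl he, hef⟩
  · exact ⟨hx'.1, fun h => hx'.2 (Or.inr h)⟩

theorem Circ.common [Finite E] (h : Circ r C) (h' : Circ r C') (hf : f ∈ C) (hf' : f ∈ C')
    (he : e ∈ C) (hg : g ∈ C') : ∃ D, D ⊆ C ∪ C' ∧ Circ r D ∧ e ∈ D ∧ g ∈ D := by
  suffices H : ∀ n : ℕ, ∀ C C' : Set E, Circ r C → Circ r C' → (C ∩ C').Nonempty → e ∈ C →
      g ∈ C' → (C ∪ C').ncard = n → ∃ D, D ⊆ C ∪ C' ∧ Circ r D ∧ e ∈ D ∧ g ∈ D from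
    H _ C C' h h' ⟨f, hf, hf'⟩ he hg rfl
  clear! C C' f
  intro n
  induction n using Nat.strong_induction_on with
  | _ n ih =>
  rintro C C' h h' ⟨f, hf, hf'⟩ he hg hn
  by_cases hgC : g ∈ C
  · exact ⟨C, Set.subset_union_left, h, he, hgC⟩
  by_cases heC : e ∈ C'
  · exact ⟨C', Set.subset_union_right, h', heC, hg⟩
  have key : ∀ A B : Set E, Circ r A → Circ r B → (A ∩ B).Nonempty → e ∈ A → g ∈ B →
      A ∪ B ⊆ C ∪ C' → (∃ D, D ⊆ C ∪ C' ∧ Circ r D ∧ e ∈ D ∧ g ∈ D) ∨ A ∪ B = C ∪ C' := by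
    intro A B hA hB hAB heA hgB hs
    by_cases heq : A ∪ B = C ∪ C'
    · exact Or.inr heq
    · left
      obtain ⟨D, hD, hD'⟩ := ih _ (hn ▸ Set.ncard_lt_ncard (hs.ssubset_of_ne heq)) A B hA hB hAB
        heA hgB rfl
      exact ⟨D, hD.trans hs, hD'⟩
  obtain ⟨C₃, h₃, he₃, hc₃⟩ := h.strong_elim h' hf hf' he heC
  obtain ⟨C₄, h₄, hg₄, hc₄⟩ := h'.strong_elim h hf' hf hg hgC
  have h₃' : C₃ ⊆ C ∪ C' := h₃.trans Set.sdiff_subset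
  have h₄' : C₄ ⊆ C ∪ C' := by rw [Set.union_comm]; exact h₄.trans Set.sdiff_subset
  obtain ⟨x, hx, hxC⟩ : ∃ x ∈ C₃, x ∉ C := by
    by_contra! hcon
    exact (h₃ (hc₃.eq_of_subset h hcon ▸ hf)).2 rfl
  obtain ⟨y, hy, hyC⟩ : ∃ y ∈ C₄, y ∉ C' := by
    by_contra! hcon
    exact (h₄ (hc₄.eq_of_subset h' hcon ▸ hf')).2 rfl
  rcases key C₃ C' hc₃ h' ⟨x, hx, (h₃' hx).resolve_left hxC⟩ he₃ hg
    (Set.union_subset h₃' Set.subset_union_right) with hD | heq₃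
  · exact hD
  have hy₃ : y ∈ C₃ := by
    have : y ∈ C₃ ∪ C' := heq₃ ▸ h₄' hy
    exact this.resolve_right hyC
  rcases key C₃ C₄ hc₃ hc₄ ⟨y, hy₃, hy⟩ he₃ hg₄ (Set.union_subset h₃' h₄') with hD | heq
  · exact hD
  · have : f ∈ C₃ ∪ C₄ := heq ▸ Or.inl hf
    rcases this with h | h
    · exact absurd rfl (h₃ h).2
    · exact absurd rfl (h₄ h).2

variable (r) in
/-- Two elements of `F` are equal or lie on a common circuit in `F`. -/
def CoCirc (F : Set E) (e f : E) : Prop := e = f ∨ ∃ C, C ⊆ F ∧ Circ r C ∧ e ∈ C ∧ f ∈ C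

theorem CoCirc.symm (h : CoCirc r F e f) : CoCirc r F f e :=
  h.imp Eq.symm fun ⟨C, h1, h2, h3, h4⟩ => ⟨C, h1, h2, h4, h3⟩

theorem CoCirc.trans [Finite E] (h : CoCirc r F e f) (h' : CoCirc r F f g) : CoCirc r F e g := by
  rcases h with rfl | ⟨C, h1, h2, h3, h4⟩
  · exact h'
  rcases h' with rfl | ⟨C', h1', h2', h3', h4'⟩
  · exact Or.inr ⟨C, h1, h2, h3, h4⟩
  obtain ⟨D, hD, hD'⟩ := h2.common h2' h4 h3' h3 h4'
  exact Or.inr ⟨D, hD.trans (Set.union_subset h1 h1'), hD'⟩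

theorem CoCirc.mono (h : CoCirc r F e f) (hF : F ⊆ F') : CoCirc r F' e f :=
  h.imp_right fun ⟨C, h1, h2⟩ => ⟨C, h1.trans hF, h2⟩

theorem Circ.rconn (h : Circ r C) : RConn r C :=
  ⟨h.nonempty, fun _ he _ hf => Or.inr ⟨C, le_rfl, h, he, hf⟩⟩

theorem rconn_of_coCirc [Finite E] (he : e ∈ F) (h : ∀ f ∈ F, CoCirc r F e f) : RConn r F :=
  ⟨⟨e, he⟩, fun f hf g hg => (h f hf).symm.trans (h g hg)⟩

/-- The circuit class of `e` in `F` is connected. -/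
theorem rconn_class [Finite E] (he : e ∈ F) : RConn r {f | f ∈ F ∧ CoCirc r F e f} := by
  refine rconn_of_coCirc (e := e) ⟨he, Or.inl rfl⟩ ?_
  rintro f ⟨hf, rfl | ⟨C, h1, h2, h3, h4⟩⟩
  · exact Or.inl rfl
  · exact Or.inr ⟨C, fun g hg => ⟨h1 hg, Or.inr ⟨C, h1, h2, h3, hg⟩⟩, h2, h3, h4⟩

theorem RConn.union [Finite E] (h : RConn r F) (h' : RConn r F') (hn : (F ∩ F').Nonempty) :
    RConn r (F ∪ F') := by
  obtain ⟨e, he, he'⟩ := hn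
  refine rconn_of_coCirc (e := e) (Or.inl he) ?_
  rintro f (hf | hf)
  · exact CoCirc.mono (h.2 e he f hf) Set.subset_union_left
  · exact CoCirc.mono (h'.2 e he' f hf) Set.subset_union_right

theorem RConn.insert [Finite E] (h : RConn r F) (he : Cl r F e) (h0 : Reg r {e}) :
    RConn r (insert e F) := by
  by_cases heF : e ∈ F
  · rwa [Set.insert_eq_of_mem heF]
  obtain ⟨C, hC, heC, hCirc⟩ := exists_circ_of_cl he heF
  have : ∃ f ∈ C, f ≠ e := by
    by_contra! hcon
    exact hCirc.1 (h0.mono hcon)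
  obtain ⟨f, hf, hfe⟩ := this
  have := h.union hCirc.rconn ⟨f, (hC hf).resolve_left hfe, hf⟩
  rwa [show F ∪ C = Insert.insert e F from subset_antisymm
    (Set.union_subset (Set.subset_insert _ _) hC)
    (Set.insert_subset (Or.inr heC) Set.subset_union_left)] at this

theorem RConn.cl [Finite E] (h : RConn r F) (h2 : 2 ≤ F.ncard) (he : e ∈ F) :
    Cl r (F \ {e}) e := by
  obtain ⟨f, hf, hfe⟩ := Set.exists_ne_of_one_lt_ncard h2 e
  rcases h.2 e he f hf with rfl | ⟨C, h1, h2, h3, h4⟩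
  · exact absurd rfl hfe
  · exact (h2.cl h3).mono (Set.sdiff_subset_sdiff_left h1)

/-- If no circuit of `K ∪ L` meets both parts then the two parts impose independent conditions. -/
theorem split_of_circ [Finite E] {K L : Set E} (hKL : Disjoint K L)
    (h : ∀ C, C ⊆ K ∪ L → Circ r C → C ⊆ K ∨ C ⊆ L) (d₁ d₂ : W) :
    ∃ d, (∀ e ∈ K, r e d = r e d₁) ∧ ∀ e ∈ L, r e d = r e d₂ := by
  classical
  obtain ⟨I, hI, hIr, hIc⟩ := exists_basis (r := r) K
  obtain ⟨J, hJ, hJr, hJc⟩ := exists_basis (r := r) L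
  have hr : Reg r (I ∪ J) := by
    by_contra hn
    obtain ⟨C, hC, hCc⟩ := exists_circ_of_not_reg hn
    rcases h C (hC.trans (Set.union_subset_union hI hJ)) hCc with h1 | h1
    · refine hCc.1 (hIr.mono fun x hx => (hC hx).resolve_right fun hx' => ?_)
      exact Set.disjoint_left.1 hKL (h1 hx) (hJ hx')
    · refine hCc.1 (hJr.mono fun x hx => (hC hx).resolve_left fun hx' => ?_)
      exact Set.disjoint_left.1 hKL (hI hx') (h1 hx)
  obtain ⟨d, hd⟩ := hr fun e => if e ∈ I then r e d₁ else r e d₂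
  refine ⟨d, fun e he => ?_, fun e he => ?_⟩
  · have := hIc e he (d - d₁) fun f hf => by simp [hd f (Or.inl hf), hf]
    simpa [sub_eq_zero] using this
  · have := hJc e he (d - d₂) fun f hf => by
      have : f ∉ I := fun hf' => Set.disjoint_left.1 hKL (hI hf') (hJ hf)
      simp [hd f (Or.inr hf), this]
    simpa [sub_eq_zero] using this

end LinearMatroid

section Plane

/-- The Euclidean inner product on the plane. -/
def ip (x y : Fin 2 → ℝ) : ℝ := x 0 * y 0 + x 1 * y 1

theorem ip_comm (x y : Fin 2 → ℝ) : ip x y = ip y x := by simp only [ip]; ring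

theorem ip_add_right (x y z : Fin 2 → ℝ) : ip x (y + z) = ip x y + ip x z := by
  simp only [ip, Pi.add_apply]; ring

theorem ip_sub_right (x y z : Fin 2 → ℝ) : ip x (y - z) = ip x y - ip x z := by
  simp only [ip, Pi.sub_apply]; ring

theorem ip_smul_right (c : ℝ) (x y : Fin 2 → ℝ) : ip x (c • y) = c * ip x y := by
  simp only [ip, Pi.smul_apply, smul_eq_mul]; ring

theorem ip_add_left (x y z : Fin 2 → ℝ) : ip (x + y) z = ip x z + ip y z := by
  simp only [ip, Pi.add_apply]; ring

theorem ip_sub_left (x y z : Fin 2 → ℝ) : ip (x - y) z = ip x z - ip y z := by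
  simp only [ip, Pi.sub_apply]; ring

theorem ip_smul_left (c : ℝ) (x y : Fin 2 → ℝ) : ip (c • x) y = c * ip x y := by
  simp only [ip, Pi.smul_apply, smul_eq_mul]; ring

@[simp] theorem ip_zero_left (x : Fin 2 → ℝ) : ip 0 x = 0 := by simp [ip]

@[simp] theorem ip_zero_right (x : Fin 2 → ℝ) : ip x 0 = 0 := by simp [ip]

theorem ip_self_nonneg (x : Fin 2 → ℝ) : 0 ≤ ip x x := by
  simp only [ip]; nlinarith [mul_self_nonneg (x 0), mul_self_nonneg (x 1)]

theorem ip_self_eq_zero {x : Fin 2 → ℝ} : ip x x = 0 ↔ x = 0 := by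
  refine ⟨fun h => ?_, fun h => by simp [h]⟩
  simp only [ip] at h
  ext i
  fin_cases i
  · simp; nlinarith [mul_self_nonneg (x 0), mul_self_nonneg (x 1)]
  · simp; nlinarith [mul_self_nonneg (x 0), mul_self_nonneg (x 1)]

theorem eDist_eq_iff {a b c d : Fin 2 → ℝ} :
    eDist a b = eDist c d ↔ ip (a - b) (a - b) = ip (c - d) (c - d) := by
  have h : ∀ x y : Fin 2 → ℝ, eDist x y = Real.sqrt (ip (x - y) (x - y)) := by
    intro x y
    simp [eDist, ip, sq]
  rw [h, h, Real.sqrt_inj (ip_self_nonneg _) (ip_self_nonneg _)]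

/-- Rotation by a right angle. -/
def rot (x : Fin 2 → ℝ) : Fin 2 → ℝ := ![-x 1, x 0]

@[simp] theorem rot_zero' (x : Fin 2 → ℝ) : rot x 0 = -x 1 := rfl

@[simp] theorem rot_one' (x : Fin 2 → ℝ) : rot x 1 = x 0 := rfl

theorem ip_rot_self (x : Fin 2 → ℝ) : ip x (rot x) = 0 := by
  simp only [ip, rot_zero', rot_one']; ring

/-- `x`, `y` are linearly independent. -/
def cross (x y : Fin 2 → ℝ) : ℝ := x 0 * y 1 - x 1 * y 0

/-- Solving a 2 × 2 linear system. -/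
theorem exists_ip_eq {x y : Fin 2 → ℝ} (h : cross x y ≠ 0) (a b : ℝ) :
    ∃ z, ip x z = a ∧ ip y z = b := by
  unfold cross at h
  refine ⟨![(a * y 1 - b * x 1) / (x 0 * y 1 - x 1 * y 0),
    (b * x 0 - a * y 0) / (x 0 * y 1 - x 1 * y 0)], ?_, ?_⟩
  · simp [ip]; field_simp; ring
  · have : x 0 * (y 1 * (x 0 * y 1 - x 1 * y 0)⁻¹) = 1 + x 1 * (y 0 * (x 0 * y 1 - x 1 * y 0)⁻¹) := by
      field_simp; ring
    simp [ip, div_eq_mul_inv]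
    linear_combination b * this

theorem eq_zero_of_ip_eq_zero {x y z : Fin 2 → ℝ} (h : cross x y ≠ 0) (hx : ip x z = 0)
    (hy : ip y z = 0) : z = 0 := by
  unfold cross at h; unfold ip at hx hy
  ext i
  fin_cases i
  · simp only [Fin.zero_eta, Pi.zero_apply]
    have : (x 0 * y 1 - x 1 * y 0) * z 0 = 0 := by linear_combination y 1 * hx - x 1 * hy
    exact (mul_eq_zero.1 this).resolve_left h
  · simp only [Fin.mk_one, Pi.zero_apply]
    have : (x 0 * y 1 - x 1 * y 0) * z 1 = 0 := by linear_combination x 0 * hy - y 0 * hx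
    exact (mul_eq_zero.1 this).resolve_left h

end Plane

section Rows

variable {V : Type*}

/-- The row of the rigidity matrix of an unordered pair, as a functional on motions. -/
def row (p : V → Fin 2 → ℝ) : Sym2 V → (V → Fin 2 → ℝ) →ₗ[ℝ] ℝ :=
  Sym2.lift ⟨fun u v =>
    { toFun := fun d => ip (p u - p v) (d u - d v)
      map_add' := fun x y => by simp only [ip, Pi.add_apply, Pi.sub_apply]; ring
      map_smul' := fun c x => by
        simp only [ip, Pi.smul_apply, Pi.sub_apply, smul_eq_mul, RingHom.id_apply]; ring },
    fun u v => by ext; simp [ip]; ring⟩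

@[simp] theorem row_mk (p d : V → Fin 2 → ℝ) (u v : V) :
    row p s(u, v) d = ip (p u - p v) (d u - d v) := rfl

theorem row_comm (p q : V → Fin 2 → ℝ) (e : Sym2 V) : row p e q = row q e p := by
  induction e with | _ u v => exact ip_comm _ _

theorem row_diag (p d : V → Fin 2 → ℝ) {e : Sym2 V} (h : e.IsDiag) : row p e d = 0 := by
  induction e with | _ u v => obtain rfl : u = v := h; simp

variable [DecidableEq V]

/-- `edgeVec` on unordered pairs, over any ring. -/
def evec {R : Type*} [CommRing R] (p : V → Fin 2 → R) : Sym2 V → V × Fin 2 → R :=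
  Sym2.lift ⟨fun u v => fun wi => if wi.1 = u then p u wi.2 - p v wi.2
            else if wi.1 = v then p v wi.2 - p u wi.2 else 0, fun u v => by
    ext ⟨w, i⟩
    by_cases h1 : w = u
    · by_cases h2 : w = v
      · simp [← h1, ← h2]
      · simp [← h1, h2]
    · by_cases h2 : w = v
      · simp [← h2, h1]
      · simp [h1, h2]⟩

theorem evec_map {R S : Type*} [CommRing R] [CommRing S] (φ : R →+* S) (p : V → Fin 2 → R)
    (e : Sym2 V) (wi : V × Fin 2) :
    φ (evec p e wi) = evec (fun v i => φ (p v i)) e wi := by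
  induction e with
  | _ u v =>
    simp only [evec, Sym2.lift_mk]
    split_ifs <;> simp

variable [Fintype V]

theorem evec_dot (p d : V → Fin 2 → ℝ) (e : Sym2 V) :
    ∑ wi, evec p e wi * d wi.1 wi.2 = row p e d := by
  induction e with
  | _ u v =>
    by_cases huv : u = v
    · subst huv
      simp [evec, ip]
    · have : ∀ w : V, ∑ i, evec p s(u, v) (w, i) * d w i =
          (if w = u then ip (p u - p v) (d u) else 0) +
            (if w = v then ip (p v - p u) (d v) else 0) := by
        intro w
        by_cases h1 : w = u
        · subst h1
          simp [evec, ip, huv]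
        · by_cases h2 : w = v
          · subst h2
            simp [evec, ip, h1]
          · simp [evec, h1, h2]
      rw [Fintype.sum_prod_type]
      simp only [this, Finset.sum_add_distrib, Finset.sum_ite_eq', Finset.mem_univ, if_true, row_mk]
      simp only [ip, Pi.sub_apply]; ring

/-- The Gram matrix of a set of rows. -/
def gram {R : Type*} [CommRing R] (p : V → Fin 2 → R) (F : Set (Sym2 V)) : Matrix F F R :=
  fun e f => ∑ wi, evec p e wi * evec p f wi

theorem gram_det_map {R S : Type*} [CommRing R] [CommRing S] (φ : R →+* S) (p : V → Fin 2 → R)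
    (F : Set (Sym2 V)) [Fintype F] [DecidableEq F] :
    φ (gram p F).det = (gram (fun v i => φ (p v i)) F).det := by
  rw [RingHom.map_det]
  congr 1
  ext e f
  simp [gram, evec_map]

theorem linearIndepOn_of_reg {p : V → Fin 2 → ℝ} {F : Set (Sym2 V)} (h : Reg (row p) F) :
    LinearIndepOn ℝ (evec p) F := by
  classical
  have : Fintype F := Fintype.ofFinite F
  rw [LinearIndepOn, Fintype.linearIndependent_iff]
  intro c hc e
  obtain ⟨d, hd⟩ := h fun f => if f = e then 1 else 0
  have h1 := congrArg (fun x : V × Fin 2 → ℝ => ∑ wi, x wi * d wi.1 wi.2) hc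
  simp only [Finset.sum_apply, Pi.smul_apply, smul_eq_mul, Finset.sum_mul, Pi.zero_apply,
    zero_mul, Finset.sum_const_zero] at h1
  rw [Finset.sum_comm] at h1
  simp only [mul_assoc, ← Finset.mul_sum, evec_dot] at h1
  rw [Finset.sum_eq_single e] at h1
  · simpa [hd e e.2] using h1
  · intro f _ hf
    rw [hd f f.2, if_neg (fun h => hf (Subtype.ext h)), mul_zero]
  · simp

theorem gram_det_ne_zero {p : V → Fin 2 → ℝ} {F : Set (Sym2 V)} [Fintype F] [DecidableEq F]
    (h : LinearIndepOn ℝ (evec p) F) : (gram p F).det ≠ 0 := by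
  intro h0
  obtain ⟨x, hx, hx0⟩ := Matrix.exists_mulVec_eq_zero_iff.2 h0
  apply hx
  rw [LinearIndepOn, Fintype.linearIndependent_iff] at h
  ext e
  refine h x ?_ e
  have h1 : ∑ wi, (∑ e : F, x e * evec p e wi) * (∑ e : F, x e * evec p e wi) = 0 := by
    have : ∑ e, x e * (gram p F).mulVec x e = 0 := by simp [hx0]
    rw [← this]
    simp only [Matrix.mulVec, dotProduct, gram, Finset.sum_mul_sum]
    rw [Finset.sum_comm]
    refine Finset.sum_congr rfl fun e _ => ?_
    rw [Finset.sum_comm, Finset.mul_sum]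
    refine Finset.sum_congr rfl fun f _ => ?_
    rw [Finset.sum_mul, Finset.mul_sum]
    refine Finset.sum_congr rfl fun w _ => ?_
    ring
  rw [Finset.sum_eq_zero_iff_of_nonneg fun _ _ => mul_self_nonneg _] at h1
  ext wi
  simpa using h1 wi (Finset.mem_univ _)

theorem reg_of_gram_det_ne_zero {p : V → Fin 2 → ℝ} {F : Set (Sym2 V)} [Fintype F]
    [DecidableEq F] (h : (gram p F).det ≠ 0) : Reg (row p) F := by
  intro c
  set x := (gram p F)⁻¹.mulVec fun e : F => c e with hx
  have hx' : (gram p F).mulVec x = fun e : F => c e := by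
    rw [hx, Matrix.mulVec_mulVec, Matrix.mul_nonsing_inv _ (isUnit_iff_ne_zero.2 h),
      Matrix.one_mulVec]
  refine ⟨fun w i => ∑ f : F, x f * evec p f (w, i), fun e he => ?_⟩
  rw [← evec_dot]
  refine Eq.trans ?_ (congrFun hx' ⟨e, he⟩)
  simp only [Matrix.mulVec, dotProduct, gram, Finset.mul_sum, Finset.sum_mul]
  rw [Finset.sum_comm]
  refine Finset.sum_congr rfl fun f _ => Finset.sum_congr rfl fun w _ => ?_
  ring

theorem reg_iff_linearIndepOn {p : V → Fin 2 → ℝ} {F : Set (Sym2 V)} :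
    Reg (row p) F ↔ LinearIndepOn ℝ (evec p) F := by
  classical
  have : Fintype F := Fintype.ofFinite F
  exact ⟨linearIndepOn_of_reg, fun h => reg_of_gram_det_ne_zero (gram_det_ne_zero h)⟩

theorem Generic.reg {p p₀ : V → Fin 2 → ℝ} (hp : Generic p) {F : Set (Sym2 V)}
    (h : Reg (row p₀) F) : Reg (row p) F := by
  classical
  have : Fintype F := Fintype.ofFinite F
  apply reg_of_gram_det_ne_zero
  have h0 := gram_det_ne_zero (linearIndepOn_of_reg h)
  set D : MvPolynomial (V × Fin 2) ℚ := (gram (fun v i => MvPolynomial.X (v, i)) F).det with hD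
  have hmap : ∀ q : V → Fin 2 → ℝ,
      MvPolynomial.aeval (fun vi : V × Fin 2 => q vi.1 vi.2) D = (gram q F).det := by
    intro q
    have := gram_det_map
      (MvPolynomial.aeval (R := ℚ) (fun vi : V × Fin 2 => q vi.1 vi.2)).toRingHom
      (fun v i => MvPolynomial.X (v, i)) F
    simpa using this
  have hD0 : D ≠ 0 := fun h => h0 (by rw [← hmap, h, map_zero])
  intro hz
  rw [← hmap] at hz
  exact hD0 ((algebraicIndependent_iff.1 hp) D hz)

theorem rankAt_eq {p : V → Fin 2 → ℝ} {F I : Set (Sym2 V)} (hI : I ⊆ F) (hr : Reg (row p) I)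
    (hc : ∀ f ∈ F, Cl (row p) I f) : rankAt 2 p F = I.ncard := by
  have hset : {x : V × Fin 2 → ℝ | ∃ u v : V, s(u, v) ∈ F ∧ x = edgeVec p u v} =
      evec p '' F := by
    ext x
    constructor
    · rintro ⟨u, v, h, rfl⟩
      exact ⟨_, h, rfl⟩
    · rintro ⟨e, he, rfl⟩
      induction e with | _ u v => exact ⟨u, v, he, rfl⟩
  have hspan : Submodule.span ℝ (evec p '' F) = Submodule.span ℝ (evec p '' I) := by
    refine le_antisymm ?_ (Submodule.span_mono (Set.image_mono hI))
    rw [Submodule.span_le]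
    rintro _ ⟨e, he, rfl⟩
    by_contra hn
    by_cases heI : e ∈ I
    · exact hn (Submodule.subset_span ⟨e, heI, rfl⟩)
    have := reg_iff_linearIndepOn.2 ((linearIndepOn_of_reg hr).insert hn)
    have h2 := this.not_cl (Set.mem_insert e I)
    rw [Set.insert_sdiff_self_of_notMem heI] at h2
    exact h2 (hc e he)
  have : Fintype I := Fintype.ofFinite I
  rw [rankAt, hset, hspan, Set.image_eq_range, finrank_span_eq_card (linearIndepOn_of_reg hr),
    ← Nat.card_eq_fintype_card, Nat.card_coe_set_eq]

theorem Reg.ncard_le {p : V → Fin 2 → ℝ} {F I J : Set (Sym2 V)} (hI : I ⊆ F)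
    (hr : Reg (row p) I) (hc : ∀ f ∈ F, Cl (row p) I f) (hJ : J ⊆ F) (hJr : Reg (row p) J) :
    J.ncard ≤ I.ncard := by
  obtain ⟨B, hJB, hBF, hB, hBc⟩ := exists_basis_superset hJr hJ
  rw [← rankAt_eq hI hr hc, rankAt_eq hBF hB hBc]
  exact Set.ncard_le_ncard hJB

theorem Generic.rd_eq {p : V → Fin 2 → ℝ} (hp : Generic p) {F I : Set (Sym2 V)} (hI : I ⊆ F)
    (hr : Reg (row p) I) (hc : ∀ f ∈ F, Cl (row p) I f) : rd 2 F = I.ncard := by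
  have hle : ∀ n ∈ {n : ℕ | ∃ p : V → Fin 2 → ℝ, n = rankAt 2 p F}, n ≤ I.ncard := by
    rintro n ⟨p₀, rfl⟩
    obtain ⟨J, hJ, hJr, hJc⟩ := exists_basis (r := row p₀) F
    rw [rankAt_eq hJ hJr hJc]
    exact Reg.ncard_le hI hr hc hJ (hp.reg hJr)
  refine le_antisymm (csSup_le' hle) (le_csSup ⟨_, hle⟩ ⟨p, (rankAt_eq hI hr hc).symm⟩)

theorem Generic.rdIndep_iff {p : V → Fin 2 → ℝ} (hp : Generic p) {F : Set (Sym2 V)} :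
    RdIndep 2 F ↔ Reg (row p) F := by
  obtain ⟨I, hI, hr, hc⟩ := exists_basis (r := row p) F
  rw [RdIndep, hp.rd_eq hI hr hc]
  constructor
  · intro h
    rwa [← Set.eq_of_subset_of_ncard_le hI h.ge]
  · intro h
    exact le_antisymm (Set.ncard_le_ncard hI) (Reg.ncard_le hI hr hc le_rfl h)

theorem Generic.rdCircuit_iff {p : V → Fin 2 → ℝ} (hp : Generic p) {C : Set (Sym2 V)} :
    RdCircuit 2 C ↔ Circ (row p) C := by
  simp only [RdCircuit, Circ, hp.rdIndep_iff]

theorem Generic.isRdBridge_iff {p : V → Fin 2 → ℝ} (hp : Generic p) {G : SimpleGraph V}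
    {e : Sym2 V} :
    IsRdBridge 2 G e ↔ e ∈ G.edgeSet ∧ ¬ Cl (row p) (G.edgeSet \ {e}) e := by
  refine and_congr_right fun he => ?_
  obtain ⟨I, hI, hr, hc⟩ := exists_basis (r := row p) (G.edgeSet \ {e})
  rw [hp.rd_eq hI hr hc]
  have heI : e ∉ I := fun h => (hI h).2 rfl
  by_cases hcl : Cl (row p) (G.edgeSet \ {e}) e
  · rw [hp.rd_eq (hI.trans Set.sdiff_subset) hr fun f hf => ?_]
    · simp [hcl]
    · by_cases hfe : f = e
      · subst hfe; exact hcl.trans hc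
      · exact hc f ⟨hf, hfe⟩
  · rw [hp.rd_eq (F := G.edgeSet) (I := insert e I)
      (Set.insert_subset he (hI.trans Set.sdiff_subset)) (hr.insert fun h => hcl (h.mono hI))
      fun f hf => ?_, Set.ncard_insert_of_notMem heI]
    · simp [hcl]
    · by_cases hfe : f = e
      · subst hfe; exact Cl.of_mem (Set.mem_insert _ _)
      · exact (hc f ⟨hf, hfe⟩).mono (Set.subset_insert _ _)

end Rows

section Transcendence

theorem exists_infinite_algebraicIndependent :
    ∃ s : Set ℝ, s.Infinite ∧ AlgebraicIndependent ℚ ((↑) : s → ℝ) := by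
  obtain ⟨s, hs⟩ := exists_isTranscendenceBasis ℚ ℝ
  refine ⟨s, fun hfin => ?_, hs.1⟩
  have : Finite s := hfin
  have h1 : Countable (Algebra.adjoin ℚ (Set.range ((↑) : s → ℝ))) := by
    have hc : Countable (MvPolynomial s ℚ) := by
      rw [← Cardinal.mk_le_aleph0_iff]
      refine MvPolynomial.cardinalMk_le_max.trans ?_
      simp
    exact hs.1.aevalEquiv.toEquiv.countable_iff.1 hc
  have h2 := hs.isAlgebraic
  have h3 := Algebra.IsAlgebraic.cardinalMk_le_max (Algebra.adjoin ℚ (Set.range ((↑) : s → ℝ))) ℝ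
  rw [max_eq_right (Cardinal.mk_le_aleph0_iff.2 h1), Cardinal.mk_le_aleph0_iff] at h3
  exact not_countable h3

theorem algebraicIndependent_add_rat {ι : Type*} {x : ι → ℝ} (hx : AlgebraicIndependent ℚ x)
    (q : ι → ℚ) : AlgebraicIndependent ℚ fun i => x i + q i := by
  have key : ∀ q : ι → ℚ, (MvPolynomial.aeval fun i => MvPolynomial.X i + MvPolynomial.C (q i) :
      MvPolynomial ι ℚ →ₐ[ℚ] MvPolynomial ι ℚ).comp
      (MvPolynomial.aeval fun i => MvPolynomial.X i - MvPolynomial.C (q i)) = AlgHom.id ℚ _ := by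
    intro q
    ext i
    simp
  have hinj : Function.Injective (MvPolynomial.aeval fun i =>
      MvPolynomial.X i + MvPolynomial.C (q i) : MvPolynomial ι ℚ →ₐ[ℚ] MvPolynomial ι ℚ) := by
    have := key fun i => - q i
    simp only [map_neg, sub_neg_eq_add, ← sub_eq_add_neg] at this
    intro y z hyz
    have h := fun y => DFunLike.congr_fun this y
    simp only [AlgHom.comp_apply, AlgHom.id_apply] at h
    rw [← h y, hyz, h z]
  have : (MvPolynomial.aeval (fun i => x i + q i) : MvPolynomial ι ℚ →ₐ[ℚ] ℝ) =
      (MvPolynomial.aeval x).comp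
        (MvPolynomial.aeval fun i => MvPolynomial.X i + MvPolynomial.C (q i)) := by
    ext i
    simp
  change Function.Injective (MvPolynomial.aeval fun i => x i + (q i : ℝ) : MvPolynomial ι ℚ →ₐ[ℚ] ℝ)
  rw [this, AlgHom.coe_comp]
  exact Function.Injective.comp hx hinj

open TrivSqZeroExt in
open scoped IntermediateField.algebraAdjoinAdjoin in
theorem exists_derivation {ι : Type*} {x : ι → ℝ} (hx : AlgebraicIndependent ℚ x) (η : ι → ℝ) :
    ∃ D : ℝ → ℝ, (∀ a b, D (a + b) = D a + D b) ∧ (∀ a b, D (a * b) = a * D b + b * D a) ∧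
      ∀ i, D (x i) = η i := by
  obtain ⟨T, hxT, hT⟩ := exists_isTranscendenceBasis_superset (_root_.AlgebraicIndependent.coe_range hx)
  let v : T → ℝ := fun t => (t : ℝ)
  let A := Algebra.adjoin ℚ (Set.range v)
  let K := IntermediateField.adjoin ℚ (Set.range v)
  have hsm : Algebra.FormallySmooth A ℝ := by
    have h1 : Algebra.FormallySmooth A K := .of_isLocalization (nonZeroDivisors _)
    have : Algebra.IsAlgebraic K ℝ := by
      have h := hT.isAlgebraic
      exact Algebra.IsAlgebraic.extendScalars (R := A) (S := K) (FaithfulSMul.algebraMap_injective A K)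
    have h2 : Algebra.FormallyEtale K ℝ := Algebra.FormallyEtale.of_isSeparable _ ℝ
    exact .comp _ K _
  let ζ : T → ℝ := fun t => Function.extend x η 0 (t : ℝ)
  let ψ : MvPolynomial T ℚ →ₐ[ℚ] TrivSqZeroExt ℝ ℝ := MvPolynomial.aeval fun t => inl (t : ℝ) + inr (ζ t)
  let φ : A →ₐ[ℚ] TrivSqZeroExt ℝ ℝ := ψ.comp hT.1.aevalEquiv.symm.toAlgHom
  have hfst : ∀ a : A, (φ a).fst = (a : ℝ) := by
    intro a
    obtain ⟨b, rfl⟩ := hT.1.aevalEquiv.surjective a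
    have : ((fstHom ℚ ℝ ℝ).comp ψ) = MvPolynomial.aeval v := by
      ext t; simp [ψ, v]
    have h := DFunLike.congr_fun this b
    simp only [φ, AlgHom.comp_apply, AlgEquiv.coe_toAlgHom, AlgEquiv.symm_apply_apply]
    exact h.trans (hT.1.algebraMap_aevalEquiv b).symm
  let _ : Algebra A (TrivSqZeroExt ℝ ℝ) := φ.toRingHom.toAlgebra
  let g : TrivSqZeroExt ℝ ℝ →ₐ[A] ℝ :=
    { (fstHom ℚ ℝ ℝ).toRingHom with commutes' := fun a => hfst a }
  have hg : Function.Surjective g := fun y => ⟨inl y, rfl⟩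
  have hker : IsNilpotent (RingHom.ker (g : TrivSqZeroExt ℝ ℝ →+* ℝ)) := by
    refine ⟨2, ?_⟩
    refine le_bot_iff.1 ((pow_two (RingHom.ker (g : TrivSqZeroExt ℝ ℝ →+* ℝ))).le.trans ?_)
    rw [Ideal.mul_le]
    intro a ha b hb
    have ha' : a.fst = 0 := ha
    have hb' : b.fst = 0 := hb
    rw [Ideal.mem_bot]
    ext <;> simp [ha', hb']
  let f := Algebra.FormallySmooth.liftOfSurjective (AlgHom.id A ℝ) g hg hker
  have hf : ∀ y, (f y).fst = y := fun y =>
    Algebra.FormallySmooth.liftOfSurjective_apply (AlgHom.id A ℝ) g hg hker y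
  refine ⟨fun y => (f y).snd, fun a b => by simp, fun a b => ?_, fun i => ?_⟩
  · simp [hf, mul_comm]
  · have hxi : x i ∈ T := hxT ⟨i, rfl⟩
    let a : A := ⟨x i, Algebra.subset_adjoin ⟨⟨x i, hxi⟩, rfl⟩⟩
    have h1 : f (algebraMap A ℝ a) = algebraMap A (TrivSqZeroExt ℝ ℝ) a := f.commutes a
    have h2 : hT.1.aevalEquiv.symm a = MvPolynomial.X ⟨x i, hxi⟩ := by
      rw [AlgEquiv.symm_apply_eq]
      apply Subtype.ext
      change _ = ((algebraMap A ℝ) (hT.1.aevalEquiv _))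
      rw [AlgebraicIndependent.algebraMap_aevalEquiv]
      simp [a, v]
    have h3 : algebraMap A (TrivSqZeroExt ℝ ℝ) a = inl (x i) + inr (ζ ⟨x i, hxi⟩) := by
      change ψ (hT.1.aevalEquiv.symm a) = _
      rw [h2]
      simp [ψ]
    change (f (algebraMap A ℝ a)).snd = _
    rw [h1, h3]
    simp [ζ, hx.injective.extend_apply]

end Transcendence

section Generic

variable {V : Type*}

theorem exists_generic [Fintype V]: ∃ p : V → Fin 2 → ℝ, Generic p := by
  obtain ⟨s, hs, hi⟩ := exists_infinite_algebraicIndependent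
  have := hs.to_subtype
  obtain ⟨f⟩ : Nonempty (V × Fin 2 ↪ s) := by
    obtain ⟨e⟩ := Finite.exists_equiv_fin (V × Fin 2) |>.choose_spec
    exact ⟨e.toEmbedding.trans (Fin.valEmbedding.trans (Infinite.natEmbedding s))⟩
  exact ⟨fun v i => f (v, i), hi.comp f f.injective⟩

theorem dense_generic [Fintype V] : Dense {p : V → Fin 2 → ℝ | Generic p} := by
  obtain ⟨t, ht⟩ := exists_generic (V := V)
  rw [Metric.dense_iff]
  intro y ε hε
  have : ∀ v i, ∃ q : ℚ, y v i - t v i - ε / 2 < q ∧ (q : ℝ) < y v i - t v i + ε / 2 :=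
    fun v i => exists_rat_btwn (by linarith)
  choose q hq using this
  refine ⟨fun v i => t v i + q v i, ?_, algebraicIndependent_add_rat ht fun vi => q vi.1 vi.2⟩
  rw [Metric.mem_ball, dist_pi_lt_iff hε]
  intro v
  rw [dist_pi_lt_iff hε]
  intro i
  rw [Real.dist_eq, abs_lt]
  constructor <;> linarith [(hq v i).1, (hq v i).2]

variable {p : V → Fin 2 → ℝ} (hp : Generic p)
include hp

theorem Generic.aeval_ne_zero {P : MvPolynomial (V × Fin 2) ℚ} (hP : P ≠ 0) :
    MvPolynomial.aeval (fun vi : V × Fin 2 => p vi.1 vi.2) P ≠ 0 := fun h =>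
  hP (algebraicIndependent_iff.1 hp P h)

theorem Generic.cross_ne_zero {a b c : V} (hab : a ≠ b) (hac : a ≠ c) (hbc : b ≠ c) :
    cross (p b - p a) (p c - p a) ≠ 0 := by
  classical
  have := hp.aeval_ne_zero (P := (MvPolynomial.X (b, 0) - MvPolynomial.X (a, 0)) *
    (MvPolynomial.X (c, 1) - MvPolynomial.X (a, 1)) - (MvPolynomial.X (b, 1) - MvPolynomial.X (a, 1)) *
    (MvPolynomial.X (c, 0) - MvPolynomial.X (a, 0))) (fun h => by
      have := congrArg (MvPolynomial.aeval fun vi : V × Fin 2 =>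
        if vi = (b, 0) then (1 : ℚ) else if vi = (c, 1) then 1 else 0) h
      simp [hab, hac, hbc, hbc.symm] at this)
  simpa [cross] using this

theorem Generic.injective : Function.Injective p := by
  intro u v h
  by_contra hne
  have := AlgebraicIndependent.injective (show AlgebraicIndependent ℚ _ from hp) (a₁ := (u, 0)) (a₂ := (v, 0)) (congrFun h 0)
  exact hne (congrArg Prod.fst this)

end Generic

section Rigid

variable {V : Type*}

/-- An infinitesimal isometry of the plane, evaluated at the points of a placement. -/
def triv (q : V → Fin 2 → ℝ) (ρ : ℝ) (c : Fin 2 → ℝ) : V → Fin 2 → ℝ :=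
  fun v => ρ • rot (q v) + c

theorem row_triv (q : V → Fin 2 → ℝ) (ρ : ℝ) (c : Fin 2 → ℝ) (e : Sym2 V) :
    row q e (triv q ρ c) = 0 := by
  induction e with
  | _ u v =>
    simp only [row_mk, triv, ip, Pi.sub_apply, Pi.add_apply, Pi.smul_apply, smul_eq_mul, rot_zero',
      rot_one']
    ring

theorem row_congr (q : V → Fin 2 → ℝ) {d d' : V → Fin 2 → ℝ} {e : Sym2 V}
    (h : ∀ v ∈ e, d v = d' v) : row q e d = row q e d' := by
  induction e with
  | _ u v => simp [h u (by simp), h v (by simp)]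

theorem row_congr_left {q q' : V → Fin 2 → ℝ} (d : V → Fin 2 → ℝ) {e : Sym2 V}
    (h : ∀ v ∈ e, q v = q' v) : row q e d = row q' e d := by
  rw [row_comm, row_congr d h, row_comm]

theorem row_self_eq_zero {q : V → Fin 2 → ℝ} {u v : V} :
    row q s(u, v) q = 0 ↔ q u = q v := by
  rw [row_mk, ip_self_eq_zero, sub_eq_zero]

theorem exists_triv_pair {q d : V → Fin 2 → ℝ} {x y : V} (hq : q x ≠ q y)
    (h : row q s(x, y) d = 0) : ∃ ρ c, d x = triv q ρ c x ∧ d y = triv q ρ c y := by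
  have hn : ip (q x - q y) (q x - q y) ≠ 0 := by
    rwa [Ne, ip_self_eq_zero, sub_eq_zero]
  let ρ := cross (q x - q y) (d x - d y) / ip (q x - q y) (q x - q y)
  have hρ : ρ * ip (q x - q y) (q x - q y) = cross (q x - q y) (d x - d y) :=
    div_mul_cancel₀ _ hn
  refine ⟨ρ, d x - ρ • rot (q x), by simp [triv], ?_⟩
  rw [row_mk] at h
  simp only [ip, cross, Pi.sub_apply] at h hρ hn
  have h0 : d x 0 - d y 0 = -ρ * (q x 1 - q y 1) := by
    apply mul_left_cancel₀ hn
    linear_combination (q x 0 - q y 0) * h - (q x 1 - q y 1) * -hρ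
  have h1 : d x 1 - d y 1 = ρ * (q x 0 - q y 0) := by
    apply mul_left_cancel₀ hn
    linear_combination (q x 1 - q y 1) * h - (q x 0 - q y 0) * hρ
  ext i
  fin_cases i
  · simp [triv]; linarith
  · simp [triv]; linarith

theorem eq_of_row_eq {q d d' : V → Fin 2 → ℝ} {x y z : V}
    (hq : cross (q z - q x) (q z - q y) ≠ 0) (hx : d x = d' x) (hy : d y = d' y)
    (hzx : row q s(z, x) d = row q s(z, x) d') (hzy : row q s(z, y) d = row q s(z, y) d') :
    d z = d' z := by
  simp only [row_mk, hx, hy, ip_sub_right] at hzx hzy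
  rw [← sub_eq_zero]
  refine eq_zero_of_ip_eq_zero hq ?_ ?_ <;> simp only [ip_sub_right, ip_sub_left] at * <;> linarith

theorem cross_ne_symm {x y z : Fin 2 → ℝ} (h : cross (y - x) (z - x) ≠ 0) :
    cross (x - y) (x - z) ≠ 0 := by
  simp only [cross, Pi.sub_apply] at *
  contrapose h
  linarith

variable {p : V → Fin 2 → ℝ}

/-- The bars in `F` make the points of `X` infinitesimally rigid. -/
def Rig (p : V → Fin 2 → ℝ) (F : Set (Sym2 V)) (X : Set V) : Prop :=
  ∀ x ∈ X, ∀ y ∈ X, Cl (row p) F s(x, y)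

theorem Rig.mono {F F' : Set (Sym2 V)} {X X' : Set V} (h : Rig p F X) (hF : F ⊆ F')
    (hX : X' ⊆ X) : Rig p F' X' := fun x hx y hy => (h x (hX hx) y (hX hy)).mono hF

theorem Rig.trans {F F' : Set (Sym2 V)} {X : Set V} (h : Rig p F X)
    (hF : ∀ f ∈ F, Cl (row p) F' f) : Rig p F' X := fun x hx y hy => (h x hx y hy).trans hF

theorem cl_diag (F : Set (Sym2 V)) (x : V) : Cl (row p) F s(x, x) := fun d _ =>
  row_diag p d (Sym2.mk_isDiag_iff.2 rfl)

theorem Generic.exists_triv (hp : Generic p) {d : V → Fin 2 → ℝ} {X : Set V}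
    (h : ∀ x ∈ X, ∀ y ∈ X, row p s(x, y) d = 0) : ∃ ρ c, ∀ x ∈ X, d x = triv p ρ c x := by
  by_cases hX : ∃ x ∈ X, ∃ y ∈ X, x ≠ y
  · obtain ⟨x, hx, y, hy, hxy⟩ := hX
    obtain ⟨ρ, c, h1, h2⟩ := exists_triv_pair (hp.injective.ne hxy) (h x hx y hy)
    refine ⟨ρ, c, fun z hz => ?_⟩
    by_cases hzx : z = x
    · rw [hzx, h1]
    by_cases hzy : z = y
    · rw [hzy, h2]
    refine eq_of_row_eq (q := p) (cross_ne_symm (hp.cross_ne_zero ?_ ?_ ?_)) h1 h2 ?_ ?_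
    · exact hzx
    · exact hzy
    · exact hxy
    · rw [h z hz x hx, row_triv]
    · rw [h z hz y hy, row_triv]
  · push Not at hX
    by_cases hX' : X.Nonempty
    · obtain ⟨x, hx⟩ := hX'
      exact ⟨0, d x, fun y hy => by simp [triv, hX x hx y hy]⟩
    · exact ⟨0, 0, fun y hy => absurd ⟨y, hy⟩ hX'⟩

theorem Generic.rig_triv (hp : Generic p) {F : Set (Sym2 V)} {X : Set V} (h : Rig p F X)
    {d : V → Fin 2 → ℝ} (hd : ∀ e ∈ F, row p e d = 0) : ∃ ρ c, ∀ x ∈ X, d x = triv p ρ c x :=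
  hp.exists_triv fun x hx y hy => h x hx y hy d hd

/-- To check rigidity it suffices to consider motions fixing a given pair of points. -/
theorem Generic.rig_of_fixed (hp : Generic p) {F : Set (Sym2 V)} {X : Set V} {x y : V}
    (hxy : x ≠ y) (h : Cl (row p) F s(x, y))
    (hX : ∀ d : V → Fin 2 → ℝ, (∀ e ∈ F, row p e d = 0) → d x = 0 → d y = 0 → ∀ z ∈ X, d z = 0) :
    Rig p F X := by
  intro u hu v hv d hd
  obtain ⟨ρ, c, h1, h2⟩ := exists_triv_pair (hp.injective.ne hxy) (h d hd)
  have := hX (d - triv p ρ c) (fun e he => by rw [map_sub, hd e he, row_triv, sub_zero])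
    (by simp [h1]) (by simp [h2])
  have h3 := row_congr p (e := s(u, v)) (d := d - triv p ρ c) (d' := 0) (by
    intro w hw
    rcases Sym2.mem_iff.1 hw with rfl | rfl
    · exact this _ hu
    · exact this _ hv)
  simpa [row_triv, map_sub] using h3

theorem Generic.rig_fixed (hp : Generic p) {F : Set (Sym2 V)} {X : Set V} (h : Rig p F X)
    {x y : V} (hx : x ∈ X) (hy : y ∈ X) (hxy : x ≠ y) {d : V → Fin 2 → ℝ}
    (hd : ∀ e ∈ F, row p e d = 0) (hdx : d x = 0) (hdy : d y = 0) : ∀ z ∈ X, d z = 0 := by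
  intro z hz
  by_cases hzx : z = x
  · rw [hzx, hdx]
  by_cases hzy : z = y
  · rw [hzy, hdy]
  refine eq_of_row_eq (d' := 0) (q := p) (cross_ne_symm (hp.cross_ne_zero hzx
    hzy hxy)) hdx hdy ?_ ?_
  · rw [h z hz x hx d hd, map_zero]
  · rw [h z hz y hy d hd, map_zero]

theorem Generic.rig_union (hp : Generic p) {F : Set (Sym2 V)} {X Y : Set V} (hX : Rig p F X)
    (hY : Rig p F Y) {x y : V} (hxy : x ≠ y) (hxX : x ∈ X) (hyX : y ∈ X) (hxY : x ∈ Y)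
    (hyY : y ∈ Y) : Rig p F (X ∪ Y) := by
  refine hp.rig_of_fixed hxy (hX x hxX y hyX) fun d hd hdx hdy z hz => ?_
  rcases hz with hz | hz
  · exact hp.rig_fixed hX hxX hyX hxy hd hdx hdy z hz
  · exact hp.rig_fixed hY hxY hyY hxy hd hdx hdy z hz

end Rigid

section Neighbours

variable {V : Type*}

/-- The neighbours of `v` in the graph with edge set `F`. -/
def nb (F : Set (Sym2 V)) (v : V) : Set V := {n | s(v, n) ∈ F}

theorem mem_vertexSpan {F : Set (Sym2 V)} {v : V} : v ∈ vertexSpan F ↔ (nb F v).Nonempty := by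
  constructor
  · rintro ⟨e, he, hv⟩
    obtain ⟨w, rfl⟩ := hv
    exact ⟨w, he⟩
  · rintro ⟨w, hw⟩
    exact ⟨_, hw, by simp⟩

theorem vertexSpan_mono {F F' : Set (Sym2 V)} (h : F ⊆ F') : vertexSpan F ⊆ vertexSpan F' :=
  fun _ ⟨e, he, hv⟩ => ⟨e, h he, hv⟩

theorem left_mem_vertexSpan {F : Set (Sym2 V)} {u v : V} (h : s(u, v) ∈ F) : u ∈ vertexSpan F :=
  ⟨_, h, by simp⟩

theorem right_mem_vertexSpan {F : Set (Sym2 V)} {u v : V} (h : s(u, v) ∈ F) : v ∈ vertexSpan F :=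
  ⟨_, h, by simp⟩

theorem sum_nb [Fintype V] {F : Set (Sym2 V)} (hF : ∀ e ∈ F, ¬ e.IsDiag) :
    ∑ v, (nb F v).ncard = 2 * F.ncard := by
  classical
  have h := (SimpleGraph.fromEdgeSet F).sum_degrees_eq_twice_card_edges
  have hE : (SimpleGraph.fromEdgeSet F).edgeSet = F := by
    rw [SimpleGraph.edgeSet_fromEdgeSet]
    ext e
    exact ⟨fun h => h.1, fun h => ⟨h, hF e h⟩⟩
  calc ∑ v, (nb F v).ncard = ∑ v, (SimpleGraph.fromEdgeSet F).degree v := by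
        refine Finset.sum_congr rfl fun v _ => ?_
        rw [← SimpleGraph.card_neighborFinset_eq_degree, ← Set.ncard_coe_finset]
        congr 1
        ext w
        simp only [nb, Set.mem_ofPred_eq, SimpleGraph.coe_neighborFinset,
          SimpleGraph.mem_neighborSet, SimpleGraph.fromEdgeSet_adj]
        refine ⟨fun h => ⟨h, ?_⟩, fun h => h.1⟩
        rintro rfl
        exact hF _ h (by simp)
    _ = 2 * F.ncard := by rw [h, ← Set.ncard_coe_finset, SimpleGraph.coe_edgeFinset, hE]

end Neighbours

section Pinned

variable {V : Type*}

/-- The rows of `B` at the placement `q` can be prescribed by motions vanishing on `P`. -/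
def PinSurj (q : V → Fin 2 → ℝ) (P : Set V) (B : Set (Sym2 V)) : Prop :=
  ∀ c : Sym2 V → ℝ, ∃ d : V → Fin 2 → ℝ, (∀ v ∈ P, d v = 0) ∧ ∀ e ∈ B, row q e d = c e

theorem pinSurj_empty {q : V → Fin 2 → ℝ} {B : Set (Sym2 V)} :
    PinSurj q ∅ B ↔ Reg (row q) B := by
  simp [PinSurj, Reg]

theorem PinSurj.mono {q : V → Fin 2 → ℝ} {P P' : Set V} {B B' : Set (Sym2 V)}
    (h : PinSurj q P B) (hP : P' ⊆ P) (hB : B' ⊆ B) : PinSurj q P' B' := fun c =>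
  (h c).imp fun _ hd => ⟨fun v hv => hd.1 v (hP hv), fun e he => hd.2 e (hB he)⟩

theorem PinSurj.congr {q q' : V → Fin 2 → ℝ} {P : Set V} {B : Set (Sym2 V)}
    (h : PinSurj q P B) (hq : ∀ e ∈ B, ∀ v ∈ e, q v = q' v) : PinSurj q' P B := fun c =>
  (h c).imp fun d hd => ⟨hd.1, fun e he => by rw [← row_congr_left d (hq e he), hd.2 e he]⟩

variable [DecidableEq V]

/-- Adding a vertex whose incident rows can be prescribed at that vertex. -/
theorem PinSurj.of_star {q : V → Fin 2 → ℝ} {P : Set V} {B : Set (Sym2 V)} {v : V} (hv : v ∉ P)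
    (h : PinSurj q P {e | e ∈ B ∧ v ∉ e})
    (hs : ∀ c : V → ℝ, ∃ z, ∀ n ∈ nb B v, ip (q v - q n) z = c n) : PinSurj q P B := by
  intro c
  obtain ⟨d, hd0, hd⟩ := h c
  obtain ⟨z, hz⟩ := hs fun n => c s(v, n) + ip (q v - q n) (d n)
  refine ⟨Function.update d v z, fun w hw => ?_, fun e he => ?_⟩
  · rw [Function.update_of_ne (ne_of_mem_of_not_mem hw hv), hd0 w hw]
  · by_cases hve : v ∈ e
    · obtain ⟨n, rfl⟩ := hve
      have hn : n ≠ v := by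
        rintro rfl
        obtain ⟨z', hz'⟩ := hs fun _ => 1
        simpa using hz' n he
      have := hz n he
      rw [row_mk, Function.update_self, Function.update_of_ne hn, ip_sub_right, this]
      ring
    · rw [← hd e ⟨he, hve⟩]
      exact row_congr q fun w hw => Function.update_of_ne (ne_of_mem_of_not_mem hw hve) _ _

/-- One-extension, with the new vertex at the midpoint of the subdivided bar. -/
theorem PinSurj.of_midpoint {q : V → Fin 2 → ℝ} {P : Set V} {B : Set (Sym2 V)} {v a b c : V}
    (hv : v ∉ P) (hva : a ≠ v) (hvb : b ≠ v) (hvc : c ≠ v) (hab : s(a, b) ∉ B) (hN : nb B v ⊆ {a, b, c})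
    (h : PinSurj q P (insert s(a, b) {e | e ∈ B ∧ v ∉ e}))
    (hm : q v = (1 / 2 : ℝ) • (q a + q b)) (hc : cross (q b - q a) (q v - q c) ≠ 0) :
    PinSurj q P B := by
  intro w
  obtain ⟨d, hd0, hd⟩ := h fun e => if e = s(a, b) then 2 * (w s(v, a) + w s(v, b)) else w e
  obtain ⟨z, hz1, hz2⟩ := exists_ip_eq hc
    (2 * w s(v, a) + ip (q b - q a) (d a)) (w s(v, c) + ip (q v - q c) (d c))
  have hdab := hd _ (Set.mem_insert _ _)
  rw [if_pos rfl, row_mk] at hdab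
  refine ⟨Function.update d v z, fun w hw => ?_, fun e he => ?_⟩
  · rw [Function.update_of_ne (ne_of_mem_of_not_mem hw hv), hd0 w hw]
  · by_cases hve : v ∈ e
    · obtain ⟨n, rfl⟩ := hve
      rcases hN he with rfl | rfl | rfl
      · rw [row_mk, Function.update_self, Function.update_of_ne hva, hm]
        simp only [ip, Pi.sub_apply, Pi.add_apply, Pi.smul_apply, smul_eq_mul] at *
        linarith
      · rw [row_mk, Function.update_self, Function.update_of_ne hvb, hm]
        simp only [ip, Pi.sub_apply, Pi.add_apply, Pi.smul_apply, smul_eq_mul] at *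
        linarith
      · rw [row_mk, Function.update_self, Function.update_of_ne hvc, ip_sub_right, hz2]
        ring
    · have := hd e (Or.inr ⟨he, hve⟩)
      rw [if_neg (ne_of_mem_of_not_mem he hab)] at this
      rw [← this]
      exact row_congr q fun w hw => Function.update_of_ne (ne_of_mem_of_not_mem hw hve) _ _

end Pinned

section Count

variable {V : Type*}

/-- All unordered pairs of elements of `X`. -/
def pairs (X : Set V) : Set (Sym2 V) := {e | ∀ v ∈ e, v ∈ X}

@[simp] theorem mk_mem_pairs {X : Set V} {u v : V} : s(u, v) ∈ pairs X ↔ u ∈ X ∧ v ∈ X := by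
  simp [pairs]

theorem subset_pairs (F : Set (Sym2 V)) : F ⊆ pairs (vertexSpan F) := fun e he _ hv => ⟨e, he, hv⟩

theorem pairs_mono {X Y : Set V} (h : X ⊆ Y) : pairs X ⊆ pairs Y := fun _ he v hv => h (he v hv)

theorem vertexSpan_subset {F : Set (Sym2 V)} {X : Set V} (h : F ⊆ pairs X) : vertexSpan F ⊆ X :=
  fun _ ⟨_, he, hv⟩ => h he _ hv

theorem exists_ne_of_reg {q : V → Fin 2 → ℝ} {I : Set (Sym2 V)} {R : Set V} (hI : Reg (row q) I)
    (hIR : I ⊆ pairs R) (hne : I.Nonempty) : ∃ x ∈ R, ∃ y ∈ R, q x ≠ q y := by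
  obtain ⟨e, he⟩ := hne
  induction e with
  | _ x y =>
    refine ⟨x, (hIR he) x (by simp), y, (hIR he) y (by simp), fun h => ?_⟩
    obtain ⟨d, hd⟩ := hI fun _ => 1
    simpa [h] using hd _ he

variable [Finite V]

theorem count_aux {q : V → Fin 2 → ℝ} {I : Set (Sym2 V)} {R : Set V} (hI : Reg (row q) I)
    (hIR : I ⊆ pairs R) (h2 : ∃ x ∈ R, ∃ y ∈ R, q x ≠ q y) :
    I.ncard + 3 ≤ 2 * R.ncard ∧ (I.ncard + 3 = 2 * R.ncard ↔
      ∀ d, (∀ e ∈ I, row q e d = 0) → ∃ ρ c, ∀ a ∈ R, d a = triv q ρ c a) := by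
  classical
  have := Fintype.ofFinite V
  let ext : (R → Fin 2 → ℝ) →ₗ[ℝ] (V → Fin 2 → ℝ) :=
    { toFun := fun d v => if h : v ∈ R then d ⟨v, h⟩ else 0
      map_add' := fun x y => by ext v i; by_cases h : v ∈ R <;> simp [h]
      map_smul' := fun c x => by ext v i; by_cases h : v ∈ R <;> simp [h] }
  have ext_apply : ∀ d : V → Fin 2 → ℝ, ∀ v ∈ R, ext (fun a => d a) v = d v := fun d v hv => by
    simp [ext, hv]
  let Ψ : (R → Fin 2 → ℝ) →ₗ[ℝ] (I → ℝ) := LinearMap.pi fun e => (row q e.1).comp ext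
  have hΨ : ∀ d : V → Fin 2 → ℝ, ∀ e : I, Ψ (fun a => d a) e = row q e.1 d := fun d e =>
    row_congr q fun v hv => ext_apply d v (hIR e.2 v hv)
  have hsurj : Function.Surjective Ψ := fun c => by
    obtain ⟨d, hd⟩ := hI fun e => if h : e ∈ I then c ⟨e, h⟩ else 0
    refine ⟨fun a => d a, ?_⟩
    ext e
    rw [hΨ, hd e e.2, dif_pos e.2]
  let T : (ℝ × (Fin 2 → ℝ)) →ₗ[ℝ] (R → Fin 2 → ℝ) :=
    { toFun := fun ρc a => triv q ρc.1 ρc.2 a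
      map_add' := fun x y => by ext v i; simp [triv]; ring
      map_smul' := fun c x => by ext v i; simp [triv]; ring }
  have hT : Function.Injective T := by
    rw [← LinearMap.ker_eq_bot, LinearMap.ker_eq_bot']
    rintro ⟨ρ, c⟩ h
    obtain ⟨x, hx, y, hy, hxy⟩ := h2
    have hx' : ρ • rot (q x) + c = 0 := congrFun h ⟨x, hx⟩
    have hy' : ρ • rot (q y) + c = 0 := congrFun h ⟨y, hy⟩
    have hρ : ρ = 0 := by
      by_contra hρ
      have h3 : ρ • (rot (q x) - rot (q y)) = 0 := by
        rw [smul_sub, sub_eq_zero]; exact add_right_cancel (hx'.trans hy'.symm)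
      have h4 := (smul_eq_zero.1 h3).resolve_left hρ
      apply hxy
      have h5 := congrFun h4 0
      have h6 := congrFun h4 1
      simp at h5 h6
      ext i
      fin_cases i
      · simp; linarith
      · simp; linarith
    subst hρ
    simpa using hx'
  have hle : LinearMap.range T ≤ LinearMap.ker Ψ := by
    rintro _ ⟨ρc, rfl⟩
    ext e
    exact (hΨ (triv q ρc.1 ρc.2) e).trans (row_triv q _ _ _)
  have hrT : Module.finrank ℝ (LinearMap.range T) = 3 := by
    rw [LinearMap.finrank_range_of_inj hT]; simp
  have hk : I.ncard + Module.finrank ℝ (LinearMap.ker Ψ) = 2 * R.ncard := by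
    have h := LinearMap.finrank_range_add_finrank_ker Ψ
    rw [LinearMap.range_eq_top.2 hsurj, finrank_top] at h
    simp only [Module.finrank_fintype_fun_eq_card, Module.finrank_pi_fintype, Finset.sum_const,
      Fintype.card_fin, Finset.card_univ, smul_eq_mul] at h
    rw [← Nat.card_coe_set_eq, ← Nat.card_coe_set_eq, Nat.card_eq_fintype_card,
      Nat.card_eq_fintype_card, h, mul_comm]
  have hmono := Submodule.finrank_mono hle
  rw [hrT] at hmono
  refine ⟨by omega, fun heq d hd => ?_, fun h => ?_⟩
  · have := Submodule.eq_of_le_of_finrank_eq hle (by omega)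
    have hdk : (fun a : R => d a) ∈ LinearMap.ker Ψ := by
      ext e
      exact (hΨ d e).trans (hd e e.2)
    rw [← this] at hdk
    obtain ⟨⟨ρ, c⟩, hρ⟩ := hdk
    exact ⟨ρ, c, fun a ha => (congrFun hρ ⟨a, ha⟩).symm⟩
  · have : LinearMap.ker Ψ ≤ LinearMap.range T := by
      intro x hx
      obtain ⟨ρ, c, hρ⟩ := h (ext x) fun e he => congrFun hx ⟨e, he⟩
      refine ⟨⟨ρ, c⟩, ?_⟩
      ext1 a
      rw [show x a = ext x a by simp [ext], hρ a a.2]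
      rfl
    have := Submodule.finrank_mono this
    omega

/-- A set of independent rows on `R` has at most `2|R| - 3` elements. -/
theorem Reg.ncard_add_three_le {q : V → Fin 2 → ℝ} {I : Set (Sym2 V)} {R : Set V}
    (hI : Reg (row q) I) (hIR : I ⊆ pairs R) (hne : I.Nonempty) : I.ncard + 3 ≤ 2 * R.ncard :=
  (count_aux hI hIR (exists_ne_of_reg hI hIR hne)).1

theorem Reg.triv_of_ncard {q : V → Fin 2 → ℝ} {I : Set (Sym2 V)} {R : Set V}
    (hI : Reg (row q) I) (hIR : I ⊆ pairs R) (hne : I.Nonempty) (h : I.ncard + 3 = 2 * R.ncard)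
    {d : V → Fin 2 → ℝ} (hd : ∀ e ∈ I, row q e d = 0) : ∃ ρ c, ∀ a ∈ R, d a = triv q ρ c a :=
  (count_aux hI hIR (exists_ne_of_reg hI hIR hne)).2.1 h d hd

theorem Generic.ncard_of_rig {p : V → Fin 2 → ℝ} (hp : Generic p) {I : Set (Sym2 V)} {R : Set V}
    (hI : Reg (row p) I) (hIR : I ⊆ pairs R) (h2 : 2 ≤ R.ncard) (h : Rig p I R) :
    I.ncard + 3 = 2 * R.ncard := by
  obtain ⟨x, hx, y, hy, hxy⟩ := (Set.one_lt_ncard).1 (show 1 < R.ncard from h2)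
  exact (count_aux hI hIR ⟨x, hx, y, hy, hp.injective.ne hxy⟩).2.2 fun d hd => hp.rig_triv h hd

end Count

section Circuits

variable {V : Type*}

theorem eq_pair_of_ncard_le_two {N : Set V} [Finite N] (h : N.ncard ≤ 2) :
    N = ∅ ∨ (∃ a, N = {a}) ∨ ∃ a b, a ≠ b ∧ N = {a, b} := by
  have : N.ncard = 0 ∨ N.ncard = 1 ∨ N.ncard = 2 := by omega
  rcases this with h | h | h
  · exact Or.inl ((Set.ncard_eq_zero (Set.toFinite _)).1 h)
  · exact Or.inr (Or.inl (Set.ncard_eq_one.1 h))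
  · exact Or.inr (Or.inr (Set.ncard_eq_two.1 h))

theorem exists_star {q : V → Fin 2 → ℝ} {x : Fin 2 → ℝ} {N : Set V} [Finite N] (hN : N.ncard ≤ 2)
    (hx : ∀ a ∈ N, x ≠ q a) (hc : ∀ a ∈ N, ∀ b ∈ N, a ≠ b → cross (x - q a) (x - q b) ≠ 0)
    (c : V → ℝ) : ∃ z, ∀ n ∈ N, ip (x - q n) z = c n := by
  rcases eq_pair_of_ncard_le_two hN with rfl | ⟨a, rfl⟩ | ⟨a, b, hab, rfl⟩
  · exact ⟨0, by simp⟩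
  · have hne := hx a rfl
    rw [Ne, ← sub_eq_zero, ← ip_self_eq_zero] at hne
    refine ⟨(c a / ip (x - q a) (x - q a)) • (x - q a), ?_⟩
    rintro n rfl
    rw [ip_smul_right, div_mul_cancel₀ _ hne]
  · obtain ⟨z, h1, h2⟩ := exists_ip_eq (hc a (by simp) b (by simp) hab) (c a) (c b)
    refine ⟨z, ?_⟩
    rintro n (rfl | rfl)
    · exact h1
    · exact h2

variable {p : V → Fin 2 → ℝ}

theorem Generic.cross_ne_zero' (hp : Generic p) {a b c : V} (hab : a ≠ b) (hac : a ≠ c)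
    (hbc : b ≠ c) : cross (p a - p b) (p a - p c) ≠ 0 := cross_ne_symm (hp.cross_ne_zero hab hac hbc)

theorem Generic.reg_singleton (hp : Generic p) {e : Sym2 V} (he : ¬ e.IsDiag) :
    Reg (row p) {e} := by
  induction e with
  | _ u v =>
    have hne : ip (p u - p v) (p u - p v) ≠ 0 := by
      rw [Ne, ip_self_eq_zero, sub_eq_zero]
      exact hp.injective.ne he
    intro c
    refine ⟨(c s(u, v) / ip (p u - p v) (p u - p v)) • p, ?_⟩
    rintro e rfl
    rw [map_smul, row_mk, smul_eq_mul, div_mul_cancel₀ _ hne]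

/-- A point joined to two points of a rigid set can be added to it. -/
theorem Generic.rig_insert (hp : Generic p) {F : Set (Sym2 V)} {X : Set V} (h : Rig p F X)
    {v a b : V} (ha : a ∈ X) (hb : b ∈ X) (hab : a ≠ b) (hva : v ≠ a) (hvb : v ≠ b)
    (h1 : Cl (row p) F s(v, a)) (h2 : Cl (row p) F s(v, b)) : Rig p F (insert v X) := by
  refine hp.rig_of_fixed hab (h a ha b hb) fun d hd hda hdb z hz => ?_
  rcases hz with rfl | hz
  · exact eq_of_row_eq (d' := 0) (hp.cross_ne_zero' hva hvb hab) hda hdb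
      (by rw [h1 d hd, map_zero]) (by rw [h2 d hd, map_zero])
  · exact hp.rig_fixed h ha hb hab hd hda hdb z hz

theorem rig_pair {F : Set (Sym2 V)} {a b : V} (h : Cl (row p) F s(a, b)) : Rig p F {a, b} := by
  rintro x (rfl | rfl) y (rfl | rfl)
  · exact cl_diag F _
  · exact h
  · rwa [Sym2.eq_swap]
  · exact cl_diag F _

theorem rig_triple {F : Set (Sym2 V)} {a b c : V} (h1 : Cl (row p) F s(a, b))
    (h2 : Cl (row p) F s(b, c)) (h3 : Cl (row p) F s(a, c)) : Rig p F {a, b, c} := by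
  rintro x (rfl | rfl | rfl) y (rfl | rfl | rfl) <;>
    first | exact cl_diag F _ | assumption | (rw [Sym2.eq_swap]; assumption)

/-- Three rigid sets that pairwise meet at the corners of a triangle. -/
theorem Generic.rig_triangle (hp : Generic p) {F : Set (Sym2 V)} {X Y Z : Set V} {a b c : V}
    (hX : Rig p F X) (hY : Rig p F Y) (hZ : Rig p F Z) (haX : a ∈ X) (hbX : b ∈ X) (hbY : b ∈ Y)
    (hcY : c ∈ Y) (haZ : a ∈ Z) (hcZ : c ∈ Z) (hab : a ≠ b) (hbc : b ≠ c) (hac : a ≠ c) :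
    Rig p F (X ∪ Y ∪ Z) := by
  have h := rig_triple (hX a haX b hbX) (hY b hbY c hcY) (hZ a haZ c hcZ)
  have h1 := hp.rig_union h hX hab (by simp) (by simp) haX hbX
  have h2 := hp.rig_union h1 hY hbc (by simp) (by simp) hbY hcY
  have h3 := hp.rig_union h2 hZ hac (by simp) (by simp) haZ hcZ
  exact h3.mono le_rfl (Set.union_subset_union_left _ (Set.union_subset_union_left _
    Set.subset_union_right))

variable [Fintype V] [DecidableEq V]

theorem Generic.reg_of_star (hp : Generic p) {B : Set (Sym2 V)} (hB : ∀ e ∈ B, ¬ e.IsDiag) {v : V}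
    (hv : (nb B v).ncard ≤ 2) (h : Reg (row p) {e | e ∈ B ∧ v ∉ e}) : Reg (row p) B := by
  rw [← pinSurj_empty] at h ⊢
  have hn : ∀ n ∈ nb B v, v ≠ n := by
    rintro n hn rfl
    exact hB _ hn (by simp)
  exact h.of_star (Set.notMem_empty v) (exists_star hv
    (fun a ha => hp.injective.ne (hn a ha)) fun a ha b hb hab =>
      hp.cross_ne_zero' (hn a ha) (hn b hb) hab)

theorem Generic.reg_of_oneExt (hp : Generic p) {B : Set (Sym2 V)} {v a b c : V} (hva : a ≠ v)
    (hvb : b ≠ v) (hvc : c ≠ v) (hab : a ≠ b) (hac : a ≠ c) (hbc : b ≠ c) (habB : s(a, b) ∉ B)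
    (hN : nb B v ⊆ {a, b, c}) (h : Reg (row p) (insert s(a, b) {e | e ∈ B ∧ v ∉ e})) :
    Reg (row p) B := by
  let q := Function.update p v ((1 / 2 : ℝ) • (p a + p b))
  refine hp.reg (p₀ := q) ?_
  rw [← pinSurj_empty] at h ⊢
  have hqa : q a = p a := Function.update_of_ne hva _ _
  have hqb : q b = p b := Function.update_of_ne hvb _ _
  have hqc : q c = p c := Function.update_of_ne hvc _ _
  have hqv : q v = (1 / 2 : ℝ) • (p a + p b) := Function.update_self _ _ _
  refine PinSurj.of_midpoint (Set.notMem_empty v) hva hvb hvc habB hN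
    (h.congr fun e he w hw => (Function.update_of_ne ?_ _ _).symm) (by rw [hqv, hqa, hqb]) ?_
  · rcases he with rfl | he
    · rcases Sym2.mem_iff.1 hw with rfl | rfl <;> assumption
    · exact ne_of_mem_of_not_mem hw he.2
  · rw [hqa, hqb, hqc, hqv]
    have := hp.cross_ne_zero hab hac hbc
    contrapose this
    simp only [cross, Pi.sub_apply, Pi.smul_apply, Pi.add_apply, smul_eq_mul] at *
    linarith

theorem reg_of_vertex {C : Set (Sym2 V)} (hC : Circ (row p) C) {v : V} (hv : v ∈ vertexSpan C) :
    Reg (row p) {e | e ∈ C ∧ v ∉ e} := by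
  obtain ⟨e, he, hve⟩ := hv
  exact hC.2 _ ⟨fun f hf => hf.1, fun h => (h he).2 hve⟩

theorem Generic.three_le_nb (hp : Generic p) {C : Set (Sym2 V)} (hC : Circ (row p) C)
    (hd : ∀ e ∈ C, ¬ e.IsDiag) {v : V} (hv : v ∈ vertexSpan C) : 3 ≤ (nb C v).ncard := by
  by_contra! h
  exact hC.1 (hp.reg_of_star hd (by omega) (reg_of_vertex hC hv))

theorem Generic.circ_cl_nb (hp : Generic p) {C : Set (Sym2 V)} (hC : Circ (row p) C) {v a b c : V}
    (hva : a ≠ v) (hvb : b ≠ v) (hvc : c ≠ v) (hab : a ≠ b) (hac : a ≠ c) (hbc : b ≠ c)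
    (hN : nb C v = {a, b, c}) : Cl (row p) {e | e ∈ C ∧ v ∉ e} s(a, b) := by
  by_contra h
  have hab' : s(a, b) ∉ C := fun h' => h (Cl.of_mem ⟨h', by simp [hva.symm, hvb.symm]⟩)
  refine hC.1 (hp.reg_of_oneExt hva hvb hvc hab hac hbc hab' hN.le (Reg.insert ?_ h))
  have : s(v, a) ∈ C := by
    change a ∈ nb C v
    simp [hN]
  exact reg_of_vertex hC ⟨_, this, by simp⟩

theorem ncard_le_of_circ {C : Set (Sym2 V)} (hC : Circ (row p) C) (h2 : 2 ≤ C.ncard) :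
    C.ncard + 2 ≤ 2 * (vertexSpan C).ncard := by
  obtain ⟨e, he⟩ := hC.nonempty
  have hs := Set.ncard_sdiff_singleton_add_one he (Set.toFinite C)
  have := (hC.2 (C \ {e}) ⟨Set.sdiff_subset, fun h => (h he).2 rfl⟩).ncard_add_three_le
    (Set.sdiff_subset.trans (subset_pairs C)) (by
      rw [← Set.ncard_pos]; omega)
  omega

/-- A sparse graph of minimum degree three has a vertex of degree three outside any three
given vertices. -/
theorem exists_nb_three {F : Set (Sym2 V)} (hd : ∀ e ∈ F, ¬ e.IsDiag)
    (h3 : ∀ v ∈ vertexSpan F, 3 ≤ (nb F v).ncard) (hc : F.ncard + 2 ≤ 2 * (vertexSpan F).ncard)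
    {S : Set V} (hS : S.ncard ≤ 3) : ∃ v ∈ vertexSpan F, v ∉ S ∧ (nb F v).ncard = 3 := by
  classical
  by_contra! h
  have hsum := sum_nb hd
  have hle : ∀ v : V, (if v ∈ vertexSpan F then 4 else 0) ≤ (nb F v).ncard + (if v ∈ S then 1 else 0) := by
    intro v
    by_cases hv : v ∈ vertexSpan F
    · have := h3 v hv
      have h' := h v hv
      by_cases hvS : v ∈ S
      · simp only [hv, hvS, if_true]; omega
      · have := h' hvS
        simp only [hv, hvS, if_true, if_false]; omega
    · simp [hv]
  have := Finset.sum_le_sum fun v (_ : v ∈ Finset.univ) => hle v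
  rw [Finset.sum_add_distrib, hsum, ← Finset.sum_filter, ← Finset.sum_filter, Finset.sum_const,
    Finset.sum_const] at this
  have e1 : (Finset.univ.filter fun v => v ∈ vertexSpan F).card = (vertexSpan F).ncard := by
    rw [← Set.ncard_coe_finset]; congr 1; ext; simp
  have e2 : (Finset.univ.filter fun v => v ∈ S).card = S.ncard := by
    rw [← Set.ncard_coe_finset]; congr 1; ext; simp
  rw [e1, e2, smul_eq_mul, smul_eq_mul] at this
  omega

theorem Generic.two_le_ncard (hp : Generic p) {C : Set (Sym2 V)} (hC : Circ (row p) C)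
    (hd : ∀ e ∈ C, ¬ e.IsDiag) : 2 ≤ C.ncard := by
  by_contra! h
  have h1 := (Set.ncard_pos (Set.toFinite C)).2 hC.nonempty
  obtain ⟨e, rfl⟩ := Set.ncard_eq_one.1 (show C.ncard = 1 by omega)
  exact hC.1 (hp.reg_singleton (hd e rfl))

theorem vertexSpan_insert (F : Set (Sym2 V)) (u v : V) :
    vertexSpan (insert s(u, v) F) = {u, v} ∪ vertexSpan F := by
  ext w
  simp [vertexSpan]

/-- Circuits of the generic rigidity matroid of the plane are rigid. -/
theorem Generic.rig_circ (hp : Generic p) {C : Set (Sym2 V)} (hC : Circ (row p) C)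
    (hd : ∀ e ∈ C, ¬ e.IsDiag) : Rig p C (vertexSpan C) := by
  suffices H : ∀ n, ∀ C : Set (Sym2 V), Circ (row p) C → (∀ e ∈ C, ¬ e.IsDiag) →
      (vertexSpan C).ncard = n → Rig p C (vertexSpan C) from H _ C hC hd rfl
  clear! C
  intro n
  induction n using Nat.strong_induction_on with
  | _ n ih =>
  intro C hC hd hn
  obtain ⟨v, hv, -, h3⟩ := exists_nb_three (S := ∅) hd (fun v => hp.three_le_nb hC hd)
    (ncard_le_of_circ hC (hp.two_le_ncard hC hd)) (by simp)
  obtain ⟨a, b, c, hab, hac, hbc, hN⟩ := Set.ncard_eq_three.1 h3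
  have hne : ∀ x, x ∈ nb C v → x ≠ v := by
    rintro x hx rfl
    exact hd _ hx (by simp)
  have ha : a ∈ nb C v := by simp [hN]
  have hb : b ∈ nb C v := by simp [hN]
  have hc : c ∈ nb C v := by simp [hN]
  have key : ∀ x y, x ≠ y → x ∈ nb C v → y ∈ nb C v → Cl (row p) {e | e ∈ C ∧ v ∉ e} s(x, y) →
      ∃ F' Y, F' ⊆ {e | e ∈ C ∧ v ∉ e} ∧ F' ⊆ pairs Y ∧ x ∈ Y ∧ y ∈ Y ∧ Rig p F' Y := by
    intro x y hxy hx hy hcl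
    by_cases hmem : s(x, y) ∈ {e | e ∈ C ∧ v ∉ e}
    · refine ⟨{s(x, y)}, {x, y}, by simpa using hmem, ?_, by simp, by simp,
        rig_pair (Cl.of_mem rfl)⟩
      rintro e rfl
      simp
    · obtain ⟨D, hD, hxyD, hDc⟩ := exists_circ_of_cl hcl hmem
      have hDd : ∀ e ∈ D, ¬ e.IsDiag := by
        intro e he
        rcases hD he with rfl | he
        · simpa using hxy
        · exact hd e he.1
      refine ⟨D \ {s(x, y)}, vertexSpan D, fun e he => (hD he.1).resolve_left he.2,
        Set.sdiff_subset.trans (subset_pairs D), left_mem_vertexSpan hxyD,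
        right_mem_vertexSpan hxyD, (ih _ ?_ D hDc hDd rfl).trans fun f hf => ?_⟩
      · rw [← hn]
        refine Set.ncard_lt_ncard ⟨fun w hw => ?_, fun h => ?_⟩ (Set.toFinite _)
        · have := vertexSpan_mono hD hw
          rw [vertexSpan_insert] at this
          rcases this with (rfl | rfl) | h
          · exact right_mem_vertexSpan hx
          · exact right_mem_vertexSpan hy
          · exact vertexSpan_mono (fun e he => he.1) h
        · have := vertexSpan_mono hD (h hv)
          rw [vertexSpan_insert] at this
          rcases this with (h | h) | ⟨e, he, h⟩
          · exact hne x hx h.symm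
          · exact hne y hy h.symm
          · exact he.2 h
      · by_cases hf' : f = s(x, y)
        · rw [hf']
          exact hDc.cl hxyD
        · exact Cl.of_mem ⟨hf, hf'⟩
  obtain ⟨F₁, Y₁, h1, h1', ha1, hb1, hr1⟩ := key a b hab ha hb
    (hp.circ_cl_nb hC (hne a ha) (hne b hb) (hne c hc) hab hac hbc hN)
  obtain ⟨F₂, Y₂, h2, h2', hb2, hc2, hr2⟩ := key b c hbc hb hc
    (hp.circ_cl_nb hC (hne b hb) (hne c hc) (hne a ha) hbc hab.symm hac.symm
      (by rw [hN]; ext; simp; tauto))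
  obtain ⟨F₃, Y₃, h3, h3', ha3, hc3, hr3⟩ := key a c hac ha hc
    (hp.circ_cl_nb hC (hne a ha) (hne c hc) (hne b hb) hac hab hbc.symm
      (by rw [hN]; ext; simp; tauto))
  let F := F₁ ∪ F₂ ∪ F₃
  let Y := Y₁ ∪ Y₂ ∪ Y₃
  have hF : F ⊆ {e | e ∈ C ∧ v ∉ e} := Set.union_subset (Set.union_subset h1 h2) h3
  have hFY : F ⊆ pairs Y := by
    refine Set.union_subset (Set.union_subset (h1'.trans (pairs_mono ?_)) (h2'.trans
      (pairs_mono ?_))) (h3'.trans (pairs_mono ?_)) <;> intro x hx <;> simp [Y, hx]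
  have hr : Rig p F Y := hp.rig_triangle (hr1.mono (by intro x hx; simp [F, hx]) le_rfl)
    (hr2.mono (by intro x hx; simp [F, hx]) le_rfl) (hr3.mono (by intro x hx; simp [F, hx]) le_rfl)
    ha1 hb1 hb2 hc2 ha3 hc3 hab hbc hac
  let G := insert s(v, a) (insert s(v, b) F)
  have hrG : Rig p G (insert v Y) := by
    refine hp.rig_insert (hr.mono (fun e he => Or.inr (Or.inr he)) le_rfl) (a := a) (b := b)
      (by simp [Y, ha1]) (by simp [Y, hb1]) hab (hne a ha).symm (hne b hb).symm
      (Cl.of_mem (Or.inl rfl)) (Cl.of_mem (Or.inr (Or.inl rfl)))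
  have hGC : insert s(v, c) G = C := by
    by_contra hG
    have hsub : insert s(v, c) G ⊆ C :=
      Set.insert_subset hc (Set.insert_subset ha (Set.insert_subset hb fun e he => (hF he).1))
    refine (hC.2 _ (hsub.ssubset_of_ne hG)).not_cl (Set.mem_insert _ _) ?_
    rw [Set.insert_sdiff_self_of_notMem]
    · exact hrG v (by simp) c (by simp [Y, hc2])
    · rintro (h | h | h)
      · have := Sym2.congr_right.1 h
        exact hac this.symm
      · have := Sym2.congr_right.1 h
        exact hbc this.symm
      · exact (hF h).2 (by simp)
  refine hrG.mono (hGC ▸ Set.subset_insert _ _) ?_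
  rw [← hGC]
  refine vertexSpan_subset ?_
  have haY : a ∈ Y := by simp [Y, ha1]
  have hbY : b ∈ Y := by simp [Y, hb1]
  have hcY : c ∈ Y := by simp [Y, hc2]
  rintro e (rfl | rfl | rfl | he)
  · simp [hcY]
  · simp [haY]
  · simp [hbY]
  · exact pairs_mono (Set.subset_insert _ _) (hFY he)

theorem Generic.rig_rconn (hp : Generic p) {F : Set (Sym2 V)} (hF : RConn (row p) F)
    (hd : ∀ e ∈ F, ¬ e.IsDiag) : Rig p F (vertexSpan F) := by
  obtain ⟨e, he⟩ := hF.1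
  induction e with
  | _ a b =>
  have hab : a ≠ b := by simpa using hd _ he
  refine hp.rig_of_fixed hab (Cl.of_mem he) fun d hd' hda hdb z hz => ?_
  obtain ⟨f, hf, hz⟩ := hz
  rcases hF.2 _ he f hf with rfl | ⟨C, hC, hCc, heC, hfC⟩
  · rcases Sym2.mem_iff.1 hz with rfl | rfl <;> assumption
  · exact hp.rig_fixed (hp.rig_circ hCc fun g hg => hd g (hC hg)) (left_mem_vertexSpan heC)
      (right_mem_vertexSpan heC) hab (fun g hg => hd' g (hC hg)) hda hdb z ⟨f, hfC, hz⟩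

end Circuits

section Components

variable {V : Type*} [Fintype V] [DecidableEq V] {p : V → Fin 2 → ℝ} {E : Set (Sym2 V)}

/-- The component of `e` in `E` with respect to the rigidity matroid at `p`. -/
def comp (p : V → Fin 2 → ℝ) (E : Set (Sym2 V)) (e : Sym2 V) : Set (Sym2 V) :=
  {f | f ∈ E ∧ CoCirc (row p) E e f}

theorem comp_subset (e : Sym2 V) : comp p E e ⊆ E := fun _ h => h.1

theorem mem_comp_self {e : Sym2 V} (he : e ∈ E) : e ∈ comp p E e := ⟨he, Or.inl rfl⟩

theorem comp_eq {e f : Sym2 V} (hf : f ∈ comp p E e) : comp p E f = comp p E e := by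
  ext g
  exact ⟨fun h => ⟨h.1, hf.2.trans h.2⟩, fun h => ⟨h.1, hf.2.symm.trans h.2⟩⟩

theorem circ_subset_comp {C : Set (Sym2 V)} (hC : Circ (row p) C) (hCE : C ⊆ E) {e f : Sym2 V}
    (hf : f ∈ C) (hfe : f ∈ comp p E e) : C ⊆ comp p E e := fun _ hg =>
  ⟨hCE hg, hfe.2.trans (Or.inr ⟨C, hCE, hC, hf, hg⟩)⟩

theorem comp_split (e : Sym2 V) (d₁ d₂ : V → Fin 2 → ℝ) :
    ∃ d, (∀ f ∈ comp p E e, row p f d = row p f d₁) ∧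
      ∀ f ∈ E \ comp p E e, row p f d = row p f d₂ := by
  refine split_of_circ Set.disjoint_sdiff_right (fun C hC hCc => ?_) d₁ d₂
  rw [Set.union_sdiff_cancel (comp_subset e)] at hC
  by_cases h : ∃ f ∈ C, f ∈ comp p E e
  · obtain ⟨f, hf, hfe⟩ := h
    exact Or.inl (circ_subset_comp hCc hC hf hfe)
  · push Not at h
    exact Or.inr fun f hf => ⟨hC hf, h f hf⟩

theorem Generic.rig_comp (hp : Generic p) (hE : ∀ e ∈ E, ¬ e.IsDiag) {e : Sym2 V} (he : e ∈ E) :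
    Rig p (comp p E e) (vertexSpan (comp p E e)) :=
  hp.rig_rconn (rconn_class he) fun f hf => hE f hf.1

theorem Rig.cl {F : Set (Sym2 V)} {X : Set V} (h : Rig p F X) {e : Sym2 V} (he : e ∈ pairs X) :
    Cl (row p) F e := by
  induction e with
  | _ x y => exact h x (he x (by simp)) y (he y (by simp))

theorem Generic.row_self_ne_zero (hp : Generic p) {e : Sym2 V} (he : ¬ e.IsDiag) :
    row p e p ≠ 0 := by
  induction e with
  | _ x y =>
    rw [Ne, row_self_eq_zero]
    exact hp.injective.ne he

theorem Generic.mem_comp_of_pairs (hp : Generic p) (hE : ∀ e ∈ E, ¬ e.IsDiag) {e f : Sym2 V}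
    (he : e ∈ E) (hf : f ∈ E) (hfe : f ∈ pairs (vertexSpan (comp p E e))) : f ∈ comp p E e := by
  by_contra h
  obtain ⟨d, h1, h2⟩ := comp_split (p := p) (E := E) e 0 p
  have := (hp.rig_comp hE he).cl hfe d fun g hg => by rw [h1 g hg, map_zero]
  rw [h2 f ⟨hf, h⟩] at this
  exact hp.row_self_ne_zero (hE f hf) this

/-- Distinct components share at most one vertex. -/
theorem Generic.comp_eq_of_share (hp : Generic p) (hE : ∀ e ∈ E, ¬ e.IsDiag) {e f : Sym2 V}
    (he : e ∈ E) (hf : f ∈ E) {x y : V} (hxy : x ≠ y) (hxe : x ∈ vertexSpan (comp p E e))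
    (hye : y ∈ vertexSpan (comp p E e)) (hxf : x ∈ vertexSpan (comp p E f))
    (hyf : y ∈ vertexSpan (comp p E f)) : comp p E e = comp p E f := by
  by_contra h
  obtain ⟨d, h1, h2⟩ := comp_split (p := p) (E := E) e 0 p
  have h3 := hp.rig_comp hE he x hxe y hye d fun g hg => by rw [h1 g hg, map_zero]
  have h4 := hp.rig_comp hE hf x hxf y hyf (d - p) fun g hg => by
    rw [map_sub, h2 g ⟨hg.1, fun hge => h ((comp_eq hge).symm.trans (comp_eq hg))⟩, sub_self]
  rw [map_sub, h3, zero_sub, neg_eq_zero] at h4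
  exact hp.row_self_ne_zero (by simpa using hxy) h4

/-- All pairs of vertices lying in a common component of `E`. -/
def plus (p : V → Fin 2 → ℝ) (E : Set (Sym2 V)) : Set (Sym2 V) :=
  {f | ¬ f.IsDiag ∧ ∃ e ∈ E, f ∈ pairs (vertexSpan (comp p E e))}

theorem subset_plus (hE : ∀ e ∈ E, ¬ e.IsDiag) : E ⊆ plus p E := fun e he =>
  ⟨hE e he, e, he, subset_pairs _ (mem_comp_self he)⟩

theorem Generic.circ_subset_pairs (hp : Generic p) (hE : ∀ e ∈ E, ¬ e.IsDiag) {C : Set (Sym2 V)}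
    (hC : Circ (row p) C) (hCE : C ⊆ plus p E) :
    ∃ e ∈ E, C ⊆ pairs (vertexSpan (comp p E e)) := by
  obtain ⟨g, hg⟩ := hC.nonempty
  obtain ⟨-, e, he, hge⟩ := hCE hg
  refine ⟨e, he, ?_⟩
  by_contra hn
  obtain ⟨f, hf, hfe⟩ := Set.not_subset.1 hn
  let P := pairs (vertexSpan (comp p E e))
  refine hC.1 fun c => ?_
  obtain ⟨d₁, h1⟩ := hC.2 (C ∩ P) ⟨Set.inter_subset_left, fun h => hfe (h hf).2⟩ c
  obtain ⟨d₂, h2⟩ := hC.2 (C \ P) ⟨Set.sdiff_subset, fun h => (h hg).2 hge⟩ c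
  obtain ⟨d, h3, h4⟩ := comp_split (p := p) (E := E) e d₁ d₂
  refine ⟨d, fun k hk => ?_⟩
  by_cases hkP : k ∈ P
  · rw [← h1 k ⟨hk, hkP⟩, ← sub_eq_zero, ← map_sub]
    exact (hp.rig_comp hE he).cl hkP _ fun g hg => by rw [map_sub, h3 g hg, sub_self]
  · rw [← h2 k ⟨hk, hkP⟩, ← sub_eq_zero, ← map_sub]
    obtain ⟨-, e', he', hke'⟩ := hCE hk
    refine (hp.rig_comp hE he').cl hke' _ fun g hg => ?_
    rw [map_sub, h4 g ⟨hg.1, fun hge => hkP ?_⟩, sub_self]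
    rw [← comp_eq hg, comp_eq hge] at hke'
    exact hke'

end Components

section Separation

variable {V : Type*} {F : Set (Sym2 V)} {A : Set V} {s t u w : V}

/-- In the graph with edge set `F`, the set `A` is attached to the rest only at `s` and `t`. -/
def IsSep (F : Set (Sym2 V)) (A : Set V) (s t : V) : Prop :=
  s ∉ A ∧ t ∉ A ∧ ∀ a b, s(a, b) ∈ F → a ∈ A → b ∈ A ∨ b = s ∨ b = t

/-- No pair of vertices separates `u` from `w` in `F`. -/
def Unsep (F : Set (Sym2 V)) (u w : V) : Prop :=
  ∀ A s t, IsSep F A s t → u ∈ A → w ∈ A ∨ w = s ∨ w = t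

/-- The other side of a separation. -/
def oside (A : Set V) (s t : V) : Set V := {v | v ∉ A ∧ v ≠ s ∧ v ≠ t}

theorem IsSep.symm (h : IsSep F A s t) : IsSep F A t s :=
  ⟨h.2.1, h.1, fun a b hab ha => (h.2.2 a b hab ha).imp_right Or.symm⟩

theorem IsSep.compl (h : IsSep F A s t) : IsSep F (oside A s t) s t := by
  refine ⟨fun h => h.2.1 rfl, fun h => h.2.2 rfl, fun a b hab ha => ?_⟩
  by_cases hb : b ∈ A
  · rcases h.2.2 b a (Sym2.eq_swap ▸ hab) hb with h | h | h
    · exact absurd h ha.1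
    · exact absurd h ha.2.1
    · exact absurd h ha.2.2
  · by_cases hs : b = s
    · exact Or.inr (Or.inl hs)
    by_cases ht : b = t
    · exact Or.inr (Or.inr ht)
    exact Or.inl ⟨hb, hs, ht⟩

theorem IsSep.oside_oside (h : IsSep F A s t) : oside (oside A s t) s t = A := by
  ext v
  simp only [oside, Set.mem_ofPred_eq]
  refine ⟨fun hv => by tauto, fun hv => ⟨fun h' => h'.1 hv, ?_, ?_⟩⟩
  · rintro rfl; exact h.1 hv
  · rintro rfl; exact h.2.1 hv

theorem IsSep.edge (h : IsSep F A s t) {a b : V} (hab : s(a, b) ∈ F) :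
    ((a ∈ A ∨ a = s ∨ a = t) ∧ (b ∈ A ∨ b = s ∨ b = t)) ∨ (a ∉ A ∧ b ∉ A) := by
  by_cases ha : a ∈ A
  · exact Or.inl ⟨Or.inl ha, h.2.2 a b hab ha⟩
  by_cases hb : b ∈ A
  · exact Or.inl ⟨h.2.2 b a (Sym2.eq_swap ▸ hab) hb, Or.inl hb⟩
  · exact Or.inr ⟨ha, hb⟩

theorem Unsep.symm (h : Unsep F u w) : Unsep F w u := by
  intro A s t hA hw
  by_contra! hu
  rcases h _ s t hA.compl ⟨hu.1, hu.2.1, hu.2.2⟩ with h' | rfl | rfl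
  · exact h'.1 hw
  · exact hA.1 hw
  · exact hA.2.1 hw

theorem unsep_self (F : Set (Sym2 V)) (u : V) : Unsep F u u := fun _ _ _ _ h => Or.inl h

theorem unsep_of_mem (h : s(u, w) ∈ F) : Unsep F u w := fun _ _ _ hA hu => hA.2.2 u w h hu

variable [DecidableEq V] {p : V → Fin 2 → ℝ}

open Classical in
/-- Gluing two motions along a separation. -/
theorem IsSep.glue (h : IsSep F A s t) {q d₁ d₂ : V → Fin 2 → ℝ} (hs : d₁ s = d₂ s)
    (ht : d₁ t = d₂ t) : ∃ d, (∀ v, v ∈ A ∨ v = s ∨ v = t → d v = d₁ v) ∧ (∀ v, v ∉ A → d v = d₂ v) ∧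
      ∀ e ∈ F, ((∀ v ∈ e, v ∈ A ∨ v = s ∨ v = t) ∧ row q e d = row q e d₁) ∨
        ((∀ v ∈ e, v ∉ A) ∧ row q e d = row q e d₂) := by
  let d : V → Fin 2 → ℝ := fun v => if v ∈ A then d₁ v else d₂ v
  have h1 : ∀ v, v ∈ A ∨ v = s ∨ v = t → d v = d₁ v := by
    rintro v (hv | rfl | rfl)
    · simp [d, hv]
    · simp [d, h.1, hs]
    · simp [d, h.2.1, ht]
  have h2 : ∀ v, v ∉ A → d v = d₂ v := fun v hv => by simp [d, hv]
  refine ⟨d, h1, h2, fun e he => ?_⟩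
  induction e with
  | _ a b =>
    rcases h.edge he with ⟨ha, hb⟩ | ⟨ha, hb⟩
    · exact Or.inl ⟨by simp [ha, hb], by simp only [row_mk, h1 a ha, h1 b hb]⟩
    · exact Or.inr ⟨by simp [ha, hb], by simp only [row_mk, h2 a ha, h2 b hb]⟩

/-- Rigid graphs have no cut vertices. -/
theorem Generic.sep_one (hp : Generic p) {X : Set V} (hX : Rig p F X) (h : IsSep F A t t) :
    (∀ x ∈ X, x ∉ A) ∨ ∀ x ∈ X, x = t ∨ x ∈ A := by
  by_contra! hn
  obtain ⟨⟨x, hx, hxA⟩, y, hy, hyt, hyA⟩ := hn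
  obtain ⟨d, h1, h2, h3⟩ := h.glue (q := p) (d₁ := triv p 1 (-rot (p t))) (d₂ := 0)
    (by simp [triv]) (by simp [triv])
  have := hX x hx y hy d fun e he => by
    rcases h3 e he with ⟨-, h⟩ | ⟨-, h⟩
    · rw [h, row_triv]
    · rw [h, map_zero]
  rw [row_mk, h1 x (Or.inl hxA), h2 y hyA] at this
  have hxt : x ≠ t := fun h' => h.1 (h' ▸ hxA)
  have hxy : x ≠ y := fun h' => hyA (h' ▸ hxA)
  refine hp.cross_ne_zero' hxy hxt hyt ?_
  simp only [cross, ip, triv, Pi.sub_apply, Pi.add_apply, Pi.smul_apply, Pi.neg_apply,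
    Pi.zero_apply, smul_eq_mul, rot_zero', rot_one'] at *
  linarith

theorem Generic.sep_mem (hp : Generic p) (hX : Rig p F (vertexSpan F)) (h : IsSep F A s t) {a b : V}
    (ha : a ∈ A) (haF : a ∈ vertexSpan F) (hb : b ∈ oside A s t) (hbF : b ∈ vertexSpan F) :
    s ≠ t ∧ s ∈ vertexSpan F ∧ t ∈ vertexSpan F := by
  have key : ∀ x, ¬ (IsSep F A x x ∧ b ≠ x) := by
    rintro x ⟨hx, hbx⟩
    rcases hp.sep_one hX hx with h' | h'
    · exact h' a haF ha
    · rcases h' b hbF with h' | h'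
      · exact hbx h'
      · exact hb.1 h'
  refine ⟨?_, ?_, ?_⟩
  · rintro rfl
    exact key s ⟨h, hb.2.1⟩
  · by_contra hs
    refine key t ⟨⟨h.2.1, h.2.1, fun x y hxy hx => ?_⟩, hb.2.2⟩
    rcases h.2.2 x y hxy hx with h' | rfl | h'
    · exact Or.inl h'
    · exact absurd (right_mem_vertexSpan hxy) hs
    · exact Or.inr (Or.inl h')
  · by_contra ht
    refine key s ⟨⟨h.1, h.1, fun x y hxy hx => ?_⟩, hb.2.1⟩
    rcases h.2.2 x y hxy hx with h' | h' | rfl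
    · exact Or.inl h'
    · exact Or.inr (Or.inl h')
    · exact absurd (right_mem_vertexSpan hxy) ht

theorem Generic.noncross_four (hp : Generic p) (hX : Rig p F (vertexSpan F)) {A' : Set V} {s' t' : V}
    (h : IsSep F A s t) (h' : IsSep F A' s' t') (hst : s ≠ t) (hsF : s ∈ vertexSpan F)
    (htF : t ∈ vertexSpan F) (hs : s ∈ A') (ht : t ∈ oside A' s' t') (hs' : s' ∈ A)
    (ht' : t' ∉ A) : False := by
  classical
  have hss' : s ≠ s' := fun e => h'.1 (e ▸ hs)
  have hst' : s ≠ t' := fun e => h'.2.1 (e ▸ hs)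
  obtain ⟨htA', hts', htt'⟩ := ht
  have hs't' : s' ≠ t' := fun e => ht' (e ▸ hs')
  let α := ip (p t - p t') (rot (p t' - p s))
  let β := ip (p t - p t') (rot (p t - p s'))
  have hα : α ≠ 0 := by
    have := hp.cross_ne_zero' htt'.symm hst'.symm hst.symm
    contrapose this
    simp only [α, ip, cross, Pi.sub_apply, rot_zero', rot_one'] at *
    linarith
  let τ₂ := triv p α (-(α • rot (p s')))
  let τ₃ := triv p β (-(β • rot (p s)))
  obtain ⟨ρ, c, h4t, h4t'⟩ := exists_triv_pair (q := p) (x := t) (y := t')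
    (d := fun v => if v = t then τ₂ t else τ₃ t') (hp.injective.ne htt') (by
      simp only [row_mk, if_true, htt'.symm, if_false, τ₂, τ₃, triv, α, β, ip, Pi.sub_apply,
        Pi.add_apply, Pi.smul_apply, Pi.neg_apply, smul_eq_mul, rot_zero', rot_one']
      ring)
  simp only [if_true, htt'.symm, if_false] at h4t h4t'
  let d : V → Fin 2 → ℝ := fun v => if v ∈ A then (if v ∈ A' then 0 else τ₂ v) else
    if v ∈ A' then τ₃ v else triv p ρ c v
  have hτ₂ : τ₂ s' = 0 := by simp [τ₂, triv]
  have hτ₃ : τ₃ s = 0 := by simp [τ₃, triv]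
  have hd1 : ∀ v, (v ∈ A ∨ v = s ∨ v = t) → (v ∈ A' ∨ v = s' ∨ v = t') → d v = 0 := by
    rintro v (hv | rfl | rfl) (hv' | rfl | rfl) <;> simp_all [d, h.1, h.2.1, h'.1, h'.2.1]
  have hd2 : ∀ v, (v ∈ A ∨ v = s ∨ v = t) → v ∉ A' → d v = τ₂ v := by
    rintro v (hv | rfl | rfl) hv' <;> simp_all [d, h.2.1]
  have hd3 : ∀ v, v ∉ A → (v ∈ A' ∨ v = s' ∨ v = t') → d v = τ₃ v := by
    rintro v hv (hv' | rfl | rfl) <;> simp_all [d, h'.2.1]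
  have hd4 : ∀ v, v ∉ A → v ∉ A' → d v = triv p ρ c v := by
    intro v hv hv'
    simp [d, hv, hv']
  have hk : ∀ e ∈ F, row p e d = 0 := by
    intro e he
    induction e with
    | _ a b =>
    rcases h.edge he with ⟨h1, h2⟩ | ⟨h1, h2⟩ <;> rcases h'.edge he with ⟨h1', h2'⟩ | ⟨h1', h2'⟩
    · rw [row_mk, hd1 a h1 h1', hd1 b h2 h2']; simp
    · rw [row_mk, hd2 a h1 h1', hd2 b h2 h2', ← row_mk, row_triv]
    · rw [row_mk, hd3 a h1 h1', hd3 b h2 h2', ← row_mk, row_triv]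
    · rw [row_mk, hd4 a h1 h1', hd4 b h2 h2', ← row_mk, row_triv]
  have h0 := hX s hsF t htF d hk
  have hds : d s = 0 := (hd3 s h.1 (Or.inl hs)).trans hτ₃
  have hdt : d t = τ₂ t := hd2 t (Or.inr (Or.inr rfl)) htA'
  rw [row_mk, hds, hdt] at h0
  have hc := mul_ne_zero hα (hp.cross_ne_zero' hst.symm hts' hss')
  apply hc
  simp only [τ₂, triv, cross, ip, Pi.sub_apply, Pi.add_apply, Pi.smul_apply, Pi.neg_apply,
    Pi.zero_apply, smul_eq_mul, rot_zero', rot_one'] at *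
  linarith

theorem Generic.noncross_two (hp : Generic p) (hX : Rig p F (vertexSpan F)) {A' : Set V} {s' t' : V}
    (h : IsSep F A s t) (h' : IsSep F A' s' t') {a b : V}
    (ha : a ∈ A) (haF : a ∈ vertexSpan F) (hb : b ∈ oside A s t) (hbF : b ∈ vertexSpan F)
    (hs : s ∈ A') (ht : t ∈ oside A' s' t') (hs' : s' ∈ A) (ht' : t' ∈ A) : False := by
  have h1 : IsSep F {v | v ∈ oside A s t ∧ v ∈ A'} s s := by
    refine ⟨fun h => h.1.2.1 rfl, fun h => h.1.2.1 rfl, fun x y hxy hx => ?_⟩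
    rcases h.compl.2.2 x y hxy hx.1 with hy | rfl | rfl
    · rcases h'.2.2 x y hxy hx.2 with hy' | rfl | rfl
      · exact Or.inl ⟨hy, hy'⟩
      · exact absurd hs' hy.1
      · exact absurd ht' hy.1
    · exact Or.inr (Or.inl rfl)
    · rcases h'.2.2 x y hxy hx.2 with hy' | rfl | rfl
      · exact absurd hy' ht.1
      · exact absurd rfl ht.2.1
      · exact absurd rfl ht.2.2
  have h2 : IsSep F {v | v ∈ oside A s t ∧ v ∉ A'} t t := by
    refine ⟨fun h => h.1.2.2 rfl, fun h => h.1.2.2 rfl, fun x y hxy hx => ?_⟩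
    rcases h.compl.2.2 x y hxy hx.1 with hy | rfl | rfl
    · refine Or.inl ⟨hy, fun hy' => ?_⟩
      rcases h'.2.2 y x (Sym2.eq_swap ▸ hxy) hy' with hx' | rfl | rfl
      · exact hx.2 hx'
      · exact hx.1.1 hs'
      · exact hx.1.1 ht'
    · rcases h'.2.2 y x (Sym2.eq_swap ▸ hxy) hs with hx' | rfl | rfl
      · exact absurd hx' hx.2
      · exact absurd hs' hx.1.1
      · exact absurd ht' hx.1.1
    · exact Or.inr (Or.inl rfl)
  by_cases hbA : b ∈ A'
  · rcases hp.sep_one hX h1 with h3 | h3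
    · exact h3 b hbF ⟨hb, hbA⟩
    · rcases h3 a haF with rfl | h3
      · exact h.1 ha
      · exact h3.1.1 ha
  · rcases hp.sep_one hX h2 with h3 | h3
    · exact h3 b hbF ⟨hb, hbA⟩
    · rcases h3 a haF with rfl | h3
      · exact h.2.1 ha
      · exact h3.1.1 ha

/-- The 2-separators of a rigid graph do not cross. -/
theorem Generic.noncross (hp : Generic p) (hX : Rig p F (vertexSpan F)) (h : IsSep F A s t)
    {a b : V} (ha : a ∈ A) (haF : a ∈ vertexSpan F) (hb : b ∈ oside A s t)
    (hbF : b ∈ vertexSpan F) : Unsep F s t := by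
  intro A' s' t' h' hs
  by_contra! ht
  have ht : t ∈ oside A' s' t' := ht
  obtain ⟨hst, hsF, htF⟩ := hp.sep_mem hX h ha haF hb hbF
  have key : ∀ x, x ∉ A → x ≠ s → x ≠ t → x ∈ oside A s t := fun x h1 h2 h3 => ⟨h1, h2, h3⟩
  have hs' : s' ≠ s ∧ s' ≠ t := ⟨fun e => h'.1 (e ▸ hs), fun e => ht.2.1 e.symm⟩
  have ht' : t' ≠ s ∧ t' ≠ t := ⟨fun e => h'.2.1 (e ▸ hs), fun e => ht.2.2 e.symm⟩
  by_cases hs'A : s' ∈ A <;> by_cases ht'A : t' ∈ A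
  · exact hp.noncross_two hX h h' ha haF hb hbF hs ht hs'A ht'A
  · exact hp.noncross_four hX h h' hst hsF htF hs ht hs'A ht'A
  · exact hp.noncross_four hX h h'.symm hst hsF htF hs ⟨ht.1, ht.2.2, ht.2.1⟩ ht'A hs'A
  · exact hp.noncross_two hX h.compl h' hb hbF (by rwa [h.oside_oside]) haF hs ht
      (key _ hs'A hs'.1 hs'.2) (key _ ht'A ht'.1 ht'.2)

end Separation

section Reduction

variable {V : Type*} [Fintype V] [DecidableEq V] {p : V → Fin 2 → ℝ} {F : Set (Sym2 V)}
  {A : Set V} {s t : V}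

/-- The part of `F` on the side `A` of a separation, with the virtual edge `st`. -/
def side (F : Set (Sym2 V)) (A : Set V) (s t : V) : Set (Sym2 V) :=
  insert s(s, t) {e | e ∈ F ∧ ∀ v ∈ e, v ∈ A ∨ v = s ∨ v = t}

theorem vertexSpan_side (h : IsSep F A s t) :
    vertexSpan (side F A s t) = (A ∩ vertexSpan F) ∪ {s, t} := by
  ext v
  rw [side, vertexSpan_insert, Set.union_comm, Set.mem_union, Set.mem_union]
  refine ⟨?_, ?_⟩
  · rintro (⟨e, he, hv⟩ | hv)
    · rcases he.2 v hv with h' | rfl | rfl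
      · exact Or.inl ⟨h', e, he.1, hv⟩
      · exact Or.inr (by simp)
      · exact Or.inr (by simp)
    · exact Or.inr hv
  · rintro (⟨hA, hv⟩ | hv)
    · obtain ⟨w, hw⟩ := mem_vertexSpan.1 hv
      refine Or.inl ⟨s(v, w), ⟨hw, fun x hx => ?_⟩, by simp⟩
      rcases Sym2.mem_iff.1 hx with rfl | rfl
      · exact Or.inl hA
      · exact h.2.2 _ _ hw hA
    · exact Or.inr hv

theorem exists_circ_of_rconn (hF : RConn (row p) F) (h2 : 2 ≤ F.ncard)
    {e : Sym2 V} (he : e ∈ F) : ∃ C ⊆ F, Circ (row p) C ∧ e ∈ C := by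
  obtain ⟨f, hf, hfe⟩ := Set.exists_ne_of_one_lt_ncard h2 e
  rcases hF.2 e he f hf with rfl | ⟨C, h1, h2, h3, h4⟩
  · exact absurd rfl hfe
  · exact ⟨C, h1, h2, h3⟩

theorem Generic.three_le_nb_rconn (hp : Generic p) (hF : RConn (row p) F)
    (hd : ∀ e ∈ F, ¬ e.IsDiag) (h2 : 2 ≤ F.ncard) {v : V} (hv : v ∈ vertexSpan F) :
    3 ≤ (nb F v).ncard := by
  obtain ⟨e, he, hve⟩ := hv
  obtain ⟨C, hCF, hC, heC⟩ := exists_circ_of_rconn hF h2 he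
  exact (hp.three_le_nb hC (fun e he => hd e (hCF he)) ⟨e, heC, hve⟩).trans
    (Set.ncard_le_ncard fun n hn => hCF hn)

theorem Generic.side_rconn (hp : Generic p) (hF : RConn (row p) F) (hd : ∀ e ∈ F, ¬ e.IsDiag)
    (h : IsSep F A s t) {a b : V} (ha : a ∈ A) (haF : a ∈ vertexSpan F) (hb : b ∈ oside A s t)
    (hbF : b ∈ vertexSpan F) : RConn (row p) (side F A s t) := by
  obtain ⟨hst, -, -⟩ := hp.sep_mem (hp.rig_rconn hF hd) h ha haF hb hbF
  refine rconn_of_coCirc (e := s(s, t)) (Set.mem_insert _ _) fun f hf => ?_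
  by_cases hfe : f = s(s, t)
  · exact Or.inl hfe.symm
  obtain ⟨hfF, hfA⟩ : f ∈ {e | e ∈ F ∧ ∀ v ∈ e, v ∈ A ∨ v = s ∨ v = t} := hf.resolve_left hfe
  obtain ⟨g, hg, hbg⟩ := hbF
  have hgA : ¬ ∀ v ∈ g, v ∈ A ∨ v = s ∨ v = t := fun h' => by
    rcases h' b hbg with h' | h' | h'
    exacts [hb.1 h', hb.2.1 h', hb.2.2 h']
  rcases hF.2 f hfF g hg with rfl | ⟨C, hCF, hC, hfC, hgC⟩
  · exact absurd hfA hgA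
  let K := {e | e ∈ C ∧ ∀ v ∈ e, v ∈ A ∨ v = s ∨ v = t}
  have hcl : Cl (row p) (insert s(s, t) (K \ {f})) f := by
    intro d hd'
    obtain ⟨ρ, c, h1, h2⟩ := exists_triv_pair (hp.injective.ne hst) (hd' _ (Set.mem_insert _ _))
    obtain ⟨d', h3, -, h4⟩ := h.glue (q := p) h1 h2
    rw [← row_congr p fun v hv => h3 v (hfA v hv)]
    refine hC.cl hfC d' fun e he => ?_
    rcases h4 e (hCF he.1) with ⟨h5, h6⟩ | ⟨-, h6⟩
    · rw [h6]
      exact hd' e (Or.inr ⟨⟨he.1, h5⟩, he.2⟩)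
    · rw [h6, row_triv]
  obtain ⟨D, hD, hfD, hDC⟩ := exists_circ_of_cl hcl (by simp [hfe])
  have hDK : D ⊆ insert s(s, t) K := fun e he => by
    rcases hD he with rfl | rfl | h'
    · exact Or.inr ⟨hfC, hfA⟩
    · exact Or.inl rfl
    · exact Or.inr h'.1
  refine Or.inr ⟨D, fun e he => (hDK he).imp_right fun h' => ⟨hCF h'.1, h'.2⟩, hDC, ?_, hfD⟩
  by_contra hn
  have hDK' : D ⊆ K := fun e he => (hDK he).resolve_left (by rintro rfl; exact hn he)
  exact hDC.1 (hC.2 D ⟨fun e he => (hDK' he).1, fun h' => hgA (hDK' (h' hgC)).2⟩)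

/-- A connected set without vertices of degree three remains connected, on the same vertex set,
after deleting a suitable edge. -/
theorem Generic.exists_reduction (hp : Generic p) (hF : RConn (row p) F)
    (hd : ∀ e ∈ F, ¬ e.IsDiag) (h2 : 2 ≤ F.ncard) : (∃ v ∈ vertexSpan F, (nb F v).ncard = 3) ∨
      ∃ e ∈ F, RConn (row p) (F \ {e}) ∧ 2 ≤ (F \ {e}).ncard ∧
        vertexSpan (F \ {e}) = vertexSpan F := by
  classical
  by_cases hFC : Circ (row p) F
  · obtain ⟨v, hv, -, hv3⟩ := exists_nb_three hd (fun v hv => hp.three_le_nb hFC hd hv)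
      (ncard_le_of_circ hFC h2) (S := ∅) (by simp)
    exact Or.inl ⟨v, hv, hv3⟩
  have hne : {D | D ⊂ F ∧ RConn (row p) D ∧ 2 ≤ D.ncard}.Nonempty := by
    obtain ⟨e, he⟩ := hF.1
    obtain ⟨C, hCF, hC, heC⟩ := exists_circ_of_rconn hF h2 he
    exact ⟨C, hCF.ssubset_of_ne fun h => hFC (h ▸ hC), hC.rconn,
      hp.two_le_ncard hC fun e he => hd e (hCF he)⟩
  obtain ⟨D, ⟨hDF, hD, hD2⟩, hmax⟩ := (Set.toFinite _).exists_maximal hne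
  have hmax : ∀ D', D ⊂ D' → D' ⊆ F → RConn (row p) D' → D' = F := by
    intro D' h1 h2 h3
    by_contra hne
    exact h1.2 (hmax ⟨h2.ssubset_of_ne hne, h3, hD2.trans (Set.ncard_le_ncard h1.1)⟩ h1.1)
  have hdD : ∀ e ∈ D, ¬ e.IsDiag := fun e he => hd e (hDF.1 he)
  have hrig := hp.rig_rconn hD hdD
  have hins : ∀ e ∈ F \ D, e ∈ pairs (vertexSpan D) → insert e D = F := fun e he hep =>
    hmax _ (Set.ssubset_insert he.2) (Set.insert_subset he.1 hDF.1)
      (hD.insert (hrig.cl hep) (hp.reg_singleton (hd e he.1)))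
  obtain ⟨e₀, he₀, he₀D⟩ := Set.exists_of_ssubset hDF
  by_cases hV : vertexSpan D = vertexSpan F
  · have h := hins e₀ ⟨he₀, he₀D⟩ (hV ▸ subset_pairs F he₀)
    have h' : F \ {e₀} = D := by rw [← h]; simp [he₀D]
    exact Or.inr ⟨e₀, he₀, by rw [h']; exact ⟨hD, hD2, hV⟩⟩
  left
  set Y := vertexSpan F \ vertexSpan D with hY
  have hmeet : ∀ e ∈ F \ D, e ∉ pairs (vertexSpan D) := fun e he hep => by
    refine hV ((vertexSpan_mono hDF.1).antisymm ?_)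
    rw [← hins e he hep]
    refine vertexSpan_subset ?_
    rintro f (rfl | hf)
    exacts [hep, subset_pairs D hf]
  have hcirc1 : ∀ C ⊆ F, Circ (row p) C → ∀ d ∈ C, d ∈ D → C ⊆ D ∨ F \ D ⊆ C := by
    intro C hCF hC d hdC hdD
    by_cases hCD : C ⊆ D
    · exact Or.inl hCD
    have := hmax (D ∪ C) ⟨Set.subset_union_left, fun h => hCD fun x hx => h (Or.inr hx)⟩
      (Set.union_subset hDF.1 hCF) (hD.union hC.rconn ⟨d, hdD, hdC⟩)
    exact Or.inr fun x hx => ((this ▸ hx.1 : x ∈ D ∪ C)).resolve_left hx.2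
  obtain ⟨d₀, hd₀⟩ := hD.1
  have hcirc2 : ∀ e ∈ F \ D, ∃ C ⊆ F, Circ (row p) C ∧ d₀ ∈ C ∧ e ∈ C ∧ F \ D ⊆ C := by
    intro e he
    rcases hF.2 d₀ (hDF.1 hd₀) e he.1 with rfl | ⟨C, h1, h2, h3, h4⟩
    · exact absurd hd₀ he.2
    · exact ⟨C, h1, h2, h3, h4, (hcirc1 C h1 h2 d₀ h3 hd₀).resolve_left fun h => he.2 (h h4)⟩
  have hcirc : ∀ C ⊆ F, Circ (row p) C → C ⊆ D ∨ F \ D ⊆ C := by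
    intro C hCF hC
    by_cases hCD : ∃ d ∈ C, d ∈ D
    · obtain ⟨d, hdC, hdD⟩ := hCD
      exact hcirc1 C hCF hC d hdC hdD
    push Not at hCD
    obtain ⟨e, he⟩ := hC.nonempty
    obtain ⟨C', h1, h2, h3, h4, h5⟩ := hcirc2 e ⟨hCF he, hCD e he⟩
    have := hC.eq_of_subset h2 fun x hx => h5 ⟨hCF hx, hCD x hx⟩
    exact absurd hd₀ (hCD d₀ (this ▸ h3))
  obtain ⟨I, hID, hI, hIcl⟩ := exists_basis (r := row p) D
  have hB : Reg (row p) (I ∪ (F \ D) \ {e₀}) := by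
    by_contra hn
    obtain ⟨C, hCB, hC⟩ := exists_circ_of_not_reg hn
    rcases hcirc C (hCB.trans (Set.union_subset (hID.trans hDF.1)
      (Set.sdiff_subset.trans Set.sdiff_subset))) hC with h | h
    · exact hC.1 (hI.mono fun x hx => (hCB hx).resolve_right fun h' => h'.1.2 (h hx))
    · rcases hCB (h ⟨he₀, he₀D⟩) with h' | h'
      exacts [he₀D (hID h'), h'.2 rfl]
  have hBcl : ∀ f ∈ F, f ≠ e₀ → Cl (row p) (I ∪ (F \ D) \ {e₀}) f := fun f hf hne => by
    by_cases hfD : f ∈ D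
    · exact (hIcl f hfD).mono Set.subset_union_left
    · exact Cl.of_mem (Or.inr ⟨⟨hf, hfD⟩, hne⟩)
  have hBrig : Rig p (I ∪ (F \ D) \ {e₀}) (vertexSpan F) :=
    ((hp.rig_rconn hF hd).trans fun f hf => (by
      by_cases hfe : f = e₀
      · subst hfe
        exact hF.cl h2 hf
      · exact Cl.of_mem ⟨hf, hfe⟩ : Cl (row p) (F \ {e₀}) f)).trans fun f hf => hBcl f hf.1 hf.2
  have hVD : 2 ≤ (vertexSpan D).ncard := by
    induction d₀ with
    | _ x y =>
      have hxy : x ≠ y := hdD _ hd₀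
      exact (Set.one_lt_ncard).2 ⟨x, left_mem_vertexSpan hd₀, y, right_mem_vertexSpan hd₀, hxy⟩
  have hc1 := hp.ncard_of_rig hI (hID.trans (subset_pairs D)) hVD (hrig.trans hIcl)
  have hc2 := hp.ncard_of_rig hB (Set.union_subset (hID.trans (hDF.1.trans (subset_pairs F)))
    ((Set.sdiff_subset.trans Set.sdiff_subset).trans (subset_pairs F)))
    (hVD.trans (Set.ncard_le_ncard (vertexSpan_mono hDF.1))) hBrig
  have hc3 : (I ∪ (F \ D) \ {e₀}).ncard = I.ncard + ((F \ D) \ {e₀}).ncard :=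
    Set.ncard_union_eq (Set.disjoint_left.2 fun x hx hx' => hx'.1.2 (hID hx))
  have hc4 : ((F \ D) \ {e₀}).ncard + 1 = (F \ D).ncard :=
    Set.ncard_sdiff_singleton_add_one ⟨he₀, he₀D⟩
  have hc5 : Y.ncard + (vertexSpan D).ncard = (vertexSpan F).ncard :=
    Set.ncard_sdiff_add_ncard_of_subset (vertexSpan_mono hDF.1)
  have hY0 : 0 < Y.ncard := by
    rw [Set.ncard_pos]
    exact Set.sdiff_nonempty.2 fun h => hV ((vertexSpan_mono hDF.1).antisymm h)
  have hsum := sum_nb (F := F \ D) fun e he => hd e he.1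
  by_contra! h4
  have hdeg : ∀ v ∈ Y, 4 ≤ (nb (F \ D) v).ncard := by
    intro v hv
    have h3 := hp.three_le_nb_rconn hF hd h2 hv.1
    have : nb (F \ D) v = nb F v := by
      ext n
      exact ⟨fun h => h.1, fun h => ⟨h, fun h' => hv.2 (left_mem_vertexSpan h')⟩⟩
    rw [this]
    have := h4 v hv.1
    omega
  rw [← Finset.sum_filter_add_sum_filter_not _ (· ∈ Y)] at hsum
  have hs1 : 4 * Y.ncard ≤ ∑ v with v ∈ Y, (nb (F \ D) v).ncard := by
    rw [Set.ncard_eq_toFinset_card', mul_comm, ← smul_eq_mul, ← Finset.sum_const]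
    have : Y.toFinset = Finset.univ.filter (· ∈ Y) := by ext; simp
    rw [this]
    exact Finset.sum_le_sum fun v hv => hdeg v (by simpa using hv)
  have hs2 : (F \ D).ncard ≤ ((F \ D) ∩ pairs Y).ncard + ∑ v with v ∉ Y, (nb (F \ D) v).ncard := by
    have hsub : F \ D ⊆ ((F \ D) ∩ pairs Y) ∪
        ⋃ v ∈ Finset.univ.filter (· ∉ Y), (fun n => s(v, n)) '' nb (F \ D) v := by
      intro e he
      by_cases heY : e ∈ pairs Y
      · exact Or.inl ⟨he, heY⟩
      simp only [pairs, Set.mem_ofPred_eq, not_forall] at heY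
      obtain ⟨v, ⟨w, rfl⟩, hv⟩ := heY
      refine Or.inr (Set.mem_biUnion (x := v) (by simpa using hv) ⟨w, he, rfl⟩)
    refine (Set.ncard_le_ncard hsub).trans ((Set.ncard_union_le _ _).trans ?_)
    gcongr
    refine (Finset.set_ncard_biUnion_le _ _).trans (Finset.sum_le_sum fun v _ => ?_)
    exact Set.ncard_image_le
  have hs3 : ((F \ D) ∩ pairs Y).ncard + 3 ≤ (F \ D).ncard := by
    by_cases hz : ((F \ D) ∩ pairs Y).ncard ≤ 1
    · by_cases hY1 : Y.ncard = 1
      · obtain ⟨y, hy⟩ := Set.ncard_eq_one.1 hY1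
        have : (F \ D) ∩ pairs Y = ∅ := by
          refine Set.eq_empty_of_forall_notMem fun e he => hd e he.1.1 ?_
          induction e with
          | _ a b =>
            have := mk_mem_pairs.1 he.2
            rw [hy] at this
            exact Sym2.mk_isDiag_iff.2 (this.1.trans this.2.symm)
        rw [this, Set.ncard_empty]
        omega
      · omega
    · have hreg : Reg (row p) (((F \ D) ∩ pairs Y) \ {e₀}) :=
        hB.mono fun x hx => Or.inr ⟨hx.1.1, hx.2⟩
      have h5 := Set.ncard_le_ncard_sdiff_add_ncard ((F \ D) ∩ pairs Y) {e₀}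
      rw [Set.ncard_singleton] at h5
      have h6 := hreg.ncard_add_three_le (fun x hx => hx.1.2) ((Set.ncard_pos).1 (by omega))
      omega
  omega

end Reduction

section OneExtension

variable {V : Type*} {p q : V → Fin 2 → ℝ}

/-- The pairs whose distance is the same in both placements. -/
def sameLen (p q : V → Fin 2 → ℝ) : Set (Sym2 V) := {e | row p e p = row q e q}

/-- A derivation takes equal lengths to equal infinitesimal length changes. -/
theorem row_derivation {D : ℝ → ℝ} (h1 : ∀ a b, D (a + b) = D a + D b)
    (h2 : ∀ a b, D (a * b) = a * D b + b * D a) {e : Sym2 V} (he : e ∈ sameLen p q) :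
    row p e (fun v i => D (p v i)) = row q e (fun v i => D (q v i)) := by
  have h3 : ∀ a b, D (a - b) = D a - D b := fun a b => by
    have := h1 (a - b) b
    rw [sub_add_cancel] at this
    linarith
  induction e with
  | _ u v =>
    have := congrArg D (show row p s(u, v) p = row q s(u, v) q from he)
    simp only [row_mk, ip, Pi.sub_apply, h1, h2, h3] at this ⊢
    linarith

variable [Fintype V] [DecidableEq V]

theorem Generic.reg_of_sameLen (hp : Generic p) (q : V → Fin 2 → ℝ) {I : Set (Sym2 V)}
    (hI : Reg (row p) I) (hIL : I ⊆ sameLen p q) : Reg (row q) I := fun c => by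
  obtain ⟨d, hd⟩ := hI c
  obtain ⟨D, h1, h2, h3⟩ := exists_derivation hp fun vi => d vi.1 vi.2
  refine ⟨fun v i => D (q v i), fun e he => ?_⟩
  rw [← row_derivation h1 h2 (hIL he), ← hd e he]
  congr 1
  ext v i
  exact h3 (v, i)

theorem linear_isometry_aux {m₀ m₁ x y z x' y' z' : Fin 2 → ℝ} (hx0 : ip x m₀ = x' 0)
    (hx1 : ip x m₁ = x' 1) (hy0 : ip y m₀ = y' 0) (hy1 : ip y m₁ = y' 1) (hz0 : ip z m₀ = z' 0)
    (hz1 : ip z m₁ = z' 1) (hx : ip x x = ip x' x') (hy : ip y y = ip y' y')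
    (hz : ip z z = ip z' z') (hyz : cross y' z' ≠ 0) (hxz : cross x' z' ≠ 0) :
    ip (x - y) (x - y) = ip (x' - y') (x' - y') := by
  simp only [ip, cross] at *
  simp only [← hx0, ← hx1, ← hy0, ← hy1, ← hz0, ← hz1, Pi.sub_apply] at *
  have e1 : y 0 * z 1 - y 1 * z 0 ≠ 0 := fun h => hyz (by
    linear_combination (m₀ 0 * m₁ 1 - m₀ 1 * m₁ 0) * h)
  have e2 : x 0 * z 1 - x 1 * z 0 ≠ 0 := fun h => hxz (by
    linear_combination (m₀ 0 * m₁ 1 - m₀ 1 * m₁ 0) * h)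
  refine sub_eq_zero.1 (mul_left_cancel₀ (mul_ne_zero e1 e2) ?_)
  linear_combination ((y 0 * z 1 - y 1 * z 0) * (x 0 * z 1 - x 1 * z 0) -
    (y 0 * z 1 - y 1 * z 0) ^ 2) * hx + ((y 0 * z 1 - y 1 * z 0) * (x 0 * z 1 - x 1 * z 0) -
    (x 0 * z 1 - x 1 * z 0) ^ 2) * hy + (x 0 * y 1 - x 1 * y 0) ^ 2 * hz

/-- If the pairs of preserved length within `R` form a rigid graph and three pairs joining
`v ∉ R` to `R` have preserved length, then the three endpoints span a preserved triangle. -/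
theorem Generic.sameLen_of_three (hp : Generic p) {R : Set V} {v a b c : V} (hv : v ∉ R)
    (hR : Rig p (sameLen p q ∩ pairs R) R) (ha : a ∈ R) (hb : b ∈ R) (hc : c ∈ R) (hab : a ≠ b)
    (hac : a ≠ c) (hbc : b ≠ c) (hva : s(v, a) ∈ sameLen p q) (hvb : s(v, b) ∈ sameLen p q)
    (hvc : s(v, c) ∈ sameLen p q) : s(a, b) ∈ sameLen p q := by
  obtain ⟨I, hIL, hI, hIcl⟩ := exists_basis (r := row p) (sameLen p q ∩ pairs R)
  have hR2 : 2 < R.ncard := (Set.two_lt_ncard).2 ⟨a, ha, b, hb, c, hc, hab, hac, hbc⟩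
  have hcard := hp.ncard_of_rig hI (fun e he => (hIL he).2) (by omega) (hR.trans hIcl)
  have hqI := hp.reg_of_sameLen q hI fun e he => (hIL he).1
  have key : ∀ k : Fin 2, ∃ m, ∀ x ∈ R, s(v, x) ∈ sameLen p q →
      ip (q v - q x) m = (p v - p x) k := by
    intro k
    obtain ⟨D, h1, h2, h3⟩ := exists_derivation hp fun vi => if vi = (v, k) then 1 else 0
    have hDp : ∀ x, x ∈ R → (fun i => D (p x i)) = 0 := fun x hx => by
      ext i
      refine (h3 (x, i)).trans (if_neg ?_)
      rintro ⟨⟩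
      exact hv hx
    obtain ⟨ρ, t, ht⟩ := hqI.triv_of_ncard (fun e he => (hIL he).2)
      ((Set.ncard_pos).1 (by omega)) hcard (d := fun v i => D (q v i)) fun e he => by
        rw [← row_derivation h1 h2 (hIL he).1,
          row_congr p (d' := 0) fun x hx => hDp x ((hIL he).2 x hx), map_zero]
    refine ⟨(fun i => D (q v i)) - triv q ρ t v, fun x hx hvx => ?_⟩
    have h4 := row_derivation h1 h2 hvx
    have h5 := row_triv q ρ t s(v, x)
    have h6 : ∀ i, D (p v i) = if i = k then 1 else 0 := fun i => by
      refine (h3 (v, i)).trans ?_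
      simp
    rw [row_mk, hDp x hx, row_mk, ht x hx, ip_sub_right, ip_sub_right] at h4
    rw [row_mk, ip_sub_right] at h5
    rw [ip_sub_right]
    have h7 : ip (p v - p x) (fun i => D (p v i)) = (p v - p x) k := by
      simp only [h6, ip]
      fin_cases k <;> simp
    rw [h7, ip_zero_right] at h4
    linarith
  obtain ⟨m₀, hm₀⟩ := key 0
  obtain ⟨m₁, hm₁⟩ := key 1
  have hva' : v ≠ a := fun h => hv (h ▸ ha)
  have hvb' : v ≠ b := fun h => hv (h ▸ hb)
  have hvc' : v ≠ c := fun h => hv (h ▸ hc)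
  have := linear_isometry_aux (hm₀ a ha hva) (hm₁ a ha hva) (hm₀ b hb hvb) (hm₁ b hb hvb)
    (hm₀ c hc hvc) (hm₁ c hc hvc) (Eq.symm hva) (Eq.symm hvb) (Eq.symm hvc)
    (hp.cross_ne_zero' hvb' hvc' hbc) (hp.cross_ne_zero' hva' hvc' hac)
  rw [sub_sub_sub_cancel_left, sub_sub_sub_cancel_left] at this
  rw [Sym2.eq_swap]
  exact this.symm

end OneExtension

section Attachment

variable {V : Type*} {F H : Set (Sym2 V)} {N A : Set V} {u w : V}

/-- `H` is induced in `F` and attached to the rest of `F` at a set `N` that is complete in `H`. -/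
def Attached (F H : Set (Sym2 V)) (N : Set V) : Prop :=
  (∀ x y, s(x, y) ∈ F → x ∈ vertexSpan H → y ∈ vertexSpan H → s(x, y) ∈ H) ∧
    (∀ x y, s(x, y) ∈ F → x ∈ vertexSpan H → y ∉ vertexSpan H → x ∈ N) ∧
      ∀ m ∈ N, ∀ n ∈ N, m ≠ n → s(m, n) ∈ H

theorem Attached.unsep (h : Attached F H N) (hu : u ∈ vertexSpan H) (hw : w ∈ vertexSpan H)
    (huw : Unsep F u w) : Unsep H u w := by
  intro A s t hA huA
  by_contra! hwA
  by_cases hN : ∃ n ∈ N, n ∈ A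
  · obtain ⟨n, hn, hnA⟩ := hN
    have hN' : ∀ m ∈ N, m ∈ A ∨ m = s ∨ m = t := fun m hm => by
      by_cases hmn : n = m
      · exact Or.inl (hmn ▸ hnA)
      · exact hA.2.2 n m (h.2.2 n hn m hm hmn) hnA
    have hsep : IsSep F {x | (x ∈ vertexSpan H → x ∈ A) ∧ x ≠ s ∧ x ≠ t} s t := by
      refine ⟨fun h => h.2.1 rfl, fun h => h.2.2 rfl, fun x y hxy hx => ?_⟩
      by_cases hs : y = s
      · exact Or.inr (Or.inl hs)
      by_cases ht : y = t
      · exact Or.inr (Or.inr ht)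
      refine Or.inl ⟨fun hy => ?_, hs, ht⟩
      have : y ∈ A ∨ y = s ∨ y = t := by
        by_cases hxH : x ∈ vertexSpan H
        · exact hA.2.2 x y (h.1 x y hxy hxH hy) (hx.1 hxH)
        · exact hN' y (h.2.1 y x (Sym2.eq_swap ▸ hxy) hy hxH)
      exact this.resolve_right (by tauto)
    rcases huw _ s t hsep ⟨fun _ => huA, fun e => hA.1 (e ▸ huA), fun e => hA.2.1 (e ▸ huA)⟩
      with h' | h' | h'
    exacts [hwA.1 (h'.1 hw), hwA.2.1 h', hwA.2.2 h']
  · push Not at hN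
    have hsep : IsSep F {x | x ∈ A ∧ x ∈ vertexSpan H} s t := by
      refine ⟨fun h => hA.1 h.1, fun h => hA.2.1 h.1, fun x y hxy hx => ?_⟩
      have hy : y ∈ vertexSpan H := by
        by_contra hy
        exact hN x (h.2.1 x y hxy hx.2 hy) hx.1
      exact (hA.2.2 x y (h.1 x y hxy hx.2 hy) hx.1).imp_left fun h' => ⟨h', hy⟩
    rcases huw _ s t hsep ⟨huA, hu⟩ with h' | h' | h'
    exacts [hwA.1 h'.1, hwA.2.1 h', hwA.2.2 h']

variable [DecidableEq V] {p : V → Fin 2 → ℝ}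

theorem Attached.unsep_of_notMem (h : Attached F H N) (hp : Generic p)
    (hF : Rig p F (vertexSpan F)) (hNF : N ⊆ vertexSpan F) (huF : u ∈ vertexSpan F)
    (hu : u ∈ vertexSpan H) (hw : w ∉ vertexSpan H) (huw : Unsep F u w) {n : V} (hn : n ∈ N) :
    Unsep H u n := by
  intro A s t hA huA
  by_contra! hnA
  have hN : ∀ x ∈ A, x ∈ vertexSpan H → ∀ y, s(x, y) ∈ F → y ∈ vertexSpan H := by
    intro x hx hxH y hxy
    by_contra hy
    have hxn : x ≠ n := fun e => hnA.1 (e ▸ hx)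
    rcases hA.2.2 x n (h.2.2 x (h.2.1 x y hxy hxH hy) n hn hxn) hx with h' | h' | h'
    exacts [hnA.1 h', hnA.2.1 h', hnA.2.2 h']
  have hsep : ∀ x ∈ A ∩ vertexSpan H, ∀ y, s(x, y) ∈ F →
      y ∈ A ∩ vertexSpan H ∨ (y = s ∨ y = t) ∧ y ∈ vertexSpan H := by
    intro x hx y hxy
    have hy := hN x hx.1 hx.2 y hxy
    exact (hA.2.2 x y (h.1 x y hxy hx.2 hy) hx.1).imp (fun h' => ⟨h', hy⟩) fun h' => ⟨h', hy⟩
  have key : ∀ r, r ∉ A → n ≠ r → ¬ ∀ x ∈ A ∩ vertexSpan H, ∀ y, s(x, y) ∈ F →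
      y ∈ A ∩ vertexSpan H ∨ y = r := by
    intro r hr hnr h'
    rcases hp.sep_one hF (A := A ∩ vertexSpan H) (t := r) ⟨fun h => hr h.1, fun h => hr h.1,
      fun a b hab ha => (h' a ha b hab).imp_right Or.inl⟩ with h'' | h''
    · exact h'' u huF ⟨huA, hu⟩
    · rcases h'' n (hNF hn) with h'' | h''
      · exact hnr h''
      · exact hnA.1 h''.1
  rcases huw (A ∩ vertexSpan H) s t ⟨fun h => hA.1 h.1, fun h => hA.2.1 h.1,
    fun a b hab ha => (hsep a ha b hab).imp_right And.left⟩ ⟨huA, hu⟩ with h' | rfl | rfl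
  · exact hw h'.2
  · refine key t hA.2.1 hnA.2.2 fun x hx y hxy => ?_
    rcases hsep x hx y hxy with h' | ⟨rfl | rfl, h'⟩
    · exact Or.inl h'
    · exact absurd h' hw
    · exact Or.inr rfl
  · refine key s hA.1 hnA.2.1 fun x hx y hxy => ?_
    rcases hsep x hx y hxy with h' | ⟨rfl | rfl, h'⟩
    · exact Or.inl h'
    · exact Or.inr rfl
    · exact absurd h' hw

end Attachment

section Closure

variable {V : Type*} {p : V → Fin 2 → ℝ} {L F : Set (Sym2 V)}

/-- Closure of a set of pairs under the operation of `Generic.sameLen_of_three`. -/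
def ExtClosed (p : V → Fin 2 → ℝ) (L : Set (Sym2 V)) : Prop :=
  ∀ (R : Set V) (v a b c : V), v ∉ R → Rig p (L ∩ pairs R) R → a ∈ R → b ∈ R → c ∈ R → a ≠ b →
    a ≠ c → b ≠ c → s(v, a) ∈ L → s(v, b) ∈ L → s(v, c) ∈ L → s(a, b) ∈ L

/-- All unseparated pairs of vertices of `F` belong to `L`. -/
def Closes (L F : Set (Sym2 V)) : Prop :=
  ∀ u ∈ vertexSpan F, ∀ w ∈ vertexSpan F, u ≠ w → Unsep F u w → s(u, w) ∈ L

variable [Fintype V] [DecidableEq V]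

theorem Generic.rig_delete (hp : Generic p) (hF : Rig p F (vertexSpan F)) {v a b c : V}
    (hN : nb F v = {a, b, c}) (h : Rig p {e | e ∈ F ∧ v ∉ e} {a, b, c}) :
    Rig p {e | e ∈ F ∧ v ∉ e} (vertexSpan F \ {v}) := by
  intro x hx y hy d hd
  obtain ⟨ρ, t, ht⟩ := hp.rig_triv h hd
  have h1 := hF x hx.1 y hy.1 (Function.update d v (triv p ρ t v)) fun e he => by
    by_cases hve : v ∈ e
    · obtain ⟨n, rfl⟩ := hve
      have hn : n ∈ nb F v := he
      by_cases hnv : n = v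
      · exact row_diag p _ (Sym2.mk_isDiag_iff.2 hnv.symm)
      rw [row_mk, Function.update_self, Function.update_of_ne hnv, ht n (hN ▸ hn), ← row_mk,
        row_triv]
    · rw [row_congr p (d' := d) fun z hz => Function.update_of_ne (by rintro rfl; exact hve hz) _ _]
      exact hd e ⟨he, hve⟩
  rwa [row_mk, Function.update_of_ne hx.2, Function.update_of_ne hy.2, ← row_mk] at h1

end Closure

section DegreeThree

variable {V : Type*} [Fintype V] [DecidableEq V] {p : V → Fin 2 → ℝ} {L F : Set (Sym2 V)}
  {v a b c : V}

/-- The graph obtained from `F` by deleting the vertex `v` and adding the triangle `abc`. -/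
def deltaGraph (F : Set (Sym2 V)) (v a b c : V) : Set (Sym2 V) :=
  {e | e ∈ F ∧ v ∉ e} ∪ {s(a, b), s(b, c), s(a, c)}

theorem Generic.coCirc_delta (hp : Generic p) (hF : RConn (row p) F)
    (hN : nb F v = {a, b, c}) {f : Sym2 V} (hf : f ∈ deltaGraph F v a b c) :
    ∃ e ∈ ({s(a, b), s(b, c), s(a, c)} : Set (Sym2 V)),
      CoCirc (row p) (deltaGraph F v a b c) e f := by
  by_cases hfT : f ∈ ({s(a, b), s(b, c), s(a, c)} : Set (Sym2 V))
  · exact ⟨f, hfT, Or.inl rfl⟩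
  obtain ⟨hfF, hvf⟩ : f ∈ F ∧ v ∉ f := hf.resolve_right hfT
  have hva : s(v, a) ∈ F := by
    have : a ∈ nb F v := by simp [hN]
    exact this
  rcases hF.2 f hfF _ hva with rfl | ⟨C, hCF, hC, hfC, haC⟩
  · simp at hvf
  have hcl : Cl (row p) (({e | e ∈ C ∧ v ∉ e} \ {f}) ∪ {s(a, b), s(b, c), s(a, c)}) f := by
    intro d hd
    obtain ⟨ρ, t, ht⟩ := hp.rig_triv (rig_triple (a := a) (b := b) (c := c)
      (Cl.of_mem (Or.inr (by simp))) (Cl.of_mem (Or.inr (by simp)))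
      (Cl.of_mem (Or.inr (by simp)))) hd
    have h1 : ∀ e : Sym2 V, v ∉ e → row p e (Function.update d v (triv p ρ t v)) = row p e d :=
      fun e hve => row_congr p fun z hz => Function.update_of_ne (by rintro rfl; exact hve hz) _ _
    rw [← h1 f hvf]
    refine hC.cl hfC _ fun e he => ?_
    by_cases hve : v ∈ e
    · obtain ⟨n, rfl⟩ := hve
      have hn : n ∈ nb F v := hCF he.1
      by_cases hnv : n = v
      · exact row_diag p _ (Sym2.mk_isDiag_iff.2 hnv.symm)
      rw [row_mk, Function.update_self, Function.update_of_ne hnv, ht n (hN ▸ hn), ← row_mk,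
        row_triv]
    · rw [h1 e hve]
      exact hd e (Or.inl ⟨⟨he.1, hve⟩, he.2⟩)
  obtain ⟨D, hD, hfD, hDC⟩ := exists_circ_of_cl hcl (by
    rintro (h | h)
    exacts [h.2 rfl, hfT h])
  have hD' : D ⊆ {e | e ∈ C ∧ v ∉ e} ∪ {s(a, b), s(b, c), s(a, c)} := fun e he => by
    rcases hD he with rfl | h | h
    exacts [Or.inl ⟨hfC, hvf⟩, Or.inl h.1, Or.inr h]
  have hDT : ∃ e ∈ D, e ∈ ({s(a, b), s(b, c), s(a, c)} : Set (Sym2 V)) := by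
    by_contra! hn
    refine hDC.1 (hC.2 D ⟨fun e he => ((hD' he).resolve_right (hn e he)).1, fun h => ?_⟩)
    exact ((hD' (h haC)).resolve_right (hn _ (h haC))).2 (by simp)
  obtain ⟨e, heD, heT⟩ := hDT
  exact ⟨e, heT, Or.inr ⟨D, fun g hg => (hD' hg).imp_left fun h => ⟨hCF h.1, h.2⟩, hDC, heD, hfD⟩⟩

theorem Generic.cl_delta (hp : Generic p) (hF : RConn (row p) F) (hd : ∀ e ∈ F, ¬ e.IsDiag)
    (h2 : 2 ≤ F.ncard) (hab : a ≠ b) (hac : a ≠ c) (hbc : b ≠ c) (hN : nb F v = {a, b, c}) :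
    Rig p {e | e ∈ F ∧ v ∉ e} {a, b, c} := by
  have hmem : ∀ n ∈ ({a, b, c} : Set V), s(v, n) ∈ F := fun n hn => by
    rw [← hN] at hn
    exact hn
  have hne : ∀ n ∈ ({a, b, c} : Set V), n ≠ v := fun n hn h =>
    hd _ (hmem n hn) (Sym2.mk_isDiag_iff.2 h.symm)
  obtain ⟨C, hCF, hC, haC⟩ := exists_circ_of_rconn hF h2 (hmem a (by simp))
  have hNC : nb C v = {a, b, c} := by
    refine Set.eq_of_subset_of_ncard_le (fun n hn => hN ▸ hCF hn) ?_
    rw [← hN]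
    refine le_trans ?_ (hp.three_le_nb hC (fun e he => hd e (hCF he)) (left_mem_vertexSpan haC))
    rw [hN]
    have h1 := Set.ncard_insert_le a {b, c}
    have h2 := Set.ncard_insert_le b {c}
    rw [Set.ncard_singleton] at h2
    omega
  have hsub : {e | e ∈ C ∧ v ∉ e} ⊆ {e | e ∈ F ∧ v ∉ e} := fun e he => ⟨hCF he.1, he.2⟩
  have ha := hne a (by simp)
  have hb := hne b (by simp)
  have hc := hne c (by simp)
  refine rig_triple ?_ ?_ ?_
  · exact (hp.circ_cl_nb hC ha hb hc hab hac hbc hNC).mono hsub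
  · refine (hp.circ_cl_nb hC hb hc ha hbc hab.symm hac.symm ?_).mono hsub
    rw [hNC]; ext; simp; tauto
  · refine (hp.circ_cl_nb hC ha hc hb hac hab hbc.symm ?_).mono hsub
    rw [hNC]; ext; simp; tauto

theorem Generic.closes_delta (hp : Generic p) (hF : RConn (row p) F) (hd : ∀ e ∈ F, ¬ e.IsDiag)
    (hab : a ≠ b) (hac : a ≠ c) (hbc : b ≠ c) (hN : nb F v = {a, b, c}) (hFL : F ⊆ L)
    (hTL : ({s(a, b), s(b, c), s(a, c)} : Set (Sym2 V)) ⊆ L)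
    (IH : ∀ F' ⊆ L, RConn (row p) F' → (∀ e ∈ F', ¬ e.IsDiag) → vertexSpan F' ⊂ vertexSpan F →
      Closes L F') {u w : V} (hu : u ∈ vertexSpan F \ {v}) (hw : w ∈ vertexSpan F \ {v})
    (huw : u ≠ w) (h : Unsep F u w) : s(u, w) ∈ L := by
  set G := deltaGraph F v a b c with hG
  have hmem : ∀ n, s(v, n) ∈ F ↔ n = a ∨ n = b ∨ n = c := fun n => by
    change n ∈ nb F v ↔ _
    simp [hN]
  have hvF : v ∈ vertexSpan F := left_mem_vertexSpan ((hmem a).2 (by simp))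
  have hne : ∀ n, n = a ∨ n = b ∨ n = c → n ≠ v := fun n hn h =>
    hd _ ((hmem n).2 hn) (Sym2.mk_isDiag_iff.2 h.symm)
  have hTG : ∀ x y, (x = a ∨ x = b ∨ x = c) → (y = a ∨ y = b ∨ y = c) → x ≠ y →
      s(x, y) ∈ ({s(a, b), s(b, c), s(a, c)} : Set (Sym2 V)) := by
    rintro x y (rfl | rfl | rfl) (rfl | rfl | rfl) hxy <;> simp_all
  have hT : ∀ e ∈ ({s(a, b), s(b, c), s(a, c)} : Set (Sym2 V)), ∃ x y, e = s(x, y) ∧ x ≠ y ∧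
      (x = a ∨ x = b ∨ x = c) ∧ (y = a ∨ y = b ∨ y = c) := by
    rintro e (rfl | rfl | rfl)
    exacts [⟨a, b, by simp [hab]⟩, ⟨b, c, by simp [hbc]⟩, ⟨a, c, by simp [hac]⟩]
  have hFG : ∀ x y, s(x, y) ∈ F → x ≠ v → y ≠ v → s(x, y) ∈ G := fun x y hxy hx hy =>
    Or.inl ⟨hxy, by simp [hx.symm, hy.symm]⟩
  have hGd : ∀ e ∈ G, ¬ e.IsDiag := by
    rintro e (he | he)
    · exact hd e he.1
    · obtain ⟨x, y, rfl, hxy, -⟩ := hT e he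
      simpa using hxy
  have hGL : G ⊆ L := Set.union_subset (fun e he => hFL he.1) hTL
  have hGV : vertexSpan G ⊆ vertexSpan F \ {v} := by
    rintro z ⟨e, he | he, hz⟩
    · exact ⟨⟨e, he.1, hz⟩, fun h => he.2 (h ▸ hz)⟩
    · obtain ⟨x, y, rfl, -, hx, hy⟩ := hT e he
      rcases Sym2.mem_iff.1 hz with rfl | rfl
      exacts [⟨right_mem_vertexSpan ((hmem _).2 hx), hne _ hx⟩,
        ⟨right_mem_vertexSpan ((hmem _).2 hy), hne _ hy⟩]
  have hcov : ∀ f ∈ G, ∃ e ∈ ({s(a, b), s(b, c), s(a, c)} : Set (Sym2 V)), f ∈ comp p G e :=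
    fun f hf => (hp.coCirc_delta hF hN hf).imp fun e he => ⟨he.1, hf, he.2⟩
  have hcl : ∀ e ∈ ({s(a, b), s(b, c), s(a, c)} : Set (Sym2 V)), Closes L (comp p G e) :=
    fun e he => IH _ ((comp_subset e).trans hGL) (rconn_class (Or.inr he))
      (fun f hf => hGd f (comp_subset e hf)) ((Set.ssubset_iff_of_subset
        ((vertexSpan_mono (comp_subset e)).trans (hGV.trans Set.sdiff_subset))).2
          ⟨v, hvF, fun h => (hGV (vertexSpan_mono (comp_subset e) h)).2 rfl⟩)
  have hVG : ∀ z ∈ vertexSpan F \ {v}, z ∈ vertexSpan G := by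
    rintro z ⟨hz, hzv⟩
    obtain ⟨y, hy⟩ := mem_vertexSpan.1 hz
    by_cases hyv : y = v
    · subst hyv
      rcases (hmem z).1 (Sym2.eq_swap ▸ hy) with rfl | rfl | rfl
      exacts [left_mem_vertexSpan (Or.inr (hTG _ b (by simp) (by simp) hab)),
        left_mem_vertexSpan (Or.inr (hTG _ c (by simp) (by simp) hbc)),
        right_mem_vertexSpan (Or.inr (hTG b _ (by simp) (by simp) hbc))]
    · exact left_mem_vertexSpan (hFG z y hy hzv hyv)
  by_cases hall : ∃ e ∈ ({s(a, b), s(b, c), s(a, c)} : Set (Sym2 V)),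
      ∀ x, (x = a ∨ x = b ∨ x = c) → x ∈ vertexSpan (comp p G e)
  · obtain ⟨e, he, hall⟩ := hall
    have hGe : comp p G e = G := by
      refine (comp_subset e).antisymm fun f hf => ?_
      obtain ⟨e', he', hfe'⟩ := hcov f hf
      have : e' ∈ comp p G e := hp.mem_comp_of_pairs hGd (Or.inr he) (Or.inr he') (by
        obtain ⟨x, y, rfl, -, hx, hy⟩ := hT e' he'
        exact mk_mem_pairs.2 ⟨hall x hx, hall y hy⟩)
      rwa [comp_eq this] at hfe'
    have hat : Attached F G {a, b, c} := by
      refine ⟨fun x y hxy hx hy => hFG x y hxy (hGV hx).2 (hGV hy).2, fun x y hxy hx hy => ?_,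
        fun m hm n hn hmn => Or.inr (hTG m n hm hn hmn)⟩
      by_cases hyv : y = v
      · subst hyv
        exact (hmem x).1 (Sym2.eq_swap ▸ hxy)
      · exact absurd (right_mem_vertexSpan (hFG x y hxy (hGV hx).2 hyv)) hy
    have := hcl e he
    rw [hGe] at this
    exact this u (hVG u hu) w (hVG w hw) huw (hat.unsep (hVG u hu) (hVG w hw) h)
  push Not at hall
  have hin : ∀ e ∈ ({s(a, b), s(b, c), s(a, c)} : Set (Sym2 V)), ∀ z ∈ vertexSpan (comp p G e),
      z ∉ e → ¬ (z = a ∨ z = b ∨ z = c) ∧ ∀ y, s(z, y) ∈ F → s(z, y) ∈ comp p G e := by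
    intro e he z hz hze
    have heV : ∀ x ∈ e, x ∈ vertexSpan (comp p G e) := fun x hx =>
      ⟨e, mem_comp_self (Or.inr he), hx⟩
    have hzT : ¬ (z = a ∨ z = b ∨ z = c) := by
      intro hzT
      obtain ⟨r, hr, hrV⟩ := hall e he
      obtain ⟨x, y, rfl, hxy, hx, hy⟩ := hT e he
      have : r = x ∨ r = y ∨ r = z := by
        have hzx : z ≠ x := fun h => hze (h ▸ Sym2.mem_mk_left x y)
        have hzy : z ≠ y := fun h => hze (h ▸ Sym2.mem_mk_right x y)
        clear * - hxy hx hy hzT hr hzx hzy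
        grind
      rcases this with rfl | rfl | rfl
      exacts [hrV (heV _ (Sym2.mem_mk_left _ _)), hrV (heV _ (Sym2.mem_mk_right _ _)), hrV hz]
    refine ⟨hzT, fun y hzy => ?_⟩
    have hzv := (hGV (vertexSpan_mono (comp_subset e) hz)).2
    have hyv : y ≠ v := by
      rintro rfl
      exact hzT ((hmem z).1 (Sym2.eq_swap ▸ hzy))
    obtain ⟨e', he', hze'⟩ := hcov _ (hFG z y hzy hzv hyv)
    obtain ⟨x, hxe, hxe'⟩ : ∃ x, x ∈ e ∧ x ∈ e' := by
      rcases he with rfl | rfl | rfl <;> rcases he' with rfl | rfl | rfl <;> simp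
    rw [hp.comp_eq_of_share hGd (Or.inr he) (Or.inr he') (x := x) (y := z)
      (fun h => hze (h ▸ hxe)) (heV x hxe) hz ⟨e', mem_comp_self (Or.inr he'), hxe'⟩
      (left_mem_vertexSpan hze')]
    exact hze'
  have hat : ∀ e ∈ ({s(a, b), s(b, c), s(a, c)} : Set (Sym2 V)),
      Attached F (comp p G e) {x | x ∈ e} := by
    intro e he
    have hpair : ∀ m ∈ e, ∀ n ∈ e, m ≠ n → s(m, n) ∈ comp p G e := fun m hm n hn hmn => by
      rw [← (Sym2.mem_and_mem_iff hmn).1 ⟨hm, hn⟩]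
      exact mem_comp_self (Or.inr he)
    refine ⟨fun x y hxy hx hy => ?_, fun x y hxy hx hy => ?_, hpair⟩
    · by_cases hxe : x ∈ e
      · by_cases hye : y ∈ e
        · exact hpair x hxe y hye fun h => hd _ hxy (Sym2.mk_isDiag_iff.2 h)
        · rw [Sym2.eq_swap] at hxy ⊢
          exact (hin e he y hy hye).2 x hxy
      · exact (hin e he x hx hxe).2 y hxy
    · by_contra hxe
      exact hy (right_mem_vertexSpan ((hin e he x hx hxe).2 y hxy))
  have hout : ∀ e ∈ ({s(a, b), s(b, c), s(a, c)} : Set (Sym2 V)), ∀ x ∈ vertexSpan (comp p G e),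
      ∀ y, x ∉ e → Unsep F x y → y ∈ vertexSpan (comp p G e) := by
    intro e he x hx y hxe hxy
    obtain ⟨s, t, rfl, -⟩ := hT e he
    have hsep : IsSep F {z | z ∈ vertexSpan (comp p G s(s, t)) ∧ z ∉ s(s, t)} s t := by
      refine ⟨fun h => h.2 (by simp), fun h => h.2 (by simp), fun z y hzy hz => ?_⟩
      have := right_mem_vertexSpan ((hin _ he z hz.1 hz.2).2 y hzy)
      by_cases hy : y ∈ s(s, t)
      · exact Or.inr (Sym2.mem_iff.1 hy)
      · exact Or.inl ⟨this, hy⟩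
    rcases hxy _ s t hsep ⟨hx, hxe⟩ with h' | rfl | rfl
    · exact h'.1
    · exact left_mem_vertexSpan (mem_comp_self (Or.inr he))
    · exact right_mem_vertexSpan (mem_comp_self (Or.inr he))
  have hspan : ∀ z ∈ vertexSpan F \ {v},
      ∃ e ∈ ({s(a, b), s(b, c), s(a, c)} : Set (Sym2 V)), z ∈ vertexSpan (comp p G e) := by
    intro z hz
    obtain ⟨f, hf, hzf⟩ := hVG z hz
    exact (hcov f hf).imp fun e he => ⟨he.1, ⟨f, he.2, hzf⟩⟩
  have hend : ∀ e ∈ ({s(a, b), s(b, c), s(a, c)} : Set (Sym2 V)), ∀ x ∈ e,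
      x = a ∨ x = b ∨ x = c := by
    rintro e he x hx
    obtain ⟨y, z, rfl, -, hy, hz⟩ := hT e he
    rcases Sym2.mem_iff.1 hx with rfl | rfl
    exacts [hy, hz]
  obtain ⟨e, he, hue⟩ := hspan u hu
  obtain ⟨e', he', hwe'⟩ := hspan w hw
  by_cases hu' : u ∈ e
  · by_cases hw' : w ∈ e'
    · exact hTL (hTG u w (hend e he u hu') (hend e' he' w hw') huw)
    · have := hout e' he' w hwe' u hw' h.symm
      exact hcl e' he' u this w hwe' huw ((hat e' he').unsep this hwe' h)
  · have := hout e he u hue w hu' h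
    exact hcl e he u hue w this huw ((hat e he).unsep hue this h)

theorem Generic.closes_of_nb_three (hp : Generic p) (hL : ExtClosed p L) (hF : RConn (row p) F)
    (hd : ∀ e ∈ F, ¬ e.IsDiag) (h2 : 2 ≤ F.ncard) (hab : a ≠ b) (hac : a ≠ c) (hbc : b ≠ c)
    (hN : nb F v = {a, b, c}) (hFL : F ⊆ L)
    (IH : ∀ F' ⊆ L, RConn (row p) F' → (∀ e ∈ F', ¬ e.IsDiag) → vertexSpan F' ⊂ vertexSpan F →
      Closes L F') : Closes L F := by
  have hmem : ∀ n, s(v, n) ∈ F ↔ n = a ∨ n = b ∨ n = c := fun n => by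
    change n ∈ nb F v ↔ _
    simp [hN]
  have hne : ∀ n, n = a ∨ n = b ∨ n = c → n ≠ v := fun n hn h =>
    hd _ ((hmem n).2 hn) (Sym2.mk_isDiag_iff.2 h.symm)
  have hrig := hp.rig_delete (hp.rig_rconn hF hd) hN (hp.cl_delta hF hd h2 hab hac hbc hN)
  have hrigL : Rig p (L ∩ pairs (vertexSpan F \ {v})) (vertexSpan F \ {v}) :=
    hrig.mono (fun e he => ⟨hFL he.1, fun x hx => ⟨⟨e, he.1, hx⟩, fun h => he.2 (h ▸ hx)⟩⟩)
      subset_rfl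
  have hnF : ∀ n, n = a ∨ n = b ∨ n = c → n ∈ vertexSpan F \ {v} := fun n hn =>
    ⟨right_mem_vertexSpan ((hmem n).2 hn), hne n hn⟩
  have hvL : ∀ n, n = a ∨ n = b ∨ n = c → s(v, n) ∈ L := fun n hn => hFL ((hmem n).2 hn)
  have hLab := hL _ v a b c (fun h => h.2 rfl) hrigL (hnF a (by simp)) (hnF b (by simp))
    (hnF c (by simp)) hab hac hbc (hvL a (by simp)) (hvL b (by simp)) (hvL c (by simp))
  have hLbc := hL _ v b c a (fun h => h.2 rfl) hrigL (hnF b (by simp)) (hnF c (by simp))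
    (hnF a (by simp)) hbc hab.symm hac.symm (hvL b (by simp)) (hvL c (by simp)) (hvL a (by simp))
  have hLac := hL _ v a c b (fun h => h.2 rfl) hrigL (hnF a (by simp)) (hnF c (by simp))
    (hnF b (by simp)) hac hab hbc.symm (hvL a (by simp)) (hvL c (by simp)) (hvL b (by simp))
  have hclose := fun u w hu hw huw h => hp.closes_delta hF hd hab hac hbc hN hFL (by
    rintro e (rfl | rfl | rfl) <;> assumption) IH (u := u) (w := w) hu hw huw h
  have hv : ∀ w ∈ vertexSpan F, v ≠ w → Unsep F v w → s(v, w) ∈ L := by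
    intro w hw hvw h
    by_cases hwN : w = a ∨ w = b ∨ w = c
    · exact hvL w hwN
    have hwx : ∀ x, x = a ∨ x = b ∨ x = c → s(w, x) ∈ L := by
      intro x hx
      refine hclose w x ⟨hw, hvw.symm⟩ (hnF x hx) (fun e => hwN (e ▸ hx)) fun A s t hA hwA => ?_
      by_contra! hxA
      have key : ∀ r, IsSep F A v r → x ≠ r → False := by
        intro r hA' hxr
        have hA0 : IsSep {e | e ∈ F ∧ v ∉ e} A r r := by
          refine ⟨hA'.2.1, hA'.2.1, fun x y hxy hx => ?_⟩
          rcases hA'.2.2 x y hxy.1 hx with h' | rfl | h'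
          exacts [Or.inl h', absurd hxy.2 (by simp), Or.inr (Or.inl h')]
        rcases hp.sep_one hrig hA0 with h' | h'
        · exact h' w ⟨hw, hvw.symm⟩ hwA
        · exact (h' x (hnF x hx)).elim hxr hxA.1
      rcases h.symm A s t hA hwA with hvA | rfl | rfl
      · have := hA.2.2 v x ((hmem x).2 hx) hvA
        tauto
      · exact key _ hA hxA.2.2
      · exact key _ hA.symm hxA.2.1
    have hwa := hwx a (by simp)
    have hwb := hwx b (by simp)
    have hwc := hwx c (by simp)
    push Not at hwN
    have ha := hne a (by simp)
    have hb := hne b (by simp)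
    have hc := hne c (by simp)
    have hrig4 : Rig p (L ∩ pairs {w, b, c, v}) {w, b, c, v} := by
      have hcl : ∀ x y, s(x, y) ∈ L → x ∈ ({w, b, c, v} : Set V) → y ∈ ({w, b, c, v} : Set V) →
          Cl (row p) (L ∩ pairs {w, b, c, v}) s(x, y) := fun x y h hx hy =>
        Cl.of_mem ⟨h, mk_mem_pairs.2 ⟨hx, hy⟩⟩
      refine hp.rig_insert (a := b) (b := c) (rig_triple ?_ ?_ ?_) (by simp) (by simp) hbc hwN.2.1
        hwN.2.2 ?_ ?_
      · exact hcl _ _ hLbc (by simp) (by simp)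
      · exact hcl _ _ (Sym2.eq_swap ▸ hvL c (by simp)) (by simp) (by simp)
      · exact hcl _ _ (Sym2.eq_swap ▸ hvL b (by simp)) (by simp) (by simp)
      · exact hcl _ _ hwb (by simp) (by simp)
      · exact hcl _ _ hwc (by simp) (by simp)
    refine hL _ a v w b ?_ hrig4 (by simp) (by simp) (by simp) hvw hb.symm hwN.2.1
      (Sym2.eq_swap ▸ hvL a (by simp)) (Sym2.eq_swap ▸ hwa) hLab
    simp [hwN.1.symm, hab, hac, ha]
  intro u hu w hw huw h
  by_cases huv : u = v
  · subst huv
    exact hv w hw huw h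
  by_cases hwv : w = v
  · subst hwv
    rw [Sym2.eq_swap]
    exact hv u hu huw.symm h.symm
  exact hclose u w ⟨hu, huv⟩ ⟨hw, hwv⟩ huw h

end DegreeThree

section Erase

variable {V : Type*} [Fintype V] [DecidableEq V] {p : V → Fin 2 → ℝ} {L F F' : Set (Sym2 V)}
  {A : Set V} {s t x y : V}

theorem Generic.unsep_of_min (hp : Generic p) (hX : Rig p F (vertexSpan F)) (h : IsSep F A s t)
    (hx : x ∈ A) (hxF : x ∈ vertexSpan F) (hy : y ∈ oside A s t) (hyF : y ∈ vertexSpan F)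
    (hmin : ∀ A' s' t', IsSep F A' s' t' → x ∈ A' → y ∈ oside A' s' t' →
      (oside A s t).ncard ≤ (oside A' s' t').ncard) : Unsep F y s := by
  intro A₂ s₂ t₂ h₂ hyA
  by_contra! hs
  have htA : t ∉ A₂ := fun ht => by
    have := (hp.noncross hX h hx hxF hy hyF).symm A₂ s₂ t₂ h₂ ht
    tauto
  set A₃ := {v | v ∈ A₂ ∧ v ∈ oside A s t} with hA₃
  have hedge : ∀ a b, s(a, b) ∈ F → a ∈ A₃ → b ∈ A₃ ∨ (b = s₂ ∨ b = t₂) ∧ b ∉ A := by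
    intro a b hab ha
    rcases h.compl.2.2 a b hab ha.2 with hb | rfl | rfl
    · rcases h₂.2.2 a b hab ha.1 with hb' | hb'
      exacts [Or.inl ⟨hb', hb⟩, Or.inr ⟨hb', hb.1⟩]
    · rcases h₂.2.2 a b hab ha.1 with hb' | hb' | hb'
      exacts [absurd hb' hs.1, absurd hb' hs.2.1, absurd hb' hs.2.2]
    · exact Or.inr ⟨(h₂.2.2 a b hab ha.1).resolve_left htA, h.2.1⟩
  have hone : ∀ r, x ≠ r → r ∉ A₃ → (∀ a b, s(a, b) ∈ F → a ∈ A₃ → b ∈ A₃ ∨ b = r) → False := by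
    intro r hxr hr h'
    rcases hp.sep_one hX (A := A₃) (t := r) ⟨hr, hr, fun a b hab ha =>
      (h' a b hab ha).imp_right Or.inl⟩ with h'' | h''
    · exact h'' y hyF ⟨hyA, hy⟩
    · exact (h'' x hxF).elim hxr fun h => h.2.1 hx
  have hxs : x ≠ s := fun e => h.1 (e ▸ hx)
  have hx2 : x ≠ s₂ ∧ x ≠ t₂ := by
    constructor
    · rintro rfl
      by_cases hxt : x = t₂
      · subst hxt
        refine hone s hxs (fun h => hs.1 h.1) fun a b hab ha => ?_
        rcases hedge a b hab ha with hb | ⟨rfl | rfl, hb⟩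
        exacts [Or.inl hb, absurd hx hb, absurd hx hb]
      · refine hone t₂ hxt (fun h => h₂.2.1 h.1) fun a b hab ha => ?_
        rcases hedge a b hab ha with hb | ⟨rfl | rfl, hb⟩
        exacts [Or.inl hb, absurd hx hb, Or.inr rfl]
    · rintro rfl
      by_cases hxt : x = s₂
      · subst hxt
        refine hone s hxs (fun h => hs.1 h.1) fun a b hab ha => ?_
        rcases hedge a b hab ha with hb | ⟨rfl | rfl, hb⟩
        exacts [Or.inl hb, absurd hx hb, absurd hx hb]
      · refine hone s₂ hxt (fun h => h₂.1 h.1) fun a b hab ha => ?_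
        rcases hedge a b hab ha with hb | ⟨rfl | rfl, hb⟩
        exacts [Or.inl hb, Or.inr rfl, absurd hx hb]
  have h₃ : IsSep F A₃ s₂ t₂ := ⟨fun h => h₂.1 h.1, fun h => h₂.2.1 h.1, fun a b hab ha =>
    (hedge a b hab ha).imp_right And.left⟩
  have hle := hmin _ s₂ t₂ h₃.compl ⟨fun h => h.2.1 hx, hx2⟩ (by
    rw [h₃.oside_oside]
    exact ⟨hyA, hy⟩)
  rw [h₃.oside_oside] at hle
  have heq : A₃ = oside A s t := Set.eq_of_subset_of_ncard_le (fun v hv => hv.2) hle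
  refine hone t (fun e => h.2.1 (e ▸ hx)) (fun h => h.2.2.2 rfl) fun a b hab ha => ?_
  rcases hedge a b hab ha with hb | ⟨hb, hbA⟩
  · exact Or.inl hb
  rcases h.compl.2.2 a b hab (heq ▸ ha) with hb' | rfl | hb'
  · exact Or.inl (heq ▸ hb')
  · exact absurd hb (by tauto)
  · exact Or.inr hb'

/-- The side `A` of a separation of `F`, with the triangle on `x`, `s` and `t` added. -/
def cornerSide (F : Set (Sym2 V)) (A : Set V) (s t x : V) : Set (Sym2 V) :=
  insert s(x, s) (insert s(x, t) (side F A s t))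

theorem vertexSpan_cornerSide (h : IsSep F A s t) (hx : x ∈ A) (hxF : x ∈ vertexSpan F) :
    vertexSpan (cornerSide F A s t x) = (A ∩ vertexSpan F) ∪ {s, t} := by
  rw [cornerSide, vertexSpan_insert, vertexSpan_insert, vertexSpan_side h]
  ext z
  simp only [Set.mem_union, Set.mem_insert_iff, Set.mem_singleton_iff, Set.mem_inter_iff]
  constructor
  · rintro ((rfl | rfl) | (rfl | rfl) | h) <;> simp_all
  · tauto

theorem Generic.cornerSide_rconn (hp : Generic p) (hF : RConn (row p) F)
    (hd : ∀ e ∈ F, ¬ e.IsDiag) (h : IsSep F A s t) (hx : x ∈ A) (hxF : x ∈ vertexSpan F)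
    (hy : y ∈ oside A s t) (hyF : y ∈ vertexSpan F) :
    RConn (row p) (cornerSide F A s t x) ∧ (∀ e ∈ cornerSide F A s t x, ¬ e.IsDiag) ∧
      Rig p (side F A s t) (vertexSpan (side F A s t)) := by
  obtain ⟨hst, -, -⟩ := hp.sep_mem (hp.rig_rconn hF hd) h hx hxF hy hyF
  have hS := hp.side_rconn hF hd h hx hxF hy hyF
  have hdS : ∀ e ∈ side F A s t, ¬ e.IsDiag := by
    rintro e (rfl | he)
    exacts [by simpa using hst, hd e he.1]
  have hrig := hp.rig_rconn hS hdS
  have hxs : ¬ s(x, s).IsDiag := by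
    rw [Sym2.mk_isDiag_iff]
    exact fun e => h.1 (e ▸ hx)
  have hxt : ¬ s(x, t).IsDiag := by
    rw [Sym2.mk_isDiag_iff]
    exact fun e => h.2.1 (e ▸ hx)
  have hV := vertexSpan_side h
  have hcl : ∀ r, r = s ∨ r = t → Cl (row p) (side F A s t) s(x, r) := fun r hr =>
    hrig x (hV ▸ Or.inl ⟨hx, hxF⟩) r (hV ▸ Or.inr hr)
  refine ⟨(hS.insert (hcl t (Or.inr rfl)) (hp.reg_singleton hxt)).insert
    ((hcl s (Or.inl rfl)).mono (Set.subset_insert _ _)) (hp.reg_singleton hxs), ?_, hrig⟩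
  rintro e (rfl | rfl | he)
  exacts [hxs, hxt, hdS e he]

theorem IsSep.attached (h : IsSep F' A s t) (hF : ∀ e ∈ F, e = s(x, y) ∨ e ∈ F')
    (hx : x ∈ A) (hxF : x ∈ vertexSpan F') (hy : y ∈ oside A s t) :
    Attached F (cornerSide F' A s t x) {x, s, t} := by
  have hyV : y ∉ (A ∩ vertexSpan F') ∪ {s, t} := by
    rintro (h' | h')
    exacts [hy.1 h'.1, h'.elim hy.2.1 hy.2.2]
  have hA : ∀ a, a ∈ (A ∩ vertexSpan F') ∪ {s, t} → a ∈ A ∨ a = s ∨ a = t := fun a ha =>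
    ha.imp_left And.left
  rw [Attached, vertexSpan_cornerSide h hx hxF]
  refine ⟨fun a b hab ha hb => ?_, fun a b hab ha hb => ?_, ?_⟩
  · rcases hF _ hab with he | he
    · rcases Sym2.eq_iff.1 he with ⟨rfl, rfl⟩ | ⟨rfl, rfl⟩
      exacts [absurd hb hyV, absurd ha hyV]
    · refine Or.inr (Or.inr (Or.inr ⟨he, fun v hv => ?_⟩))
      rcases Sym2.mem_iff.1 hv with rfl | rfl
      exacts [hA _ ha, hA _ hb]
  · rcases hF _ hab with he | he
    · rcases Sym2.eq_iff.1 he with ⟨rfl, rfl⟩ | ⟨rfl, rfl⟩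
      exacts [Or.inl rfl, absurd ha hyV]
    · rcases hA a ha with ha' | ha'
      · refine absurd ?_ hb
        exact (h.2.2 a b he ha').imp_left fun h' => ⟨h', right_mem_vertexSpan he⟩
      · exact Or.inr ha'
  · rintro m (rfl | rfl | rfl) n (rfl | rfl | rfl) hmn <;>
      simp_all [cornerSide, side, Sym2.eq_swap]

theorem Generic.closes_across (hp : Generic p) (hL : ExtClosed p L) {u w : V}
    (hus : u ≠ s) (hut : u ≠ t) (huy : u ≠ y) (hwx : w ≠ x) (hws : w ≠ s) (hwt : w ≠ t)
    (huw : u ≠ w) (hst : s ≠ t) (hxs : x ≠ s) (hxt : x ≠ t) (hxy : x ≠ y) (hys : y ≠ s)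
    (hyt : y ≠ t) (hxyL : s(x, y) ∈ L) (hxsL : s(x, s) ∈ L) (hstL : s(s, t) ∈ L)
    (hysL : s(y, s) ∈ L) (hytL : s(y, t) ∈ L) (hu : ∀ n ∈ ({x, s, t} : Set V), u ≠ n → s(u, n) ∈ L)
    (hw : ∀ n ∈ ({y, s, t} : Set V), w ≠ n → s(w, n) ∈ L) : s(u, w) ∈ L := by
  have hcl : ∀ R : Set V, ∀ a b, s(a, b) ∈ L → a ∈ R → b ∈ R → Cl (row p) (L ∩ pairs R) s(a, b) :=
    fun R a b h ha hb => Cl.of_mem ⟨h, mk_mem_pairs.2 ⟨ha, hb⟩⟩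
  have husL := hu s (by simp) hus
  have hutL := hu t (by simp) hut
  have hwsL := hw s (by simp) hws
  have hwtL := hw t (by simp) hwt
  have huyL : s(u, y) ∈ L := by
    by_cases hux : u = x
    · rwa [hux]
    have hR : Rig p (L ∩ pairs {w, y, u, s, t}) {w, y, u, s, t} := by
      refine hp.rig_insert (a := s) (b := t) (hp.rig_insert (a := s) (b := t) (rig_triple ?_ ?_ ?_)
        (by simp) (by simp) hst hys hyt ?_ ?_) (by simp) (by simp) hst hws hwt ?_ ?_ <;>
      apply hcl <;> first | assumption | simp
    refine hL _ x u y s ?_ hR (by simp) (by simp) (by simp) huy hus hys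
      (Sym2.eq_swap ▸ hu x (by simp) hux) hxyL hxsL
    simp [Ne.symm hux, hwx.symm, hxs, hxt, hxy]
  by_cases hwy : w = y
  · rwa [hwy]
  have hR : Rig p (L ∩ pairs {w, u, t, y}) {w, u, t, y} := by
    refine hp.rig_insert (a := t) (b := y) (rig_triple ?_ ?_ ?_) (by simp) (by simp) hyt.symm hwt
      hwy ?_ ?_
    · exact hcl _ _ _ hutL (by simp) (by simp)
    · exact hcl _ _ _ (Sym2.eq_swap ▸ hytL) (by simp) (by simp)
    · exact hcl _ _ _ huyL (by simp) (by simp)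
    · exact hcl _ _ _ hwtL (by simp) (by simp)
    · exact hcl _ _ _ (hw y (by simp) hwy) (by simp) (by simp)
  refine hL _ s u w t ?_ hR (by simp) (by simp) (by simp) huw hut hwt (Sym2.eq_swap ▸ husL)
    (Sym2.eq_swap ▸ hwsL) hstL
  simp [hus.symm, hws.symm, hst, hys.symm]

theorem Generic.closes_of_erase (hp : Generic p) (hL : ExtClosed p L) (hF : RConn (row p) F)
    (hd : ∀ e ∈ F, ¬ e.IsDiag) (hxy : s(x, y) ∈ F) (hF' : RConn (row p) (F \ {s(x, y)}))
    (hV : vertexSpan (F \ {s(x, y)}) = vertexSpan F) (hFL : F ⊆ L)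
    (IH' : Closes L (F \ {s(x, y)}))
    (IH : ∀ F' ⊆ L, RConn (row p) F' → (∀ e ∈ F', ¬ e.IsDiag) → vertexSpan F' ⊂ vertexSpan F →
      Closes L F') : Closes L F := by
  classical
  set F₁ := F \ {s(x, y)} with hF₁
  have hFF : ∀ e ∈ F, e = s(x, y) ∨ e ∈ F₁ := fun e he => by
    by_cases h : e = s(x, y)
    exacts [Or.inl h, Or.inr ⟨he, h⟩]
  by_cases hU : Unsep F₁ x y
  · refine fun u hu w hw huw h => IH' u (hV ▸ hu) w (hV ▸ hw) huw fun A s t hA => h A s t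
      ⟨hA.1, hA.2.1, fun a b hab ha => ?_⟩
    rcases hFF _ hab with he | he
    · rcases Sym2.eq_iff.1 he with ⟨rfl, rfl⟩ | ⟨rfl, rfl⟩
      exacts [hU A s t hA ha, hU.symm A s t hA ha]
    · exact hA.2.2 a b he ha
  have hd₁ : ∀ e ∈ F₁, ¬ e.IsDiag := fun e he => hd e he.1
  have hX := hp.rig_rconn hF' hd₁
  have hxF : x ∈ vertexSpan F₁ := hV ▸ left_mem_vertexSpan hxy
  have hyF : y ∈ vertexSpan F₁ := hV ▸ right_mem_vertexSpan hxy
  obtain ⟨A, s, t, h, hx, hy, hmin⟩ : ∃ A s t, IsSep F₁ A s t ∧ x ∈ A ∧ y ∈ oside A s t ∧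
      ∀ A' s' t', IsSep F₁ A' s' t' → x ∈ A' → y ∈ oside A' s' t' →
        (oside A s t).ncard ≤ (oside A' s' t').ncard := by
    simp only [Unsep, not_forall, not_or] at hU
    obtain ⟨A, s, t, h, hx, hy⟩ := hU
    have hex : ∃ n A s t, IsSep F₁ A s t ∧ x ∈ A ∧ y ∈ oside A s t ∧ (oside A s t).ncard = n :=
      ⟨_, A, s, t, h, hx, hy, rfl⟩
    obtain ⟨A, s, t, h, hx, hy, hn⟩ := Nat.find_spec hex
    exact ⟨A, s, t, h, hx, hy, fun A' s' t' h1 h2 h3 =>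
      hn ▸ Nat.find_min' hex ⟨A', s', t', h1, h2, h3, rfl⟩⟩
  obtain ⟨hst, hsF, htF⟩ := hp.sep_mem hX h hx hxF hy hyF
  have hys := hp.unsep_of_min hX h hx hxF hy hyF hmin
  have hswap : oside A t s = oside A s t := by
    ext z
    simp [oside, and_comm]
  have hyt := hp.unsep_of_min hX h.symm hx hxF (hswap ▸ hy) hyF (hswap ▸ hmin)
  have hxs : x ≠ s := fun e => h.1 (e ▸ hx)
  have hxt : x ≠ t := fun e => h.2.1 (e ▸ hx)
  have hne : x ≠ y := fun e => hy.1 (e ▸ hx)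
  have hysL := IH' y hyF s hsF hy.2.1 hys
  have hytL := IH' y hyF t htF hy.2.2 hyt
  have hstL := IH' s hsF t htF hst (hp.noncross hX h hx hxF hy hyF)
  obtain ⟨hA1, hA2, hA3⟩ := hp.cornerSide_rconn hF' hd₁ h hx hxF hy hyF
  have hx' : x ∈ oside (oside A s t) s t := by rwa [h.oside_oside]
  obtain ⟨hB1, hB2, -⟩ := hp.cornerSide_rconn hF' hd₁ h.compl hy hyF hx' hxF
  have hVA := vertexSpan_cornerSide h hx hxF
  have hVB := vertexSpan_cornerSide h.compl hy hyF
  have hsideL : ∀ B, side F₁ B s t ⊆ L := by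
    rintro B e (rfl | he)
    exacts [hstL, hFL he.1.1]
  have hR : Rig p (L ∩ pairs (vertexSpan (side F₁ A s t))) (vertexSpan (side F₁ A s t)) :=
    hA3.mono (fun e he => ⟨hsideL A he, subset_pairs _ he⟩) subset_rfl
  have hyR : y ∉ vertexSpan (side F₁ A s t) := by
    rw [vertexSpan_side h]
    rintro (h' | h')
    exacts [hy.1 h'.1, h'.elim hy.2.1 hy.2.2]
  have hxR : x ∈ vertexSpan (side F₁ A s t) := by
    rw [vertexSpan_side h]
    exact Or.inl ⟨hx, hxF⟩
  have hsR : s ∈ vertexSpan (side F₁ A s t) := by simp [vertexSpan_side h]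
  have htR : t ∈ vertexSpan (side F₁ A s t) := by simp [vertexSpan_side h]
  have hyxL : s(y, x) ∈ L := Sym2.eq_swap ▸ hFL hxy
  have hxsL := hL _ y x s t hyR hR hxR hsR htR hxs hxt hst hyxL hysL hytL
  have hxtL := hL _ y x t s hyR hR hxR htR hsR hxt hxs hst.symm hyxL hytL hysL
  have hcA : Closes L (cornerSide F₁ A s t x) := by
    refine IH _ ?_ hA1 hA2 ?_
    · rintro e (rfl | rfl | he)
      exacts [hxsL, hxtL, hsideL A he]
    · rw [hVA, ← hV, Set.ssubset_iff_of_subset]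
      · exact ⟨y, hyF, vertexSpan_side h ▸ hyR⟩
      · rintro z (hz | rfl | rfl)
        exacts [hz.2, hsF, htF]
  have hcB : Closes L (cornerSide F₁ (oside A s t) s t y) := by
    refine IH _ ?_ hB1 hB2 ?_
    · rintro e (rfl | rfl | he)
      exacts [hysL, hytL, hsideL _ he]
    · rw [hVB, ← hV, Set.ssubset_iff_of_subset]
      · refine ⟨x, hxF, ?_⟩
        rintro (h' | h')
        exacts [h'.1.1 hx, h'.elim hxs hxt]
      · rintro z (hz | rfl | rfl)
        exacts [hz.2, hsF, htF]
  have hatA : Attached F _ {x, s, t} := h.attached hFF hx hxF hy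
  have hatB : Attached F _ {y, s, t} := h.compl.attached (fun e he => Sym2.eq_swap (a := x) ▸
    hFF e he) hy hyF hx'
  have hXF := hp.rig_rconn hF hd
  have hacross : ∀ u w, u ∈ A → u ∈ vertexSpan F → w ∈ oside A s t → w ∈ vertexSpan F →
      Unsep F u w → s(u, w) ∈ L := by
    intro u w hu huF hw hwF huw
    have hus : u ≠ s := fun e => h.1 (e ▸ hu)
    have hut : u ≠ t := fun e => h.2.1 (e ▸ hu)
    have hN : ∀ r, r ∈ vertexSpan F₁ → ({r, s, t} : Set V) ⊆ vertexSpan F := by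
      rintro r hr z (rfl | rfl | rfl)
      exacts [hV ▸ hr, hV ▸ hsF, hV ▸ htF]
    have huA : u ∈ vertexSpan (cornerSide F₁ A s t x) := hVA ▸ Or.inl ⟨hu, hV.symm ▸ huF⟩
    have hwB : w ∈ vertexSpan (cornerSide F₁ (oside A s t) s t y) :=
      hVB ▸ Or.inl ⟨hw, hV.symm ▸ hwF⟩
    have hwA : w ∉ vertexSpan (cornerSide F₁ A s t x) := by
      rw [hVA]
      rintro (h' | h')
      exacts [hw.1 h'.1, h'.elim hw.2.1 hw.2.2]
    have huB : u ∉ vertexSpan (cornerSide F₁ (oside A s t) s t y) := by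
      rw [hVB]
      rintro (h' | h')
      exacts [h'.1.1 hu, h'.elim hus hut]
    have hu' : ∀ n ∈ ({x, s, t} : Set V), u ≠ n → s(u, n) ∈ L := fun n hn hun => by
      refine hcA u huA n ?_ hun (hatA.unsep_of_notMem hp hXF (hN x hxF) huF huA hwA huw hn)
      rw [hVA]
      rcases hn with rfl | hn
      exacts [Or.inl ⟨hx, hxF⟩, Or.inr hn]
    have hw' : ∀ n ∈ ({y, s, t} : Set V), w ≠ n → s(w, n) ∈ L := fun n hn hwn => by
      refine hcB w hwB n ?_ hwn (hatB.unsep_of_notMem hp hXF (hN y hyF) hwF hwB huB huw.symm hn)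
      rw [hVB]
      rcases hn with rfl | hn
      exacts [Or.inl ⟨hy, hyF⟩, Or.inr hn]
    exact hp.closes_across hL hus hut (ne_of_mem_of_not_mem hu hy.1) (ne_of_mem_of_not_mem hx hw.1).symm
      hw.2.1 hw.2.2 (ne_of_mem_of_not_mem hu hw.1) hst hxs hxt hne hy.2.1 hy.2.2 (hFL hxy) hxsL hstL hysL hytL
      hu' hw'
  intro u hu w hw huw hUw
  have hinA : ∀ z ∈ vertexSpan F, z ∈ A ∨ z ∈ ({s, t} : Set V) →
      z ∈ vertexSpan (cornerSide F₁ A s t x) := fun z hz h => by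
    rw [hVA, hV]
    exact h.imp_left fun h => ⟨h, hz⟩
  have hinB : ∀ z ∈ vertexSpan F, z ∈ oside A s t ∨ z ∈ ({s, t} : Set V) →
      z ∈ vertexSpan (cornerSide F₁ (oside A s t) s t y) := fun z hz h => by
    rw [hVB, hV]
    exact h.imp_left fun h => ⟨h, hz⟩
  have hA : ∀ z z', z ∈ vertexSpan F → z' ∈ vertexSpan F → z ∈ A ∨ z ∈ ({s, t} : Set V) →
      z' ∈ A ∨ z' ∈ ({s, t} : Set V) → z ≠ z' → Unsep F z z' → s(z, z') ∈ L :=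
    fun z z' hz hz' h h' hne hU => hcA z (hinA z hz h) z' (hinA z' hz' h') hne
      (hatA.unsep (hinA z hz h) (hinA z' hz' h') hU)
  have hB : ∀ z z', z ∈ vertexSpan F → z' ∈ vertexSpan F → z ∈ oside A s t ∨ z ∈ ({s, t} : Set V) →
      z' ∈ oside A s t ∨ z' ∈ ({s, t} : Set V) → z ≠ z' → Unsep F z z' → s(z, z') ∈ L :=
    fun z z' hz hz' h h' hne hU => hcB z (hinB z hz h) z' (hinB z' hz' h') hne
      (hatB.unsep (hinB z hz h) (hinB z' hz' h') hU)
  have htri : ∀ z, z ∈ A ∨ z ∈ oside A s t ∨ z ∈ ({s, t} : Set V) := by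
    intro z
    simp only [oside, Set.mem_ofPred_eq, Set.mem_insert_iff, Set.mem_singleton_iff]
    tauto
  rcases htri u with hu' | hu' | hu' <;> rcases htri w with hw' | hw' | hw'
  · exact hA u w hu hw (Or.inl hu') (Or.inl hw') huw hUw
  · exact hacross u w hu' hu hw' hw hUw
  · exact hA u w hu hw (Or.inl hu') (Or.inr hw') huw hUw
  · rw [Sym2.eq_swap]
    exact hacross w u hw' hw hu' hu hUw.symm
  · exact hB u w hu hw (Or.inl hu') (Or.inl hw') huw hUw
  · exact hB u w hu hw (Or.inl hu') (Or.inr hw') huw hUw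
  · exact hA u w hu hw (Or.inr hu') (Or.inl hw') huw hUw
  · exact hB u w hu hw (Or.inr hu') (Or.inl hw') huw hUw
  · exact hA u w hu hw (Or.inr hu') (Or.inr hw') huw hUw

/-- Unseparated pairs of vertices of a connected graph have their length determined. -/
theorem Generic.closes (hp : Generic p) (hL : ExtClosed p L) (hFL : F ⊆ L)
    (hF : RConn (row p) F) (hd : ∀ e ∈ F, ¬ e.IsDiag) : Closes L F := by
  obtain ⟨n, hn⟩ : ∃ n, (vertexSpan F).ncard * (Nat.card (Sym2 V) + 1) + F.ncard = n := ⟨_, rfl⟩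
  induction n using Nat.strong_induction_on generalizing F with
  | _ n ih =>
  have IH : ∀ F' ⊆ L, RConn (row p) F' → (∀ e ∈ F', ¬ e.IsDiag) →
      vertexSpan F' ⊂ vertexSpan F → Closes L F' := by
    intro F' hF'L hF' hd' hV
    refine ih _ ?_ hF'L hF' hd' rfl
    have h1 : (vertexSpan F').ncard + 1 ≤ (vertexSpan F).ncard := Set.ncard_lt_ncard hV
    have h2 : F'.ncard ≤ Nat.card (Sym2 V) := Set.ncard_le_card F'
    rw [← hn]
    nlinarith
  by_cases h2 : 2 ≤ F.ncard
  · rcases hp.exists_reduction hF hd h2 with ⟨v, hv, h3⟩ | ⟨e, he, hF', h2', hV⟩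
    · obtain ⟨a, b, c, hab, hac, hbc, hN⟩ := Set.ncard_eq_three.1 h3
      exact hp.closes_of_nb_three hL hF hd h2 hab hac hbc hN hFL IH
    · induction e with
      | _ x y =>
      refine hp.closes_of_erase hL hF hd he hF' hV hFL (ih _ ?_ (Set.sdiff_subset.trans hFL) hF'
        (fun f hf => hd f hf.1) rfl) IH
      rw [hV, ← hn]
      exact Nat.add_lt_add_left (Set.ncard_sdiff_singleton_lt_of_mem he) _
  · intro u ⟨e, he, hue⟩ w ⟨f, hf, hwf⟩ huw _
    have : e = f := by
      by_contra hef
      exact h2 ((Set.one_lt_ncard).2 ⟨e, he, f, hf, hef⟩)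
    subst this
    rw [← (Sym2.mem_and_mem_iff huw).1 ⟨hue, hwf⟩]
    exact hFL he

end Erase

section PinTransfer

open Topology

variable {V : Type*} [Fintype V] [DecidableEq V] {p m m₀ : V → Fin 2 → ℝ} {P : Set V}
  {B F : Set (Sym2 V)} {a b c v w : V}

theorem continuous_row (e : Sym2 V) (d : V → Fin 2 → ℝ) :
    Continuous fun x : V → Fin 2 → ℝ => row x e d := by
  simp_rw [row_comm _ d]
  exact (row d e).continuous_of_finiteDimensional

theorem PinSurj.eventually (h : PinSurj m P B) : ∀ᶠ x in 𝓝 m, PinSurj x P B := by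
  classical
  have : Fintype B := Fintype.ofFinite _
  choose d hd0 hd using fun e : Sym2 V => h (fun f => if f = e then 1 else 0)
  let M : (V → Fin 2 → ℝ) → Matrix B B ℝ := fun x => Matrix.of fun f e => row x f (d e)
  have hM : Continuous fun x => (M x).det :=
    Continuous.matrix_det (continuous_matrix fun f e => continuous_row _ _)
  have h1 : (M m).det ≠ 0 := by
    have : M m = 1 := by
      ext f e
      simp [M, hd e f f.2, Matrix.one_apply, Subtype.ext_iff]
    simp [this]
  filter_upwards [hM.continuousAt.eventually_ne h1] with x hx c
  have hinv : M x * (M x)⁻¹ = 1 := Matrix.mul_nonsing_inv _ (isUnit_iff_ne_zero.2 hx)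
  refine ⟨∑ e : B, ((M x)⁻¹.mulVec fun e => c e) e • d e, fun v hv => ?_, fun f hf => ?_⟩
  · simp [Finset.sum_apply, hd0 _ v hv]
  · have := congrFun (Matrix.mulVec_mulVec (fun e : B => c e) (M x) (M x)⁻¹) ⟨f, hf⟩
    rw [hinv, Matrix.one_mulVec] at this
    rw [← this, map_sum]
    simp only [map_smul, smul_eq_mul, M, Matrix.mulVec, dotProduct, Matrix.of_apply]
    exact Finset.sum_congr rfl fun e _ => mul_comm _ _

theorem Reg.eventually (h : Reg (row m) F) : ∀ᶠ x in 𝓝 m, Reg (row x) F := by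
  simp_rw [← pinSurj_empty] at h ⊢
  exact h.eventually

theorem Generic.cl_of_reg (hp : Generic p) {e : Sym2 V} (h : Cl (row p) F e)
    (hm : Reg (row m) F) : Cl (row m) F e := by
  by_contra hcl
  have he : e ∉ F := fun he => hcl (Cl.of_mem he)
  have := (hp.reg (hm.insert hcl)).not_cl (Set.mem_insert e F)
  rw [Set.insert_sdiff_of_mem _ (Set.mem_singleton e), Set.sdiff_singleton_eq_self he] at this
  exact this h

theorem PinSurj.exists_update (h : PinSurj m P B) (a : V) {D : Set (Fin 2 → ℝ)} (hD : Dense D) :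
    ∃ z ∈ D, PinSurj (Function.update m a z) P B := by
  have : Filter.Tendsto (fun z => Function.update m a z) (𝓝 (m a)) (𝓝 m) := by
    have hc : Continuous fun z => Function.update m a z := by fun_prop
    simpa using hc.tendsto (m a)
  obtain ⟨z, hzD, hz⟩ := (hD.inter_nhds_nonempty (this.eventually h.eventually))
  exact ⟨z, hzD, hz⟩

theorem dense_cross_ne_zero {δ : Fin 2 → ℝ} (hδ : δ ≠ 0) (α : Fin 2 → ℝ) :
    Dense {z | cross (z - α) δ ≠ 0} := by
  intro z
  by_cases hz : cross (z - α) δ = 0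
  · have hc : Filter.Tendsto (fun t : ℝ => z + t • rot δ) (𝓝[≠] 0) (𝓝 z) := by
      have : Continuous fun t : ℝ => z + t • rot δ := by fun_prop
      simpa using (this.tendsto 0).mono_left nhdsWithin_le_nhds
    refine mem_closure_of_tendsto hc ?_
    filter_upwards [self_mem_nhdsWithin] with t ht
    have hne : ip δ δ ≠ 0 := fun h => hδ (ip_self_eq_zero.1 h)
    have : cross (z + t • rot δ - α) δ = cross (z - α) δ - t * ip δ δ := by
      simp [cross, ip]; ring
    rw [this, hz, zero_sub, neg_ne_zero]
    exact mul_ne_zero ht hne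
  · exact subset_closure hz

theorem PinSurj.insert_of_row_ne (h : PinSurj m P B) {e : Sym2 V} {d : V → Fin 2 → ℝ}
    (hd0 : ∀ v ∈ P, d v = 0) (hdB : ∀ f ∈ B, row m f d = 0) (hde : row m e d ≠ 0) :
    PinSurj m P (insert e B) := by
  intro c
  obtain ⟨d₁, h0, h1⟩ := h c
  refine ⟨d₁ + ((c e - row m e d₁) / row m e d) • d, fun v hv => ?_, ?_⟩
  · simp [h0 v hv, hd0 v hv]
  · rintro f (rfl | hf)
    · rw [map_add, map_smul, smul_eq_mul, div_mul_cancel₀ _ hde]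
      ring
    · rw [map_add, map_smul, h1 f hf, hdB f hf, smul_zero, add_zero]

theorem PinSurj.notMem_pairs (h : PinSurj m P B) {e : Sym2 V} (he : e ∈ B) : e ∉ pairs P := by
  intro heP
  obtain ⟨d, hd0, hd⟩ := h fun _ => 1
  have := hd e he
  rw [row_congr (d' := 0) m fun v hv => hd0 v (heP v hv)] at this
  simp at this

theorem PinSurj.ne_of_mem (h : PinSurj m P B) (hab : s(a, b) ∈ B) : m a ≠ m b := by
  intro he
  obtain ⟨d, -, hd⟩ := h fun _ => 1
  have := hd _ hab
  rw [row_mk, he, sub_self, ip_zero_left] at this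
  exact zero_ne_one this

theorem PinSurj.ncard_le (h : PinSurj m P B) : B.ncard ≤ 2 * (vertexSpan B \ P).ncard := by
  classical
  set W := vertexSpan B \ P
  have : Fintype B := Fintype.ofFinite _
  have : Fintype W := Fintype.ofFinite _
  let ext : (W → Fin 2 → ℝ) →ₗ[ℝ] (V → Fin 2 → ℝ) :=
    LinearMap.pi fun v => if hv : v ∈ W then LinearMap.proj ⟨v, hv⟩ else 0
  let φ : (W → Fin 2 → ℝ) →ₗ[ℝ] (B → ℝ) := LinearMap.pi fun e => (row m e).comp ext
  have hφ : Function.Surjective φ := by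
    intro c
    obtain ⟨d, hd0, hd⟩ := h fun e => if he : e ∈ B then c ⟨e, he⟩ else 0
    refine ⟨fun v => d v, funext fun e => ?_⟩
    have : row m e (ext fun v => d v) = row m e d := by
      refine row_congr m fun v hv => ?_
      by_cases hvW : v ∈ W
      · simp [ext, hvW]
      · have hvP : v ∈ P := by
          by_contra hvP
          exact hvW ⟨⟨e, e.2, hv⟩, hvP⟩
        simp [ext, hvW, hd0 v hvP]
    simp [φ, this, hd e e.2]
  have := φ.finrank_le_finrank_of_surjective hφ
  simp only [Module.finrank_pi_fintype, Module.finrank_self, Finset.sum_const, Finset.card_univ,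
    Fintype.card_fin, smul_eq_mul, mul_one] at this
  rw [← Nat.card_coe_set_eq, ← Nat.card_coe_set_eq, Nat.card_eq_fintype_card,
    Nat.card_eq_fintype_card]
  linarith

theorem PinSurj.exists_nb_le_three (hB : ∀ e ∈ B, ¬ e.IsDiag)
    (h : PinSurj m P B) (hne : B.Nonempty) :
    ∃ w ∈ vertexSpan B, w ∉ P ∧ (nb B w).ncard ≤ 3 := by
  classical
  by_contra! hcon
  set W := vertexSpan B \ P with hW
  have h1 : B.ncard ≤ 2 * W.ncard := h.ncard_le
  have h2 := sum_nb hB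
  set B' := B ∩ pairs W
  have h3 : B' = ∅ ∨ B'.ncard + 3 ≤ 2 * W.ncard := by
    rcases B'.eq_empty_or_nonempty with h' | h'
    · exact Or.inl h'
    · exact Or.inr ((pinSurj_empty.1 (h.mono (Set.empty_subset _)
        Set.inter_subset_left)).ncard_add_three_le Set.inter_subset_right h')
  have hWpos : 0 < W.ncard := by
    rw [Set.ncard_pos]
    obtain ⟨e, he⟩ := hne
    by_contra hemp
    rw [Set.not_nonempty_iff_eq_empty] at hemp
    refine h.notMem_pairs he fun v hv => ?_
    by_contra hvP
    exact (hemp ▸ (⟨⟨e, he, hv⟩, hvP⟩ : v ∈ W) : v ∈ (∅ : Set V))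
  have h4 : (B \ B').ncard ≤ ∑ v ∈ P.toFinset, (nb B v).ncard := by
    have hsub : B \ B' ⊆ ⋃ v ∈ P.toFinset, (fun n => s(v, n)) '' nb B v := by
      rintro e ⟨he, he'⟩
      have : ∃ v ∈ e, v ∈ P := by
        by_contra! hno
        exact he' ⟨he, fun v hv => ⟨⟨e, he, hv⟩, hno v hv⟩⟩
      obtain ⟨v, ⟨n, rfl⟩, hvP⟩ := this
      simp only [Set.mem_iUnion]
      exact ⟨v, by simpa using hvP, n, he, rfl⟩
    refine (Set.ncard_le_ncard hsub (Set.toFinite _)).trans ?_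
    refine (Finset.set_ncard_biUnion_le _ _).trans (Finset.sum_le_sum fun v _ => ?_)
    exact Set.ncard_image_le (Set.toFinite _)
  have h5 : 4 * W.ncard ≤ ∑ v ∈ P.toFinsetᶜ, (nb B v).ncard := by
    rw [Set.ncard_eq_toFinset_card', mul_comm, ← smul_eq_mul]
    calc _ ≤ ∑ v ∈ W.toFinset, (nb B v).ncard :=
          Finset.card_nsmul_le_sum _ _ _ fun v hv => by
            simp only [Set.mem_toFinset] at hv
            exact hcon v hv.1 hv.2
      _ ≤ _ := Finset.sum_le_sum_of_subset fun v hv => by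
            simp only [Set.mem_toFinset, Finset.mem_compl] at hv ⊢
            exact hv.2
  rw [← Finset.sum_add_sum_compl P.toFinset] at h2
  have h6 := Set.ncard_sdiff_add_ncard_of_subset (s := B') (t := B) Set.inter_subset_left
  rcases h3 with h3 | h3
  · rw [h3, Set.ncard_empty] at h6
    rw [h3] at h4
    omega
  · omega

theorem PinSurj.exists_of_nb_le_two (hB : ∀ e ∈ B, ¬ e.IsDiag) (hw : w ∉ P)
    (hN : (nb B w).ncard ≤ 2) (hinj : Set.InjOn m P) (h : PinSurj m P {e | e ∈ B ∧ w ∉ e}) :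
    ∃ m', (∀ v ∈ P, m' v = m v) ∧ PinSurj m' P B := by
  suffices H : ∃ m', (∀ v ∈ P, m' v = m v) ∧ PinSurj m' P {e | e ∈ B ∧ w ∉ e} ∧
      ∃ x, (∀ a ∈ nb B w, x ≠ m' a) ∧
        ∀ a ∈ nb B w, ∀ b ∈ nb B w, a ≠ b → cross (x - m' a) (x - m' b) ≠ 0 by
    obtain ⟨m', hm', hs, x, hx, hc⟩ := H
    have hnw : ∀ n ∈ nb B w, n ≠ w := by
      rintro n hn rfl
      exact hB _ hn rfl
    refine ⟨Function.update m' w x, fun v hv => ?_, ?_⟩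
    · rw [Function.update_of_ne (ne_of_mem_of_not_mem hv hw), hm' v hv]
    · refine PinSurj.of_star hw (hs.congr fun e he v hv => ?_) fun c => ?_
      · rw [Function.update_of_ne]
        rintro rfl
        exact he.2 hv
      · obtain ⟨z, hz⟩ := exists_star hN hx hc c
        refine ⟨z, fun n hn => ?_⟩
        rw [Function.update_self, Function.update_of_ne (hnw n hn), hz n hn]
  rcases eq_pair_of_ncard_le_two hN with hN | ⟨a, hN⟩ | ⟨a, b, hab, hN⟩
  · exact ⟨m, fun _ _ => rfl, h, 0, by simp [hN]⟩
  · obtain ⟨x, hx⟩ := exists_ne (m a)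
    refine ⟨m, fun _ _ => rfl, h, x, ?_⟩
    rw [hN]
    refine ⟨fun _ h => h ▸ hx, ?_⟩
    rintro _ rfl _ rfl hne
    exact absurd rfl hne
  · have key : ∃ m', (∀ v ∈ P, m' v = m v) ∧ PinSurj m' P {e | e ∈ B ∧ w ∉ e} ∧
        m' a ≠ m' b := by
      have hupd : ∀ a b, a ≠ b → a ∉ P → ∃ m', (∀ v ∈ P, m' v = m v) ∧
          PinSurj m' P {e | e ∈ B ∧ w ∉ e} ∧ m' a ≠ m' b := by
        intro a b hab ha
        obtain ⟨z, hz, hs⟩ := h.exists_update a (dense_compl_singleton (m b))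
        refine ⟨_, fun v hv => Function.update_of_ne (ne_of_mem_of_not_mem hv ha) _ _, hs, ?_⟩
        rw [Function.update_self, Function.update_of_ne hab.symm]
        exact hz
      by_cases ha : a ∈ P
      · by_cases hb : b ∈ P
        · exact ⟨m, fun _ _ => rfl, h, hinj.ne ha hb hab⟩
        · obtain ⟨m', h1, h2, h3⟩ := hupd b a hab.symm hb
          exact ⟨m', h1, h2, h3.symm⟩
      · exact hupd a b hab ha
    obtain ⟨m', h1, h2, h3⟩ := key
    have hne : ip (m' b - m' a) (m' b - m' a) ≠ 0 := fun h =>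
      h3 (sub_eq_zero.1 (ip_self_eq_zero.1 h)).symm
    have hcr : cross (m' a + rot (m' b - m' a) - m' a) (m' a + rot (m' b - m' a) - m' b) ≠ 0 := by
      convert hne using 1
      simp [cross, ip]; ring
    have hcr' : cross (m' a + rot (m' b - m' a) - m' b) (m' a + rot (m' b - m' a) - m' a) ≠ 0 := by
      rw [← neg_ne_zero]
      convert hcr using 1
      simp [cross]; ring
    refine ⟨m', h1, h2, m' a + rot (m' b - m' a), ?_, ?_⟩
    · rw [hN]
      rintro _ (rfl | rfl) he
      · rw [sub_eq_zero.2 he] at hcr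
        simp [cross] at hcr
      · rw [sub_eq_zero.2 he] at hcr
        simp [cross] at hcr
    · rw [hN]
      rintro _ (rfl | rfl) _ (rfl | rfl) hne
      exacts [absurd rfl hne, hcr, hcr', absurd rfl hne]

theorem PinSurj.exists_of_edge (hw : w ∉ P) (hN : nb B w ⊆ {a, b, c}) (haw : a ≠ w) (hbw : b ≠ w)
    (hcw : c ≠ w) (hab : a ≠ b) (hac : a ≠ c) (hbc : b ≠ c) (habB : s(a, b) ∉ B)
    (hinj : Set.InjOn m P) (h : PinSurj m P (insert s(a, b) {e | e ∈ B ∧ w ∉ e})) :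
    ∃ m', (∀ v ∈ P, m' v = m v) ∧ PinSurj m' P B := by
  have hne : m a ≠ m b := h.ne_of_mem (Set.mem_insert _ _)
  suffices H : ∃ m', (∀ v ∈ P, m' v = m v) ∧
      PinSurj m' P (insert s(a, b) {e | e ∈ B ∧ w ∉ e}) ∧ cross (m' b - m' a) (m' a - m' c) ≠ 0 by
    obtain ⟨m', h1, h2, h3⟩ := H
    refine ⟨Function.update m' w ((1 / 2 : ℝ) • (m' a + m' b)), fun v hv => ?_, ?_⟩
    · rw [Function.update_of_ne (ne_of_mem_of_not_mem hv hw), h1 v hv]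
    · refine PinSurj.of_midpoint hw haw hbw hcw habB hN (h2.congr fun e he v hv => ?_) ?_ ?_
      · rw [Function.update_of_ne]
        rintro rfl
        rcases he with rfl | he
        · rcases Sym2.mem_iff.1 hv with rfl | rfl
          exacts [haw rfl, hbw rfl]
        · exact he.2 hv
      · rw [Function.update_self, Function.update_of_ne haw, Function.update_of_ne hbw]
      · rw [Function.update_self, Function.update_of_ne haw, Function.update_of_ne hbw,
          Function.update_of_ne hcw]
        convert h3 using 1
        simp [cross]; ring
  have hend : ∀ x y, y ∉ P → m x ≠ m c → x ≠ y → y ≠ c →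
      ∃ m', (∀ v ∈ P, m' v = m v) ∧ PinSurj m' P (insert s(a, b) {e | e ∈ B ∧ w ∉ e}) ∧
        cross (m' y - m' x) (m' x - m' c) ≠ 0 := by
    intro x y hy hxc hxy hyc
    obtain ⟨z, hz, hs⟩ := h.exists_update y (dense_cross_ne_zero (sub_ne_zero.2 hxc) (m x))
    refine ⟨_, fun v hv => Function.update_of_ne (ne_of_mem_of_not_mem hv hy) _ _, hs, ?_⟩
    rw [Function.update_self, Function.update_of_ne hxy, Function.update_of_ne hyc.symm]
    exact hz
  have hswap : ∀ m' : V → Fin 2 → ℝ, cross (m' a - m' b) (m' b - m' c) ≠ 0 →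
      cross (m' b - m' a) (m' a - m' c) ≠ 0 := fun m' h' => by
    convert neg_ne_zero.2 h' using 1
    simp [cross]; ring
  have habP : ¬ (a ∈ P ∧ b ∈ P) := fun h' => h.notMem_pairs (Set.mem_insert _ _)
    (mk_mem_pairs.2 h')
  have hb := fun h1 h2 => hend a b h1 h2 hab hbc
  have ha := fun h1 h2 => (hend b a h1 h2 hab.symm hac).imp
      fun m' h' => And.intro h'.1 (And.intro h'.2.1 (hswap m' h'.2.2))
  by_cases hcP : c ∈ P
  · by_cases haP : a ∈ P
    · exact hb (fun h => habP ⟨haP, h⟩) (hinj.ne haP hcP hac)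
    · by_cases hbP : b ∈ P
      · exact ha haP (hinj.ne hbP hcP hbc)
      · by_cases h' : m a = m c
        · exact ha haP fun h'' => hne (h'.trans h''.symm)
        · exact hb hbP h'
  · obtain ⟨z, hz, hs⟩ := h.exists_update c (dense_cross_ne_zero (sub_ne_zero.2 hne) (m a))
    refine ⟨_, fun v hv => Function.update_of_ne (ne_of_mem_of_not_mem hv hcP) _ _, hs, ?_⟩
    rw [Function.update_self, Function.update_of_ne hac, Function.update_of_ne hbc]
    have : cross (m b - m a) (m a - z) = -cross (z - m a) (m a - m b) := by
      simp [cross]; ring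
    rw [this]
    exact neg_ne_zero.2 hz

theorem Generic.exists_pinSurj_insert (hp : Generic p) (hB : ∀ e ∈ B, ¬ e.IsDiag)
    (h : PinSurj p P B) (haB : s(w, a) ∈ B) (hbB : s(w, b) ∈ B) (hcB : s(w, c) ∈ B)
    (hab : a ≠ b) (hac : a ≠ c) (hbc : b ≠ c) :
    ∃ x y z, ({x, y, z} : Set V) = {a, b, c} ∧ x ≠ y ∧ x ≠ z ∧ y ≠ z ∧ s(x, y) ∉ B ∧
      PinSurj p P (insert s(x, y) {e | e ∈ B ∧ w ∉ e}) := by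
  have hwa : w ≠ a := fun h' => hB _ haB h'
  have hwb : w ≠ b := fun h' => hB _ hbB h'
  have hwc : w ≠ c := fun h' => hB _ hcB h'
  have h0 := h.mono subset_rfl (Set.sep_subset B fun e => w ∉ e)
  obtain ⟨d, hdP, hd⟩ := h fun e => if e = s(w, a) then 1 else 0
  have hdB : ∀ e ∈ {e | e ∈ B ∧ w ∉ e}, row p e d = 0 := by
    rintro e ⟨he, hwe⟩
    rw [hd e he, if_neg]
    rintro rfl
    exact hwe (Sym2.mem_mk_left _ _)
  have hwit : ∀ x y, w ≠ x → w ≠ y → row p s(x, y) d ≠ 0 → s(x, y) ∉ B ∧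
      PinSurj p P (insert s(x, y) {e | e ∈ B ∧ w ∉ e}) := by
    intro x y hx hy hr
    refine ⟨fun hxy => hr (hdB _ ⟨hxy, ?_⟩), h0.insert_of_row_ne hdP hdB hr⟩
    rw [Sym2.mem_iff]
    tauto
  by_cases h1 : row p s(a, b) d = 0
  · by_cases h2 : row p s(b, c) d = 0
    · by_cases h3 : row p s(a, c) d = 0
      · exfalso
        have hrig : Rig p {s(a, b), s(b, c), s(a, c)} {a, b, c} :=
          rig_triple (Cl.of_mem (by simp)) (Cl.of_mem (by simp)) (Cl.of_mem (by simp))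
        obtain ⟨ρ, c', ht⟩ := hp.rig_triv hrig (d := d) (by
          rintro e (rfl | rfl | rfl) <;> assumption)
        have hbr : row p s(w, b) d = 0 := by
          rw [hd _ hbB, if_neg]
          simp [hab.symm, hwa, hwb.symm]
        have hcr : row p s(w, c) d = 0 := by
          rw [hd _ hcB, if_neg]
          simp [hac.symm, hwa, hwc.symm]
        have har := hd _ haB
        rw [if_pos rfl] at har
        have hdw : d w = triv p ρ c' w := by
          refine eq_of_row_eq (q := p) (d := d) (d' := triv p ρ c') (x := b) (y := c) (z := w)
            ?_ (ht b (by simp)) (ht c (by simp)) ?_ ?_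
          · exact hp.cross_ne_zero' hwb hwc hbc
          · rw [hbr, row_triv]
          · rw [hcr, row_triv]
        rw [row_congr (d' := triv p ρ c') p (by
          intro v hv
          rcases Sym2.mem_iff.1 hv with rfl | rfl
          exacts [hdw, ht _ (by simp)]), row_triv] at har
        exact zero_ne_one har
      · exact ⟨a, c, b, by rw [Set.pair_comm], hac, hab, hbc.symm, hwit a c hwa hwc h3⟩
    · exact ⟨b, c, a, by ext; simp; tauto, hbc, hab.symm, hac.symm, hwit b c hwb hwc h2⟩
  · exact ⟨a, b, c, rfl, hab, hac, hbc, hwit a b hwa hwb h1⟩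

/-- A generically pinned-independent edge set can be realised as such for an arbitrary injective
placement of the pinned vertices. -/
theorem Generic.pin_transfer (hp : Generic p) {P : Set V} {B : Set (Sym2 V)}
    (hB : ∀ e ∈ B, ¬ e.IsDiag) (h : PinSurj p P B) (hinj : Set.InjOn m₀ P) :
    ∃ m, (∀ v ∈ P, m v = m₀ v) ∧ PinSurj m P B := by
  induction hn : (vertexSpan B \ P).ncard using Nat.strong_induction_on generalizing B with
  | _ n ih =>
    rcases B.eq_empty_or_nonempty with rfl | hne
    · exact ⟨m₀, fun _ _ => rfl, fun _ => ⟨0, by simp⟩⟩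
    obtain ⟨w, hwB, hwP, hw3⟩ := h.exists_nb_le_three hB hne
    have hsub : ∀ B' ⊆ pairs (vertexSpan B \ {w}), (vertexSpan B' \ P).ncard < n := by
      intro B' hB'
      rw [← hn]
      refine Set.ncard_lt_ncard ⟨?_, fun hs => ?_⟩ (Set.toFinite _)
      · exact fun v hv => ⟨(vertexSpan_subset hB' hv.1).1, hv.2⟩
      · exact (vertexSpan_subset hB' (hs ⟨hwB, hwP⟩).1).2 rfl
    have h0 : {e | e ∈ B ∧ w ∉ e} ⊆ pairs (vertexSpan B \ {w}) := fun e he v hv =>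
      ⟨⟨e, he.1, hv⟩, fun hvw => he.2 (hvw ▸ hv)⟩
    have hinj' : ∀ m : V → Fin 2 → ℝ, (∀ v ∈ P, m v = m₀ v) → Set.InjOn m P := fun m hm x hx y hy hxy =>
      hinj hx hy (by rwa [← hm x hx, ← hm y hy])
    have hnw : ∀ n ∈ nb B w, n ≠ w := by
      rintro n hn rfl
      exact hB _ hn rfl
    by_cases hw2 : (nb B w).ncard ≤ 2
    · obtain ⟨m, hm, hs⟩ := ih _ (hsub _ h0) (fun e he => hB e he.1)
        (h.mono subset_rfl (Set.sep_subset _ _)) rfl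
      obtain ⟨m', hm', hs'⟩ := hs.exists_of_nb_le_two hB hwP hw2 (hinj' m hm)
      exact ⟨m', fun v hv => (hm' v hv).trans (hm v hv), hs'⟩
    · obtain ⟨a, b, c, hab, hac, hbc, hN⟩ := Set.ncard_eq_three.1 (le_antisymm hw3 (by omega))
      obtain ⟨x, y, z, hxyz, hxy, hxz, hyz, hxyB, hs⟩ :=
        hp.exists_pinSurj_insert hB h (w := w) (a := a) (b := b) (c := c)
          (show a ∈ nb B w by simp [hN]) (show b ∈ nb B w by simp [hN])
          (show c ∈ nb B w by simp [hN]) hab hac hbc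
      rw [← hxyz] at hN
      have hx : x ∈ nb B w := by simp [hN]
      have hy : y ∈ nb B w := by simp [hN]
      have hz : z ∈ nb B w := by simp [hN]
      obtain ⟨m, hm, hs'⟩ := ih _ (hsub (insert s(x, y) {e | e ∈ B ∧ w ∉ e}) (by
          rintro e (rfl | he)
          · exact mk_mem_pairs.2 ⟨⟨right_mem_vertexSpan hx, hnw x hx⟩,
              ⟨right_mem_vertexSpan hy, hnw y hy⟩⟩
          · exact h0 he)) (by
          rintro e (rfl | he)
          exacts [hxy, hB e he.1]) hs rfl
      obtain ⟨m', hm', hs''⟩ := hs'.exists_of_edge hwP hN.subset (hnw x hx) (hnw y hy) (hnw z hz)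
        hxy hxz hyz hxyB (hinj' m hm)
      exact ⟨m', fun v hv => (hm' v hv).trans (hm v hv), hs''⟩

end PinTransfer

section OpenMaps

open Topology

variable {V : Type*} [Fintype V] [DecidableEq V] {m d : V → Fin 2 → ℝ} {P : Set V}
  {B F : Set (Sym2 V)}

/-- The rigidity row of an edge, as a continuous bilinear form. -/
def rowBilin (e : Sym2 V) : (V → Fin 2 → ℝ) →L[ℝ] (V → Fin 2 → ℝ) →L[ℝ] ℝ :=
  (LinearMap.mk₂ ℝ (fun x z => row x e z)
    (fun x y z => by rw [row_comm, map_add, row_comm z, row_comm z])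
    (fun c x z => by rw [row_comm, map_smul, row_comm z])
    (fun x => map_add _) (fun c x z => map_smul _ c z)).toContinuousBilinearMap

@[simp]
theorem rowBilin_apply (e : Sym2 V) (x z : V → Fin 2 → ℝ) : rowBilin e x z = row x e z := rfl

/-- A placement whose edge set `B` is independent after pinning `P` may be perturbed so as to
prescribe simultaneously the positions of `P` and the lengths of the edges in `B`. -/
theorem PinSurj.eventually_exists (h : PinSurj m P B) {U : Set (V → Fin 2 → ℝ)} (hU : U ∈ 𝓝 m) :
    ∀ᶠ yc : (V → Fin 2 → ℝ) × (Sym2 V → ℝ) in 𝓝 (m, fun f => row m f m),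
      ∃ q ∈ U, (∀ v ∈ P, q v = yc.1 v) ∧ ∀ f ∈ B, row q f q = yc.2 f := by
  classical
  have : Fintype B := Fintype.ofFinite _
  choose d hd0 hd using fun e : Sym2 V => h (fun f => if f = e then 1 else 0)
  let T : (V → Fin 2 → ℝ) × (B → ℝ) →L[ℝ] (V → Fin 2 → ℝ) :=
    LinearMap.toContinuousLinearMap
      (LinearMap.fst ℝ _ _ + (Fintype.linearCombination ℝ fun e : B => d e) ∘ₗ LinearMap.snd ℝ _ _)
  have hT : ∀ x, T x = x.1 + ∑ e : B, x.2 e • d e := fun x => by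
    simp [T, Fintype.linearCombination_apply]
  have hTP : ∀ x, ∀ v ∈ P, T x v = x.1 v := fun x v hv => by
    simp [hT, Finset.sum_apply, hd0 _ v hv]
  have hT0 : T (m, 0) = m := by simp [hT]
  let G : (V → Fin 2 → ℝ) × (B → ℝ) → (V → Fin 2 → ℝ) × (B → ℝ) := fun x =>
    (x.1, fun f => row (T x) f (T x))
  have hder : HasStrictFDerivAt G _ (m, 0) :=
    hasStrictFDerivAt_fst.prodMk (hasStrictFDerivAt_pi.2 fun f : B =>
      (rowBilin f.1).hasStrictFDerivAt_of_bilinear T.hasStrictFDerivAt T.hasStrictFDerivAt)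
  have hsurj := hder.map_nhds_eq_of_surj (by
    rw [LinearMap.range_eq_top]
    rintro ⟨δ, c⟩
    refine ⟨(δ, fun f => c f / 2 - row m f δ), Prod.ext rfl (funext fun f => ?_)⟩
    have : row m f (T (δ, fun f => c f / 2 - row m f δ)) = c f / 2 := by
      rw [hT, map_add, map_sum, Finset.sum_eq_single f]
      · simp [hd f f.1 f.2]
      · intro e _ he
        rw [map_smul, hd e f.1 f.2, if_neg fun h => he (Subtype.ext h.symm), smul_zero]
      · simp
    simp [hT0, row_comm (T _), this])
  have hUT : {x | T x ∈ U} ∈ 𝓝 ((m, 0) : (V → Fin 2 → ℝ) × (B → ℝ)) :=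
    T.continuous.continuousAt.preimage_mem_nhds (by rwa [hT0])
  have himg := Filter.image_mem_map (m := G) hUT
  rw [hsurj] at himg
  have hGm : G (m, 0) = (m, fun f : B => row m f m) := by simp [G, hT0]
  rw [hGm] at himg
  have hc : Continuous fun yc : (V → Fin 2 → ℝ) × (Sym2 V → ℝ) =>
      ((yc.1, fun f : B => yc.2 f) : (V → Fin 2 → ℝ) × (B → ℝ)) := by fun_prop
  filter_upwards [hc.continuousAt.preimage_mem_nhds himg] with yc hyc
  obtain ⟨x, hx, hxy⟩ := hyc
  simp only [G, Prod.mk.injEq] at hxy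
  exact ⟨T x, hx, fun v hv => by rw [hTP x v hv, hxy.1], fun f hf => congrFun hxy.2 ⟨f, hf⟩⟩

/-- If `d` is a motion of `F` at `m` and the system describing nearby pairs is nondegenerate, then
there are nearby pairs `(x, z)` of a placement and a motion for which `x + t • z` is generic. -/
theorem exists_generic_fold {t₀ : ℝ} (hd : ∀ f ∈ F, row m f d = 0)
    (h : ∀ c : Sym2 V → ℝ, ∃ z : V → Fin 2 → ℝ, ∃ t : ℝ,
      ∀ f ∈ F, row (m - t₀ • d) f z + t * row d f d = c f)
    {U : Set ((V → Fin 2 → ℝ) × (V → Fin 2 → ℝ) × ℝ)} (hU : U ∈ 𝓝 (m, d, t₀)) :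
    ∃ x z t, (x, z, t) ∈ U ∧ Generic (x + t • z) ∧ ∀ f ∈ F, row x f z = 0 := by
  classical
  have : Fintype F := Fintype.ofFinite _
  let G : (V → Fin 2 → ℝ) × (V → Fin 2 → ℝ) × ℝ → (F → ℝ) × (V → Fin 2 → ℝ) := fun x =>
    (fun f => row x.1 f x.2.1, x.1 + x.2.2 • x.2.1)
  have h1 := hasStrictFDerivAt_fst (𝕜 := ℝ) (p := (m, d, t₀))
  have h2 := hasStrictFDerivAt_snd (𝕜 := ℝ) (p := (m, d, t₀))
  have hder : HasStrictFDerivAt G _ (m, d, t₀) :=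
    (hasStrictFDerivAt_pi.2 fun f : F =>
      (rowBilin f.1).hasStrictFDerivAt_of_bilinear h1 h2.fst).prodMk (h1.add (h2.snd.smul h2.fst))
  have hsurj := hder.map_nhds_eq_of_surj (by
    rw [LinearMap.range_eq_top]
    rintro ⟨c, y⟩
    obtain ⟨z, t, hzt⟩ := h fun f => (if hf : f ∈ F then c ⟨f, hf⟩ else 0) - row d f y
    refine ⟨(y - t₀ • z + t • d, z, -t), Prod.ext (funext fun f => ?_) ?_⟩
    · have := hzt f f.2
      rw [dif_pos f.2, row_comm, map_sub, map_smul, row_comm z, row_comm z] at this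
      simp [row_comm _ d]
      rw [smul_eq_mul] at this
      linarith
    · simp
      abel)
  have himg := Filter.image_mem_map (m := G) hU
  rw [hsurj] at himg
  have hGm : G (m, d, t₀) = (0, m + t₀ • d) := by
    refine Prod.ext (funext fun f => ?_) rfl
    exact hd f f.2
  rw [hGm] at himg
  have hc : Continuous fun y : V → Fin 2 → ℝ => ((0, y) : (F → ℝ) × (V → Fin 2 → ℝ)) := by
    fun_prop
  obtain ⟨y, hy, ⟨⟨x, z, t⟩, hx, hxy⟩⟩ :=
    dense_generic.inter_nhds_nonempty (hc.continuousAt.preimage_mem_nhds himg)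
  simp only [G, Prod.mk.injEq] at hxy
  exact ⟨x, z, t, hx, by rw [hxy.2]; exact hy, fun f hf => congrFun hxy.1 ⟨f, hf⟩⟩

end OpenMaps

section Flip

open Topology

variable {V : Type*} [Fintype V] [DecidableEq V] {p q m : V → Fin 2 → ℝ} {A P : Set V}
  {B E F : Set (Sym2 V)} {s t u w : V}

theorem row_add_sub (p q : V → Fin 2 → ℝ) (e : Sym2 V) :
    row (p + q) e (p - q) = row p e p - row q e q := by
  rw [map_sub, row_comm, row_comm (p + q), map_add, map_add, row_comm p q]
  ring

theorem mem_sameLen_iff {e : Sym2 V} : e ∈ sameLen p q ↔ row (p + q) e (p - q) = 0 := by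
  rw [row_add_sub, sub_eq_zero, sameLen, Set.mem_ofPred_eq]

theorem mem_sameLen_fold {x z : V → Fin 2 → ℝ} {t : ℝ} {e : Sym2 V} :
    e ∈ sameLen (x + t • z) (x - t • z) ↔ t = 0 ∨ row x e z = 0 := by
  have h1 : x + t • z + (x - t • z) = (2 : ℝ) • x := by rw [two_smul]; abel
  have h2 : x + t • z - (x - t • z) = (2 * t) • z := by rw [mul_smul, two_smul]; abel
  rw [mem_sameLen_iff, h1, h2, map_smul, row_comm, map_smul, row_comm]
  simp

theorem Generic.exists_flip_of_not_cl (hp : Generic p) (h : ¬ Cl (row p) E s(u, w)) :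
    ∃ p' q, Generic p' ∧ E ⊆ sameLen p' q ∧ s(u, w) ∉ sameLen p' q := by
  obtain ⟨F, hFE, hF, hcl⟩ := exists_basis (r := row p) E
  simp only [Cl, not_forall] at h
  obtain ⟨d, hd, hduw⟩ := h
  have hev : ∀ᶠ t : ℝ in 𝓝[≠] 0, Reg (row (p - t • d)) F := by
    have hc : Continuous fun t : ℝ => p - t • d := by fun_prop
    have := hc.tendsto 0
    simp only [zero_smul, sub_zero] at this
    exact (this.eventually hF.eventually).filter_mono nhdsWithin_le_nhds
  obtain ⟨t₀, ht₀, ht₀'⟩ := (hev.and self_mem_nhdsWithin).exists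
  have hU : ∀ᶠ y : (V → Fin 2 → ℝ) × (V → Fin 2 → ℝ) × ℝ in 𝓝 (p, d, t₀),
      Reg (row y.1) F ∧ row y.1 s(u, w) y.2.1 ≠ 0 ∧ y.2.2 ≠ 0 := by
    refine ((continuous_fst.tendsto (p, d, t₀)).eventually hF.eventually).and ((?_ : ∀ᶠ _ in _, _).and ?_)
    · refine ContinuousAt.eventually_ne (Continuous.continuousAt ?_) hduw
      exact (rowBilin s(u, w)).continuous₂.comp (by fun_prop : Continuous fun y :
        (V → Fin 2 → ℝ) × (V → Fin 2 → ℝ) × ℝ => (y.1, y.2.1))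
    · exact ContinuousAt.eventually_ne (by fun_prop) ht₀'
  obtain ⟨x, z, t, ⟨hx, hxz, ht⟩, hgen, hker⟩ := exists_generic_fold (m := p) (d := d) (F := F)
    (t₀ := t₀) (fun f hf => hd f (hFE hf)) (fun c => (ht₀ c).imp fun z hz => ⟨0, by simpa using hz⟩)
    hU
  refine ⟨_, x - t • z, hgen, fun e he => ?_, fun h => ?_⟩
  · exact mem_sameLen_fold.2 (Or.inr (hp.cl_of_reg (hcl e he) hx z hker))
  · exact (mem_sameLen_fold.1 h).elim ht hxz

/-- Reflection in the line through `a` and `b`. -/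
def lineRefl (a b z : Fin 2 → ℝ) : Fin 2 → ℝ :=
  (2 * ip (z - a) (b - a) / ip (b - a) (b - a)) • (b - a) - (z - a) + a

theorem inv_ip_mul_self {a b : Fin 2 → ℝ} (hab : a ≠ b) :
    (ip (b - a) (b - a))⁻¹ * ip (b - a) (b - a) = 1 :=
  inv_mul_cancel₀ fun h => hab (sub_eq_zero.1 (ip_self_eq_zero.1 h)).symm

theorem lineRefl_isometry {a b : Fin 2 → ℝ} (hab : a ≠ b) (z z' : Fin 2 → ℝ) :
    ip (lineRefl a b z - lineRefl a b z') (lineRefl a b z - lineRefl a b z') =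
      ip (z - z') (z - z') := by
  have hk := inv_ip_mul_self hab
  simp only [lineRefl, div_eq_mul_inv]
  generalize (ip (b - a) (b - a))⁻¹ = k at *
  simp only [ip, Pi.add_apply, Pi.sub_apply, Pi.smul_apply, smul_eq_mul] at hk ⊢
  linear_combination 4 * k * ((z 0 - z' 0) * (b 0 - a 0) + (z 1 - z' 1) * (b 1 - a 1)) ^ 2 * hk

theorem lineRefl_ip_sub {a b : Fin 2 → ℝ} (hab : a ≠ b) (z w : Fin 2 → ℝ) :
    ip (lineRefl a b z - w) (lineRefl a b z - w) - ip (z - w) (z - w) =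
      4 * cross (b - a) (z - a) * cross (b - a) (w - a) / ip (b - a) (b - a) := by
  have hk := inv_ip_mul_self hab
  simp only [lineRefl, div_eq_mul_inv]
  generalize (ip (b - a) (b - a))⁻¹ = k at *
  simp only [ip, cross, Pi.add_apply, Pi.sub_apply, Pi.smul_apply, smul_eq_mul] at hk ⊢
  linear_combination (4 * k * ((z 0 - a 0) * (b 0 - a 0) + (z 1 - a 1) * (b 1 - a 1)) ^ 2
    - 4 * ((z 0 - a 0) * (w 0 - a 0) + (z 1 - a 1) * (w 1 - a 1))) * hk

theorem lineRefl_eq_self {a b z : Fin 2 → ℝ} (hab : a ≠ b) (h : cross (b - a) (z - a) = 0) :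
    lineRefl a b z = z := by
  have := lineRefl_ip_sub hab z z
  rw [h, sub_self z, ip_zero_left, sub_zero, mul_zero, zero_div] at this
  exact sub_eq_zero.1 (ip_self_eq_zero.1 this)

theorem continuousAt_lineRefl {X : Type*} [TopologicalSpace X] {a b z : X → Fin 2 → ℝ} {x : X}
    (ha : ContinuousAt a x) (hb : ContinuousAt b x) (hz : ContinuousAt z x) (hab : a x ≠ b x) :
    ContinuousAt (fun y => lineRefl (a y) (b y) (z y)) x := by
  have hne : ip (b x - a x) (b x - a x) ≠ 0 := fun h =>
    hab (sub_eq_zero.1 (ip_self_eq_zero.1 h)).symm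
  have hip : ∀ f g : X → Fin 2 → ℝ, ContinuousAt f x → ContinuousAt g x →
      ContinuousAt (fun y => ip (f y) (g y)) x := fun f g hf hg => by
    have := fun i => continuousAt_pi.1 hf i
    have := fun i => continuousAt_pi.1 hg i
    simp only [ip]
    fun_prop
  have h1 := hip _ _ (hz.sub ha) (hb.sub ha)
  have h2 := hip _ _ (hb.sub ha) (hb.sub ha)
  exact ((((continuousAt_const.mul h1).div h2 hne).smul (hb.sub ha)).sub (hz.sub ha)).add ha

/-- An independent set of edges outside a component stays independent when the component is
pinned. -/
theorem Generic.pinSurj_of_comp (hp : Generic p) (hE : ∀ e ∈ E, ¬ e.IsDiag) {e : Sym2 V}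
    (he : e ∈ E) (hB : Reg (row p) B) (hBE : B ⊆ E \ comp p E e) :
    PinSurj p (vertexSpan (comp p E e)) B := by
  intro c
  obtain ⟨d₂, hd₂⟩ := hB c
  obtain ⟨d, hd, hd'⟩ := comp_split (p := p) (E := E) e 0 d₂
  obtain ⟨ρ, k, ht⟩ := hp.rig_triv (hp.rig_comp hE he) (d := d) fun f hf => by
    rw [hd f hf, map_zero]
  refine ⟨d - triv p ρ k, fun v hv => by rw [Pi.sub_apply, ht v hv, sub_self], fun f hf => ?_⟩
  rw [map_sub, row_triv, sub_zero, hd' f (hBE hf), hd₂ f hf]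

theorem Generic.exists_flip_of_isSep (hp : Generic p) (hE : ∀ e ∈ E, ¬ e.IsDiag) {e : Sym2 V}
    (he : e ∈ E) (h : IsSep (comp p E e) A s t) (hu : u ∈ A) (hw : w ∈ oside A s t)
    (huV : u ∈ vertexSpan (comp p E e)) (hwV : w ∈ vertexSpan (comp p E e)) :
    ∃ p' q, Generic p' ∧ E ⊆ sameLen p' q ∧ s(u, w) ∉ sameLen p' q := by
  classical
  set H := comp p E e with hH
  obtain ⟨hst, hsH, htH⟩ := hp.sep_mem (hp.rig_comp hE he) h hu huV hw hwV
  obtain ⟨B, hBE, hB, hBcl⟩ := exists_basis (r := row p) (E \ H)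
  have hinj : ∀ x y, p x 0 = p y 0 → x = y := fun x y hxy => congrArg Prod.fst
    (AlgebraicIndependent.injective (show AlgebraicIndependent ℚ _ from hp)
      (a₁ := (x, 0)) (a₂ := (y, 0)) hxy)
  obtain ⟨m, hm, hmB⟩ := hp.pin_transfer (m₀ := fun v => if v ∈ A ∨ v = s ∨ v = t then
    ![p v 0, 0] else p v) (fun f hf => hE f (hBE hf).1) (hp.pinSurj_of_comp hE he hB hBE)
    (fun x _ y _ hxy => hinj x y (by
      have := congrFun hxy 0
      simp only at this
      split_ifs at this <;> simpa using this))
  have hms : m s ≠ m t := by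
    rw [hm s hsH, hm t htH, if_pos (Or.inr (Or.inl rfl)), if_pos (Or.inr (Or.inr rfl))]
    intro h'
    exact hst (hinj s t (congrFun h' 0))
  let y : (V → Fin 2 → ℝ) → V → Fin 2 → ℝ := fun x v =>
    if v ∈ A ∧ v ∈ vertexSpan H then lineRefl (x s) (x t) (x v) else x v
  have hym : y m = m := by
    funext v
    by_cases hv : v ∈ A ∧ v ∈ vertexSpan H
    · simp only [y, if_pos hv]
      refine lineRefl_eq_self hms ?_
      rw [hm s hsH, hm t htH, hm v hv.2, if_pos (Or.inr (Or.inl rfl)),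
        if_pos (Or.inr (Or.inr rfl)), if_pos (Or.inl hv.1)]
      simp [cross]
    · simp only [y, if_neg hv]
  have hyc : ContinuousAt y m := by
    refine continuousAt_pi.2 fun v => ?_
    by_cases hv : v ∈ A ∧ v ∈ vertexSpan H
    · simp only [y, if_pos hv]
      exact continuousAt_lineRefl (continuous_apply s).continuousAt
        (continuous_apply t).continuousAt (continuous_apply v).continuousAt hms
    · simp only [y, if_neg hv]
      exact (continuous_apply v).continuousAt
  have hlen : Continuous fun (x : V → Fin 2 → ℝ) (f : Sym2 V) => row x f x :=
    continuous_pi fun f => (rowBilin f).continuous₂.comp (by fun_prop : Continuous fun x :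
        V → Fin 2 → ℝ => (x, x))
  have hmm : Reg (row (m + m)) B := fun c => by
    obtain ⟨d, -, hd⟩ := hmB fun f => c f / 2
    refine ⟨d, fun f hf => ?_⟩
    rw [row_comm, map_add, row_comm, hd f hf]
    ring
  have hsum : ∀ᶠ xq : (V → Fin 2 → ℝ) × (V → Fin 2 → ℝ) in 𝓝 m ×ˢ 𝓝 m,
      Reg (row (xq.1 + xq.2)) B := by
    rw [← nhds_prod_eq]
    exact (continuous_add.tendsto (m, m)).eventually hmm.eventually
  obtain ⟨U₁, hU₁, U₂, hU₂, hU⟩ := Filter.eventually_prod_iff.1 hsum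
  have hfin := (hyc.prodMk hlen.continuousAt).eventually (by
    simp only [hym]
    exact hmB.eventually_exists hU₂)
  obtain ⟨x, hx, hx₁, q, hq, hqP, hqB⟩ := dense_generic.inter_nhds_nonempty (hU₁.and hfin)
  have hreg := hU hx₁ hq
  have hxst : x s ≠ x t := fun h' => hst (Generic.injective hx h')
  refine ⟨x, q, hx, fun f hf => ?_, ?_⟩
  · by_cases hfH : f ∈ H
    · induction f with
      | _ a b =>
        have ha := left_mem_vertexSpan hfH
        have hb := right_mem_vertexSpan hfH
        have hside : ∀ a b, s(a, b) ∈ H → a ∈ A → b ∈ vertexSpan H →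
            y x b = lineRefl (x s) (x t) (x b) := by
          intro a b hab ha hb
          rcases h.2.2 a b hab ha with hbA | rfl | rfl
          · simp only [y, if_pos (And.intro hbA hb)]
          · rw [lineRefl_eq_self hxst (by simp [cross])]
            exact if_neg fun h' => h.1 h'.1
          · rw [lineRefl_eq_self hxst (by simp [cross]; ring)]
            exact if_neg fun h' => h.2.1 h'.1
        change row x s(a, b) x = row q s(a, b) q
        rw [row_mk, row_mk, hqP a ha, hqP b hb]
        by_cases haA : a ∈ A
        · simp only [hside a b hfH haA hb]
          simp only [y, if_pos (And.intro haA ha), lineRefl_isometry hxst]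
        · by_cases hbA : b ∈ A
          · simp only [hside b a (by rwa [Sym2.eq_swap]) hbA ha]
            simp only [y, if_pos (And.intro hbA hb), lineRefl_isometry hxst]
          · simp only [y, haA, hbA, false_and, if_false]
    · rw [mem_sameLen_iff]
      refine hp.cl_of_reg (hBcl f ⟨hf, hfH⟩) hreg _ fun g hg => ?_
      rw [row_add_sub, hqB g hg, sub_self]
  · intro hmem
    have hmem : row x s(u, w) x = row q s(u, w) q := hmem
    rw [row_mk, row_mk, hqP u huV, hqP w hwV] at hmem
    simp only [y, if_pos (And.intro hu huV), if_neg fun h' : w ∈ A ∧ w ∈ vertexSpan H => hw.1 h'.1]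
      at hmem
    have hus : u ≠ s := fun h' => h.1 (h' ▸ hu)
    have hut : u ≠ t := fun h' => h.2.1 (h' ▸ hu)
    have := lineRefl_ip_sub hxst (x u) (x w)
    rw [← hmem, sub_self, eq_comm, div_eq_zero_iff] at this
    have hne : ip (x t - x s) (x t - x s) ≠ 0 := fun h' =>
      hxst (sub_eq_zero.1 (ip_self_eq_zero.1 h')).symm
    have h1 := Generic.cross_ne_zero hx hst hus.symm hut.symm
    have h2 := Generic.cross_ne_zero hx hst (Ne.symm hw.2.1) (Ne.symm hw.2.2)
    simp [h1, h2, hne] at this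

end Flip

section Conic

open Topology

theorem continuous_ip : Continuous fun x : (Fin 2 → ℝ) × (Fin 2 → ℝ) => ip x.1 x.2 := by
  simp only [ip]
  fun_prop

theorem ip_rot_rot (x y : Fin 2 → ℝ) : ip (rot x) (rot y) = ip x y := by
  simp [ip]
  ring

/-- The conic `⟨X, Y + L X⟩ = 0` passes through the origin, and contains points arbitrarily close
to it. -/
theorem frequently_conic (L : (Fin 2 → ℝ) →ₗ[ℝ] (Fin 2 → ℝ)) {Y : Fin 2 → ℝ} (hY : Y ≠ 0) :
    ∃ᶠ X in 𝓝[≠] 0, ip X (Y + L X) = 0 := by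
  have hYY : ip Y Y ≠ 0 := fun h => hY (ip_self_eq_zero.1 h)
  have hrot : ip (rot Y) Y = 0 := by rw [ip_comm, ip_rot_self]
  have hrot0 : rot Y ≠ 0 := fun h => hYY (by rw [← ip_rot_rot, h, ip_zero_left])
  have hLc : Continuous L := L.continuous_of_finiteDimensional
  by_cases h0 : ip (rot Y) (L (rot Y)) = 0
  · have hT : Filter.Tendsto (fun r : ℝ => r • rot Y) (𝓝[≠] 0) (𝓝[≠] 0) := by
      refine tendsto_nhdsWithin_iff.2 ⟨?_, ?_⟩
      · have : Continuous fun r : ℝ => r • rot Y := by fun_prop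
        simpa using (this.tendsto 0).mono_left nhdsWithin_le_nhds
      · filter_upwards [self_mem_nhdsWithin] with r hr
        exact smul_ne_zero hr hrot0
    refine hT.frequently (Filter.Eventually.of_forall fun r => ?_).frequently
    rw [map_smul, ip_add_right, ip_smul_left, ip_smul_left, ip_smul_right, hrot, h0]
    ring
  · let v : ℝ → Fin 2 → ℝ := fun s => rot Y + s • Y
    let r : ℝ → ℝ := fun s => -(s * ip Y Y) / ip (v s) (L (v s))
    have hv : Continuous v := by fun_prop
    have hvL : Continuous fun s => ip (v s) (L (v s)) :=
      continuous_ip.comp (hv.prodMk (hLc.comp hv))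
    have hne : ∀ᶠ s in 𝓝[≠] (0 : ℝ), ip (v s) (L (v s)) ≠ 0 :=
      (hvL.continuousAt.eventually_ne (by simpa [v] using h0)).filter_mono nhdsWithin_le_nhds
    have hT : Filter.Tendsto (fun s => r s • v s) (𝓝[≠] 0) (𝓝[≠] 0) := by
      refine tendsto_nhdsWithin_iff.2 ⟨?_, ?_⟩
      · have : ContinuousAt (fun s => r s • v s) 0 :=
          ((by fun_prop : ContinuousAt (fun s : ℝ => -(s * ip Y Y)) 0).div hvL.continuousAt
            (by simpa [v] using h0)).smul hv.continuousAt
        have := this.tendsto.mono_left (nhdsWithin_le_nhds (s := {0}ᶜ))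
        simpa [r] using this
      · filter_upwards [hne, self_mem_nhdsWithin] with s hs hs0
        have hv0 : v s ≠ 0 := fun h => hs (by rw [h, ip_zero_left])
        exact smul_ne_zero (div_ne_zero (neg_ne_zero.2 (mul_ne_zero hs0 hYY)) hs) hv0
    refine hT.frequently (Filter.Eventually.frequently ?_)
    filter_upwards [hne] with s hs
    have hvY : ip (v s) Y = s * ip Y Y := by
      rw [ip_add_left, hrot, zero_add, ip_smul_left]
    rw [map_smul, ip_add_right, ip_smul_left, ip_smul_left, ip_smul_right, hvY]
    simp only [r]
    field_simp
    ring

/-- The solution `z` of `⟨x, z⟩ = α`, `⟨y, z⟩ = β`. -/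
def sol (x y : Fin 2 → ℝ) (α β : ℝ) : Fin 2 → ℝ :=
  (cross x y)⁻¹ • ![α * y 1 - β * x 1, β * x 0 - α * y 0]

theorem ip_sol_left {x y : Fin 2 → ℝ} (h : cross x y ≠ 0) (α β : ℝ) : ip x (sol x y α β) = α := by
  have h' := inv_mul_cancel₀ h
  simp only [sol, ip, Pi.smul_apply, smul_eq_mul, Matrix.cons_val_zero, Matrix.cons_val_one]
  generalize (cross x y)⁻¹ = k at *
  simp only [cross] at h'
  linear_combination α * h'

theorem ip_sol_right {x y : Fin 2 → ℝ} (h : cross x y ≠ 0) (α β : ℝ) : ip y (sol x y α β) = β := by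
  have h' := inv_mul_cancel₀ h
  simp only [sol, ip, Pi.smul_apply, smul_eq_mul, Matrix.cons_val_zero, Matrix.cons_val_one]
  generalize (cross x y)⁻¹ = k at *
  simp only [cross] at h'
  linear_combination β * h'

theorem continuousAt_sol {T : Type*} [TopologicalSpace T] {x y : T → Fin 2 → ℝ} {α β : T → ℝ}
    {t : T} (hx : ContinuousAt x t) (hy : ContinuousAt y t) (hα : ContinuousAt α t)
    (hβ : ContinuousAt β t) (h : cross (x t) (y t) ≠ 0) :
    ContinuousAt (fun t => sol (x t) (y t) (α t) (β t)) t := by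
  have hx' := fun i => continuousAt_pi.1 hx i
  have hy' := fun i => continuousAt_pi.1 hy i
  have hc : ContinuousAt (fun t => cross (x t) (y t)) t := by
    simp only [cross]
    fun_prop
  refine (hc.inv₀ h).smul (continuousAt_pi.2 fun i => ?_)
  fin_cases i <;> simp <;> fun_prop

/-- A point near the origin, together with a velocity and an acceleration, for the three bars
joining it to the origin and to `n₂`, `n₃`. -/
theorem exists_fold_point {n₂ n₃ d₂ d₃ a₁ a₂ a₃ : Fin 2 → ℝ} {Q : Set (Fin 2 → ℝ)} (hQ : Q.Finite)
    (hn : cross n₂ n₃ ≠ 0) (hρ : ip n₂ d₂ ≠ 0) :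
    ∃ X Y a : Fin 2 → ℝ, X ≠ 0 ∧ (X ∈ Q → X = 0) ∧ cross (X - n₂) (X - n₃) ≠ 0 ∧ ip X Y = 0 ∧
      ip (X - n₂) (Y - d₂) = 0 ∧ ip (X - n₃) (Y - d₃) = 0 ∧
      ip (X - n₂) (a - a₂) = -ip (Y - d₂) (Y - d₂) ∧
      ip (X - n₃) (a - a₃) = -ip (Y - d₃) (Y - d₃) ∧ ip X (a - a₁) + ip Y Y ≠ 0 := by
  let L : (Fin 2 → ℝ) →ₗ[ℝ] (Fin 2 → ℝ) :=
    { toFun := fun X => sol n₂ n₃ (-ip X d₂) (-ip X d₃)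
      map_add' := fun X X' => by
        ext i
        fin_cases i <;> simp [sol, ip] <;> ring
      map_smul' := fun c X => by
        ext i
        fin_cases i <;> simp [sol, ip] <;> ring }
  have hLc : Continuous L := L.continuous_of_finiteDimensional
  let Y₀ := sol n₂ n₃ (ip n₂ d₂) (ip n₃ d₃)
  have hY₀ : Y₀ ≠ 0 := fun h => by
    have := ip_sol_left hn (ip n₂ d₂) (ip n₃ d₃)
    rw [show sol n₂ n₃ (ip n₂ d₂) (ip n₃ d₃) = 0 from h, ip_zero_right] at this
    exact hρ this.symm
  let Y : (Fin 2 → ℝ) → Fin 2 → ℝ := fun X => Y₀ + L X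
  have hY2 : ∀ X, ip n₂ (Y X) = ip n₂ d₂ - ip X d₂ := fun X => by
    rw [ip_add_right, ip_sol_left hn, show L X = sol n₂ n₃ _ _ from rfl, ip_sol_left hn]
    ring
  have hY3 : ∀ X, ip n₃ (Y X) = ip n₃ d₃ - ip X d₃ := fun X => by
    rw [ip_add_right, ip_sol_right hn, show L X = sol n₂ n₃ _ _ from rfl, ip_sol_right hn]
    ring
  have hYc : Continuous Y := by fun_prop
  let a : (Fin 2 → ℝ) → Fin 2 → ℝ := fun X => sol (X - n₂) (X - n₃)
    (ip (X - n₂) a₂ - ip (Y X - d₂) (Y X - d₂)) (ip (X - n₃) a₃ - ip (Y X - d₃) (Y X - d₃))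
  have hcr : Continuous fun X : Fin 2 → ℝ => cross (X - n₂) (X - n₃) := by
    simp only [cross, Pi.sub_apply]
    fun_prop
  have hcr0 : cross (0 - n₂) (0 - n₃) ≠ 0 := by
    convert hn using 1
    simp [cross]
  have hic : ∀ f g : (Fin 2 → ℝ) → Fin 2 → ℝ, Continuous f → Continuous g →
      Continuous fun X => ip (f X) (g X) := fun f g hf hg => continuous_ip.comp (hf.prodMk hg)
  have hac : ContinuousAt a 0 := by
    refine continuousAt_sol (by fun_prop) (by fun_prop) ?_ ?_ hcr0
    · exact ((hic _ _ (by fun_prop) (by fun_prop)).sub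
        (hic _ _ (by fun_prop) (by fun_prop))).continuousAt
    · exact ((hic _ _ (by fun_prop) (by fun_prop)).sub
        (hic _ _ (by fun_prop) (by fun_prop))).continuousAt
  have hN : ∀ᶠ X in 𝓝 (0 : Fin 2 → ℝ), ip X (a X - a₁) + ip (Y X) (Y X) ≠ 0 := by
    refine ContinuousAt.eventually_ne (ContinuousAt.add ?_ (hic _ _ hYc hYc).continuousAt) ?_
    · exact continuous_ip.continuousAt.comp₂ continuousAt_id (hac.sub continuousAt_const)
    · simp only [Y, map_zero, add_zero, ip_zero_left, zero_add]
      exact fun h => hY₀ (ip_self_eq_zero.1 h)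
  have hQ' : ∀ᶠ X in 𝓝 (0 : Fin 2 → ℝ), X ∉ Q \ {0} :=
    (hQ.subset Set.sdiff_subset).isClosed.isOpen_compl.mem_nhds (by simp)
  obtain ⟨X, hX, ⟨⟨hX1, hX2⟩, hX3⟩, hX0⟩ := ((frequently_conic L hY₀).and_eventually
    ((((hcr.continuousAt.eventually_ne hcr0).and hN).and hQ').filter_mono
      nhdsWithin_le_nhds |>.and self_mem_nhdsWithin)).exists
  refine ⟨X, Y X, a X, hX0, fun h => ?_, hX1, hX, ?_, ?_, ?_, ?_, hX2⟩
  · by_contra h0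
    exact hX3 ⟨h, h0⟩
  · have := hY2 X
    simp only [ip_sub_left, ip_sub_right, show ip X (Y X) = 0 from hX, this]
    ring
  · have := hY3 X
    simp only [ip_sub_left, ip_sub_right, show ip X (Y X) = 0 from hX, this]
    ring
  · rw [ip_sub_right, ip_sol_left hX1]
    ring
  · rw [ip_sub_right, ip_sol_right hX1]
    ring

end Conic

section Fold

open Topology

variable {V : Type*} [Fintype V] [DecidableEq V] {p q m : V → Fin 2 → ℝ} {P : Set V}
  {B D E F G : Set (Sym2 V)} {u w x n₁ n₂ n₃ : V}

theorem PinSurj.reg_union (h : PinSurj m P B) (hG : Reg (row m) G) (hGP : G ⊆ pairs P) :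
    Reg (row m) (B ∪ G) := fun c => by
  obtain ⟨d, hd⟩ := hG c
  obtain ⟨z, hz, hzB⟩ := h fun f => c f - row m f d
  refine ⟨d + z, fun f hf => ?_⟩
  rw [map_add]
  by_cases hfP : f ∈ pairs P
  · have : row m f z = 0 := by
      rw [row_congr (d' := 0) m fun v hv => hz v (hfP v hv), map_zero]
    rw [this, add_zero]
    exact hf.elim (fun hfB => absurd hfP (h.notMem_pairs hfB)) (hd f)
  · rw [hzB f (hf.resolve_right fun hfG => hfP (hGP hfG))]
    ring

theorem exists_eq_triple {a b c y z : V} (hab : a ≠ b) (hac : a ≠ c) (hbc : b ≠ c)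
    (hy : y ∈ ({a, b, c} : Set V)) (hz : z ∈ ({a, b, c} : Set V)) (hyz : y ≠ z) :
    ∃ v, y ≠ v ∧ z ≠ v ∧ ({a, b, c} : Set V) = {y, z, v} := by
  have key : ∀ v, y ≠ v → z ≠ v → (∀ t, t = a ∨ t = b ∨ t = c ↔ t = y ∨ t = z ∨ t = v) →
      ∃ v, y ≠ v ∧ z ≠ v ∧ ({a, b, c} : Set V) = {y, z, v} :=
    fun v h1 h2 h3 => ⟨v, h1, h2, by ext t; simpa using h3 t⟩
  simp only [Set.mem_insert_iff, Set.mem_singleton_iff] at hy hz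
  by_cases h1 : y ≠ a ∧ z ≠ a
  · exact key a h1.1 h1.2 (by grind)
  by_cases h2 : y ≠ b ∧ z ≠ b
  · exact key b h2.1 h2.2 (by grind)
  exact key c (by grind) (by grind) (by grind)

/-- In a circuit through `uw` and edges closed in `E`, chosen with few vertices, there is a vertex
`x` of degree three, one of whose neighbours shares no connected component of `E` with `x` and
another neighbour, and a flex of `D - x - uw` that is nontrivial on the neighbours. -/
theorem Generic.exists_fold_vertex (hp : Generic p) (hE : ∀ e ∈ E, ¬ e.IsDiag) (huw : u ≠ w)
    (hcl : Cl (row p) E s(u, w)) (hno : s(u, w) ∉ plus p E) :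
    ∃ D x n₁ n₂ n₃ d, D ⊆ insert s(u, w) (plus p E) ∧ s(u, w) ∈ D ∧ Circ (row p) D ∧
      x ≠ u ∧ x ≠ w ∧ nb D x = {n₁, n₂, n₃} ∧ n₁ ≠ n₂ ∧ n₁ ≠ n₃ ∧ n₂ ≠ n₃ ∧
      (∀ f ∈ D, x ∉ f → f ≠ s(u, w) → row p f d = 0) ∧ row p s(u, w) d ≠ 0 ∧
      row p s(n₁, n₂) d ≠ 0 ∧ ∀ e ∈ E, x ∈ vertexSpan (comp p E e) →
        n₁ ∈ vertexSpan (comp p E e) → n₂ ∉ vertexSpan (comp p E e) ∧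
          n₃ ∉ vertexSpan (comp p E e) := by
  have hd : ∀ f ∈ insert s(u, w) (plus p E), ¬ f.IsDiag := by
    rintro f (rfl | hf)
    · exact huw
    · exact hf.1
  obtain ⟨C₀, hC₀⟩ := exists_circ_of_cl (hcl.mono (subset_plus hE)) hno
  obtain ⟨D, ⟨hDE, huD, hD⟩, hmin⟩ := Set.exists_min_image
    {D | D ⊆ insert s(u, w) (plus p E) ∧ s(u, w) ∈ D ∧ Circ (row p) D}
    (fun D => (vertexSpan D).ncard) (Set.toFinite _) ⟨C₀, hC₀⟩
  have hdD : ∀ f ∈ D, ¬ f.IsDiag := fun f hf => hd f (hDE hf)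
  obtain ⟨x, hxD, hxS, hx3⟩ := exists_nb_three hdD (fun v hv => hp.three_le_nb hD hdD hv)
    (ncard_le_of_circ hD (hp.two_le_ncard hD hdD)) (S := {u, w})
    ((Set.ncard_insert_le _ _).trans (by simp))
  simp only [Set.mem_insert_iff, Set.mem_singleton_iff, not_or] at hxS
  obtain ⟨a, b, c, hab, hac, hbc, hN⟩ := Set.ncard_eq_three.1 hx3
  have hNx : ∀ n ∈ nb D x, n ≠ x := fun n hn h => hdD _ hn h.symm
  let T : Set (Sym2 V) := {f | ¬ f.IsDiag ∧ f ∈ pairs (nb D x) ∧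
    ∃ e ∈ E, x ∈ vertexSpan (comp p E e) ∧ f ∈ pairs (vertexSpan (comp p E e))}
  have hTE : T ⊆ plus p E := fun f hf => ⟨hf.1, hf.2.2.imp fun e he => ⟨he.1, he.2.2⟩⟩
  let D₀ : Set (Sym2 V) := {f | f ∈ D ∧ x ∉ f ∧ f ≠ s(u, w)}
  have hcl' : ¬ Cl (row p) (D₀ ∪ T) s(u, w) := fun h => by
    obtain ⟨C, hC, huC, hCc⟩ := exists_circ_of_cl h (by
      rintro (h' | h')
      · exact h'.2.2 rfl
      · exact hno (hTE h'))
    have hle := hmin C ⟨hC.trans (Set.insert_subset_insert (Set.union_subset (fun f hf =>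
      (hDE hf.1).resolve_left hf.2.2) hTE)), huC, hCc⟩
    refine (Set.ncard_lt_ncard (t := vertexSpan D) ?_ (Set.toFinite _)).not_ge hle
    have hCD : vertexSpan C ⊆ vertexSpan D := by
      rintro v ⟨f, hf, hv⟩
      rcases hC hf with rfl | h' | h'
      · exact ⟨_, huD, hv⟩
      · exact ⟨f, h'.1, hv⟩
      · exact right_mem_vertexSpan (h'.2.1 v hv)
    refine (Set.ssubset_iff_of_subset hCD).2 ⟨x, hxD, ?_⟩
    · rintro ⟨f, hf, hv⟩
      rcases hC hf with rfl | h' | h'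
      · exact (Sym2.mem_iff.1 hv).elim hxS.1 hxS.2
      · exact h'.2.1 hv
      · exact hNx x (h'.2.1 x hv) rfl
  simp only [Cl, not_forall] at hcl'
  obtain ⟨d, hdk, hduw⟩ := hcl'
  have hshare : ∀ y ∈ nb D x, ∀ z ∈ nb D x, row p s(y, z) d ≠ 0 →
      ∀ e ∈ E, x ∈ vertexSpan (comp p E e) → y ∈ vertexSpan (comp p E e) →
        z ∉ vertexSpan (comp p E e) := by
    intro y hy z hz hr e he hxe hye hze
    refine hr (hdk _ (Or.inr ⟨fun h => ?_, mk_mem_pairs.2 ⟨hy, hz⟩, e, he, hxe,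
      mk_mem_pairs.2 ⟨hye, hze⟩⟩))
    exact hr (row_diag p d h)
  have hkey : ∀ a b c, nb D x = {a, b, c} → a ≠ b → a ≠ c → b ≠ c → row p s(a, b) d ≠ 0 →
      ∃ n₁ n₂ n₃, nb D x = {n₁, n₂, n₃} ∧ n₁ ≠ n₂ ∧ n₁ ≠ n₃ ∧ n₂ ≠ n₃ ∧ row p s(n₁, n₂) d ≠ 0 ∧
        ∀ e ∈ E, x ∈ vertexSpan (comp p E e) → n₁ ∈ vertexSpan (comp p E e) →
          n₂ ∉ vertexSpan (comp p E e) ∧ n₃ ∉ vertexSpan (comp p E e) := by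
    intro a b c hN hab hac hbc hr
    have ha : a ∈ nb D x := hN ▸ by simp
    have hb : b ∈ nb D x := hN ▸ by simp
    by_cases hca : ∃ e ∈ E, x ∈ vertexSpan (comp p E e) ∧ a ∈ vertexSpan (comp p E e) ∧
        c ∈ vertexSpan (comp p E e)
    · obtain ⟨e, he, hxe, hae, hce⟩ := hca
      have hr' : row p s(b, a) d ≠ 0 := by rwa [Sym2.eq_swap]
      refine ⟨b, a, c, by rw [hN, Set.insert_comm], hab.symm, hbc, hac, hr',
        fun f hf hxf hbf => ⟨hshare b hb a ha hr' f hf hxf hbf, fun hcf => ?_⟩⟩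
      have hxc : x ≠ c := (hNx c (hN ▸ by simp)).symm
      have := hp.comp_eq_of_share hE he hf hxc hxe hce hxf hcf
      exact hshare a ha b hb hr e he hxe hae (this ▸ hbf)
    · exact ⟨a, b, c, hN, hab, hac, hbc, hr, fun e he hxe hae =>
        ⟨hshare a ha b hb hr e he hxe hae, fun hce => hca ⟨e, he, hxe, hae, hce⟩⟩⟩
  have hne : ∃ y ∈ nb D x, ∃ z ∈ nb D x, row p s(y, z) d ≠ 0 := by
    by_contra! h
    obtain ⟨ρ, c, ht⟩ := hp.exists_triv h
    refine hduw ?_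
    have hx' : x ∉ s(u, w) := fun h => (Sym2.mem_iff.1 h).elim hxS.1 hxS.2
    have hup : ∀ f, x ∉ f → row p f d = row p f (Function.update d x (triv p ρ c x)) :=
      fun f hf => row_congr p fun v hv =>
        (Function.update_of_ne (fun h => hf (by rwa [← h])) _ _).symm
    rw [hup _ hx']
    refine hD.cl huD _ fun f hf => ?_
    by_cases hxf : x ∈ f
    · obtain ⟨n, rfl⟩ := Sym2.mem_iff_exists.1 hxf
      rw [row_congr (d' := triv p ρ c), row_triv]
      intro v hv
      rcases Sym2.mem_iff.1 hv with rfl | rfl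
      · rw [Function.update_self]
      · rw [Function.update_of_ne (hNx v hf.1), ht v hf.1]
    · rw [← hup f hxf]
      exact hdk f (Or.inl ⟨hf.1, hxf, hf.2⟩)
  obtain ⟨y, hy, z, hz, hr⟩ := hne
  have hyz : y ≠ z := by
    rintro rfl
    exact hr (row_diag p d (Sym2.mk_isDiag_iff.2 rfl))
  obtain ⟨v, hyv, hzv, hN'⟩ := exists_eq_triple hab hac hbc (hN ▸ hy) (hN ▸ hz) hyz
  rw [← hN] at hN'
  obtain ⟨n₁, n₂, n₃, hN₁, h₁₂, h₁₃, h₂₃, hr', hsh⟩ := hkey y z v hN' hyz hyv hzv hr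
  exact ⟨D, x, n₁, n₂, n₃, d, hDE, huD, hD, hxS.1, hxS.2, hN₁, h₁₂, h₁₃, h₂₃,
    fun f hf hxf hfu => hdk f (Or.inl ⟨hf, hxf, hfu⟩), hduw, hr', hsh⟩

/-- A pair in the closure of `E` that lies in no connected component of `E` is not preserved by
some placement with the same edge lengths as a generic one. -/
theorem Generic.exists_flip_of_notMem_plus (hp : Generic p) (hE : ∀ e ∈ E, ¬ e.IsDiag)
    (huw : u ≠ w) (hcl : Cl (row p) E s(u, w)) (hno : s(u, w) ∉ plus p E) :
    ∃ p' q, Generic p' ∧ E ⊆ sameLen p' q ∧ s(u, w) ∉ sameLen p' q := by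
  obtain ⟨D, x, n₁, n₂, n₃, d, hDE, huD, hD, hxu, hxw, hN, h₁₂, h₁₃, h₂₃, hdk, hduw, hρ, hsh⟩ :=
    hp.exists_fold_vertex hE huw hcl hno
  have hdD : ∀ f ∈ D, ¬ f.IsDiag := fun f hf => (hDE hf).elim (fun h => h ▸ huw) fun h => h.1
  have hx' : x ∉ s(u, w) := fun h => (Sym2.mem_iff.1 h).elim hxu hxw
  have hDpl : D \ {s(u, w)} ⊆ plus p E := fun f hf => (hDE hf.1).resolve_left hf.2
  have hDreg : Reg (row p) (D \ {s(u, w)}) := hD.2 _ (Set.sdiff_singleton_ssubset.2 huD)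
  obtain ⟨F, hDF, hFE, hF, hFcl⟩ := exists_basis_superset hDreg hDpl
  let B := F \ (D \ {s(u, w)})
  let D₀ : Set (Sym2 V) := {f | f ∈ D ∧ x ∉ f ∧ f ≠ s(u, w)}
  have hn : ∀ n ∈ nb D x, n ≠ x ∧ n ∈ vertexSpan D ∧ s(x, n) ∈ D \ {s(u, w)} := fun n hn =>
    ⟨fun h => hdD _ hn h.symm, right_mem_vertexSpan hn, hn, fun h => hx' (by
      rw [← Set.mem_singleton_iff.1 h]; simp)⟩
  have hn₁ := hn n₁ (hN ▸ by simp)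
  have hn₂ := hn n₂ (hN ▸ by simp)
  have hn₃ := hn n₃ (hN ▸ by simp)
  have hxD : x ∈ vertexSpan D := left_mem_vertexSpan hn₁.2.2.1
  have huV : u ∈ vertexSpan D := left_mem_vertexSpan huD
  have hwV : w ∈ vertexSpan D := right_mem_vertexSpan huD
  have hD₀ : D₀ ⊆ D \ {s(u, w)} := fun f hf => ⟨hf.1, hf.2.2⟩
  have hsplit : ∀ f ∈ F, f ∈ B ∨ f ∈ D₀ ∨ f = s(x, n₁) ∨ f = s(x, n₂) ∨ f = s(x, n₃) := by
    intro f hf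
    by_cases hfD : f ∈ D \ {s(u, w)}
    · by_cases hxf : x ∈ f
      · obtain ⟨n, rfl⟩ := Sym2.mem_iff_exists.1 hxf
        have : n ∈ nb D x := hfD.1
        rw [hN] at this
        rcases this with rfl | rfl | rfl <;> simp
      · exact Or.inr (Or.inl ⟨hfD.1, hxf, hfD.2⟩)
    · exact Or.inl ⟨hf, hfD⟩
  have hBp : PinSurj p (vertexSpan D) B := fun c => by
    classical
    obtain ⟨d₂, hd₂⟩ := hF fun f => if f ∈ B then c f else 0
    obtain ⟨ρ, c', ht⟩ := hp.rig_triv ((hp.rig_circ hD hdD).trans (F' := D \ {s(u, w)}) fun f hf => by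
      by_cases hfu : f = s(u, w)
      · rw [hfu]
        exact hD.cl huD
      · exact Cl.of_mem ⟨hf, hfu⟩) (d := d₂) fun f hf => by
        rw [hd₂ f (hDF hf), if_neg fun h => h.2 hf]
    refine ⟨d₂ - triv p ρ c', fun v hv => by simp [ht v hv], fun f hf => ?_⟩
    rw [map_sub, row_triv, hd₂ f hf.1, if_pos hf, sub_zero]
  obtain ⟨a₀, ha₀⟩ := hDreg fun f => - row d f d
  obtain ⟨X, Y, a, hX0, hXQ, hcr, hXY, hXY₂, hXY₃, ha₂, ha₃, hne⟩ := exists_fold_point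
    (Q := Set.range fun v => p v - p n₁) (n₂ := p n₂ - p n₁) (n₃ := p n₃ - p n₁)
    (d₂ := d n₂ - d n₁) (d₃ := d n₃ - d n₁) (a₁ := 0) (a₂ := a₀ n₂ - a₀ n₁) (a₃ := a₀ n₃ - a₀ n₁)
    (Set.finite_range _) (hp.cross_ne_zero h₁₂ h₁₃ h₂₃) (by
      rwa [row_mk, ← neg_sub, ← neg_sub (d n₂), ← neg_one_smul ℝ, ip_smul_left,
        ← neg_one_smul ℝ (d n₂ - d n₁), ip_smul_right, ← mul_assoc, neg_one_mul, neg_neg,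
        one_mul] at hρ)
  have hinj : Set.InjOn (Function.update p x (p n₁ + X)) (vertexSpan D) := by
    have hne' : ∀ v, p n₁ + X ≠ p v := fun v h => hX0 (hXQ ⟨v, by simp [← h]⟩)
    intro v _ v' _ h
    by_cases hv : v = x <;> by_cases hv' : v' = x
    · rw [hv, hv']
    · rw [hv, Function.update_self, Function.update_of_ne hv'] at h
      exact absurd h (hne' v')
    · rw [hv', Function.update_self, Function.update_of_ne hv] at h
      exact absurd h.symm (hne' v)
    · rw [Function.update_of_ne hv, Function.update_of_ne hv'] at h
      exact hp.injective h
  obtain ⟨m, hmD, hmB⟩ := hp.pin_transfer (fun f hf => (hFE hf.1).1) hBp hinj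
  have hmx : m x = p n₁ + X := by rw [hmD x hxD, Function.update_self]
  have hm : ∀ v ∈ vertexSpan D, v ≠ x → m v = p v := fun v hv hvx => by
    rw [hmD v hv, Function.update_of_ne hvx]
  obtain ⟨z₀, hz₀, hz₀B⟩ := hmB fun f => - row m f (Function.update d x (d n₁ + Y))
  obtain ⟨δ, hδ⟩ : ∃ δ, δ = Function.update d x (d n₁ + Y) + z₀ := ⟨_, rfl⟩
  have hδx : δ x = d n₁ + Y := by simp [hδ, hz₀ x hxD]
  have hδv : ∀ v ∈ vertexSpan D, v ≠ x → δ v = d v := fun v hv hvx => by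
    simp [hδ, hz₀ v hv, Function.update_of_ne hvx]
  have hδB : ∀ f ∈ B, row m f δ = 0 := fun f hf => by rw [hδ, map_add, hz₀B f hf]; ring
  obtain ⟨α, hα⟩ : ∃ α, α = Function.update a₀ x (a₀ n₁ + a) := ⟨_, rfl⟩
  have hαx : α x = a₀ n₁ + a := by simp [hα]
  have hαv : ∀ v, v ≠ x → α v = a₀ v := fun v hvx => by simp [hα, hvx]
  have hmD₀ : ∀ f, f ∈ D → x ∉ f → ∀ v ∈ f, m v = p v := fun f hf hxf v hv =>
    hm v ⟨f, hf, hv⟩ fun h => hxf (h ▸ hv)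
  have hδD₀ : ∀ f, f ∈ D → x ∉ f → ∀ v ∈ f, δ v = d v := fun f hf hxf v hv =>
    hδv v ⟨f, hf, hv⟩ fun h => hxf (h ▸ hv)
  have hrδ : ∀ f, f ∈ D → x ∉ f → row m f δ = row p f d := fun f hf hxf => by
    rw [row_congr_left δ (hmD₀ f hf hxf), row_congr p (hδD₀ f hf hxf)]
  have hsub : ∀ y y' z : Fin 2 → ℝ, y + z - y' = z - (y' - y) := fun y y' z => by abel
  have hδF : ∀ f ∈ F, row m f δ = 0 := by
    intro f hf
    rcases hsplit f hf with hfB | hfD | rfl | rfl | rfl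
    · exact hδB f hfB
    · rw [hrδ f hfD.1 hfD.2.1, hdk f hfD.1 hfD.2.1 hfD.2.2]
    · rwa [row_mk, hmx, hδx, hm _ hn₁.2.1 hn₁.1, hδv _ hn₁.2.1 hn₁.1, add_sub_cancel_left,
        add_sub_cancel_left]
    · rwa [row_mk, hmx, hδx, hm _ hn₂.2.1 hn₂.1, hδv _ hn₂.2.1 hn₂.1, hsub, hsub]
    · rwa [row_mk, hmx, hδx, hm _ hn₃.2.1 hn₃.1, hδv _ hn₃.2.1 hn₃.1, hsub, hsub]
  have hreg : ∀ N ⊆ nb D x, (∀ c : V → ℝ, ∃ z, ∀ n ∈ N, ip (m x - m n) z = c n) →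
      Reg (row m) (D₀ ∪ {f | ∃ n ∈ N, f = s(x, n)}) := by
    intro N hND hc
    refine pinSurj_empty.1 (PinSurj.of_star (v := x) (Set.notMem_empty x) ?_ fun c => ?_)
    · refine (pinSurj_empty.2 ((hDreg.mono hD₀).mono ?_)).congr fun f hf v hv =>
        (hmD₀ f ?_ hf.2 v hv).symm
      · rintro f ⟨hf | ⟨n, -, rfl⟩, hxf⟩
        · exact hf
        · exact absurd (Sym2.mem_mk_left x n) hxf
      · rcases hf.1 with h | ⟨n, hnN, rfl⟩
        · exact h.1
        · exact hND hnN
    · refine (hc c).imp fun z hz n hn => hz n ?_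
      rcases hn with h | ⟨n', hn', h⟩
      · exact absurd (Sym2.mem_mk_left x n) h.2.1
      · rwa [Sym2.congr_right.1 h]
  have hpos : ∀ n ∈ nb D x, m x - m n = X - (p n - p n₁) := fun n hn' => by
    rw [hmx, hm n (hn n hn').2.1 (hn n hn').1, hsub]
  have hreg₁ := hreg {n₁} (by rw [hN]; simp) fun c => by
    refine ⟨(c n₁ / ip X X) • X, ?_⟩
    rintro n rfl
    rw [hpos n (hN ▸ by simp), sub_self, sub_zero, ip_smul_right,
      div_mul_cancel₀ _ fun h => hX0 (ip_self_eq_zero.1 h)]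
  have hreg₂ := hreg {n₂, n₃} (by rw [hN]; exact Set.subset_insert _ _) fun c => by
    obtain ⟨z, hz₂, hz₃⟩ := exists_ip_eq hcr (c n₂) (c n₃)
    refine ⟨z, ?_⟩
    rintro n (rfl | rfl)
    · rw [hpos n (hN ▸ by simp), hz₂]
    · rw [hpos n (hN ▸ by simp), hz₃]
  have hpairs : ∀ N ⊆ nb D x, D₀ ∪ {f | ∃ n ∈ N, f = s(x, n)} ⊆ pairs (vertexSpan D) := by
    rintro N hND f (hf | ⟨n, hnN, rfl⟩)
    · exact subset_pairs D hf.1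
    · exact mk_mem_pairs.2 ⟨hxD, (hn n (hND hnN)).2.1⟩
  have hregB₁ := hmB.reg_union hreg₁ (hpairs _ (by rw [hN]; simp))
  have hregB₂ := hmB.reg_union hreg₂ (hpairs _ (by rw [hN]; exact Set.subset_insert _ _))
  have hα₀ : ∀ f ∈ D₀ ∪ {f | ∃ n ∈ ({n₂, n₃} : Set V), f = s(x, n)},
      row m f α + row δ f δ = 0 := by
    rintro f (hf | ⟨n, rfl | rfl, rfl⟩)
    · rw [row_congr_left α (hmD₀ f hf.1 hf.2.1), row_congr_left δ (hδD₀ f hf.1 hf.2.1),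
        row_congr d (hδD₀ f hf.1 hf.2.1), row_congr p (d' := a₀) fun v hv => hαv v fun h =>
          hf.2.1 (h ▸ hv), ha₀ f (hD₀ hf)]
      ring
    · rw [row_mk, row_mk, hmx, hδx, hm _ hn₂.2.1 hn₂.1, hδv _ hn₂.2.1 hn₂.1, hαx, hαv _ hn₂.1,
        hsub, hsub, hsub, ha₂]
      ring
    · rw [row_mk, row_mk, hmx, hδx, hm _ hn₃.2.1 hn₃.1, hδv _ hn₃.2.1 hn₃.1, hαx, hαv _ hn₃.1,
        hsub, hsub, hsub, ha₃]
      ring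
  have hne₁ : row m s(x, n₁) α + row δ s(x, n₁) δ ≠ 0 := by
    rwa [row_mk, row_mk, hmx, hδx, hm _ hn₁.2.1 hn₁.1, hδv _ hn₁.2.1 hn₁.1, hαx, hαv _ hn₁.1,
      add_sub_cancel_left, add_sub_cancel_left, add_sub_cancel_left, ← sub_zero a]
  have hsolve : ∀ c : Sym2 V → ℝ, ∃ z : V → Fin 2 → ℝ, ∃ t : ℝ,
      ∀ f ∈ F, row (m - (0 : ℝ) • δ) f z + t * row δ f δ = c f := by
    intro c
    rw [zero_smul, sub_zero]
    obtain ⟨z₁, hz₁⟩ := hreg₂ c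
    let t := (c s(x, n₁) - row m s(x, n₁) z₁) / (row m s(x, n₁) α + row δ s(x, n₁) δ)
    have ht : t * (row m s(x, n₁) α + row δ s(x, n₁) δ) = c s(x, n₁) - row m s(x, n₁) z₁ :=
      div_mul_cancel₀ _ hne₁
    obtain ⟨z₂, hz₂, hz₂B⟩ := hmB fun f => c f - t * row δ f δ - row m f (z₁ + t • α)
    have hD' : ∀ f ∈ pairs (vertexSpan D), row m f z₂ = 0 := fun f hf => by
      rw [row_congr (d' := 0) m fun v hv => hz₂ v (hf v hv), map_zero]
    have hfix : ∀ f ∈ D₀ ∪ {f | ∃ n ∈ ({n₂, n₃} : Set V), f = s(x, n)},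
        row m f (z₁ + t • α + z₂) + t * row δ f δ = c f := fun f hf => by
      rw [map_add, hD' f (hpairs _ (by rw [hN]; exact Set.subset_insert _ _) hf), map_add,
        map_smul, hz₁ f hf, smul_eq_mul]
      linear_combination t * hα₀ f hf
    refine ⟨z₁ + t • α + z₂, t, fun f hf => ?_⟩
    rcases hsplit f hf with hfB | hfD | rfl | rfl | rfl
    · rw [map_add, hz₂B f hfB]
      ring
    · exact hfix f (Or.inl hfD)
    · rw [map_add, hD' _ (subset_pairs D hn₁.2.2.1), map_add, map_smul, smul_eq_mul]
      linear_combination ht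
    · exact hfix _ (Or.inr ⟨n₂, by simp, rfl⟩)
    · exact hfix _ (Or.inr ⟨n₃, by simp, rfl⟩)
  have hcont : Continuous fun y : (V → Fin 2 → ℝ) × (V → Fin 2 → ℝ) × ℝ => row y.1 s(u, w) y.2.1 :=
    (rowBilin s(u, w)).continuous₂.comp (continuous_fst.prodMk (continuous_fst.comp continuous_snd))
  have hU : ∀ᶠ y : (V → Fin 2 → ℝ) × (V → Fin 2 → ℝ) × ℝ in 𝓝 (m, δ, (0 : ℝ)),
      (Reg (row y.1) (B ∪ (D₀ ∪ {f | ∃ n ∈ ({n₁} : Set V), f = s(x, n)})) ∧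
        Reg (row y.1) (B ∪ (D₀ ∪ {f | ∃ n ∈ ({n₂, n₃} : Set V), f = s(x, n)}))) ∧
      row y.1 s(u, w) y.2.1 ≠ 0 := by
    refine Filter.Eventually.and ?_ (hcont.continuousAt.eventually_ne ?_)
    · exact (continuous_fst.tendsto (m, δ, (0 : ℝ))).eventually
        (hregB₁.eventually.and hregB₂.eventually)
    · change row m s(u, w) δ ≠ 0
      rwa [hrδ _ huD hx']
  obtain ⟨x', z, t, ⟨⟨hR₁, hR₂⟩, hx'uw⟩, hgen, hz⟩ := exists_generic_fold hδF hsolve hU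
  refine ⟨x' + t • z, x' - t • z, hgen, fun e he => mem_sameLen_fold.2 (Or.inr ?_), fun h => ?_⟩
  · by_cases heF : e ∈ F
    · exact hz e heF
    obtain ⟨C, hCF, heC, hC⟩ := exists_circ_of_cl (hFcl e (subset_plus hE he)) heF
    obtain ⟨g, hg, hCg⟩ := hp.circ_subset_pairs hE hC (hCF.trans (Set.insert_subset
      (subset_plus hE he) hFE))
    have hCF' : C \ {e} ⊆ F := fun f hf => (hCF hf.1).resolve_left hf.2
    suffices Reg (row x') (C \ {e}) from
      hp.cl_of_reg (hC.cl heC) this z fun f hf => hz f (hCF' hf)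
    by_cases h₁ : s(x, n₁) ∈ C
    · obtain ⟨hxg, hg₁⟩ := mk_mem_pairs.1 (hCg h₁)
      obtain ⟨hg₂, hg₃⟩ := hsh g hg hxg hg₁
      refine hR₁.mono fun f hf => ?_
      rcases hsplit f (hCF' hf) with hfB | hfD | rfl | rfl | rfl
      · exact Or.inl hfB
      · exact Or.inr (Or.inl hfD)
      · exact Or.inr (Or.inr ⟨n₁, rfl, rfl⟩)
      · exact absurd (mk_mem_pairs.1 (hCg hf.1)).2 hg₂
      · exact absurd (mk_mem_pairs.1 (hCg hf.1)).2 hg₃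
    · refine hR₂.mono fun f hf => ?_
      rcases hsplit f (hCF' hf) with hfB | hfD | rfl | rfl | rfl
      · exact Or.inl hfB
      · exact Or.inr (Or.inl hfD)
      · exact absurd hf.1 h₁
      · exact Or.inr (Or.inr ⟨n₂, by simp, rfl⟩)
      · exact Or.inr (Or.inr ⟨n₃, by simp, rfl⟩)
  · refine hx'uw ((mem_sameLen_fold.1 h).resolve_left fun ht => ?_)
    rw [ht, zero_smul, add_zero] at hgen
    exact hx'uw (hp.cl_of_reg ((hD.cl huD).mono hDF) (hgen.reg hF) z hz)

end Fold

section GlobalLink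

variable {V : Type*} [Fintype V] [DecidableEq V] {p p' : V → Fin 2 → ℝ} {E : Set (Sym2 V)}
  {G : SimpleGraph V} {u w : V}

theorem Generic.exists_flip (hp : Generic p) (hE : ∀ e ∈ E, ¬ e.IsDiag) (huw : u ≠ w)
    (h : ∀ e ∈ E, u ∈ vertexSpan (comp p E e) → w ∈ vertexSpan (comp p E e) →
      ¬ Unsep (comp p E e) u w) :
    ∃ p' q, Generic p' ∧ E ⊆ sameLen p' q ∧ s(u, w) ∉ sameLen p' q := by
  by_cases hcl : Cl (row p) E s(u, w)
  · by_cases hpl : s(u, w) ∈ plus p E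
    · obtain ⟨-, e, he, huwe⟩ := hpl
      obtain ⟨hu, hw⟩ := mk_mem_pairs.1 huwe
      have := h e he hu hw
      simp only [Unsep, not_forall, not_or] at this
      obtain ⟨A, s, t, hA, huA, hw'⟩ := this
      exact hp.exists_flip_of_isSep hE he hA huA hw' hu hw
    · exact hp.exists_flip_of_notMem_plus hE huw hcl hpl
  · exact hp.exists_flip_of_not_cl hcl

theorem Generic.comp_eq_comp (hp : Generic p) (hp' : Generic p') (e : Sym2 V) :
    comp p' E e = comp p E e := by
  simp only [comp, CoCirc, ← hp.rdCircuit_iff, ← hp'.rdCircuit_iff]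

theorem Generic.isRdComponent_iff (hp : Generic p) {F : Set (Sym2 V)} :
    IsRdComponent 2 G F ↔ ∃ e ∈ G.edgeSet, F = comp p G.edgeSet e := by
  simp only [IsRdComponent, RdCircuitOf, hp.rdCircuit_iff, comp, CoCirc, and_assoc]

theorem mem_sameLen_mk {q : V → Fin 2 → ℝ} :
    s(u, w) ∈ sameLen p q ↔ eDist (p u) (p w) = eDist (q u) (q w) := by
  rw [eDist_eq_iff]
  rfl

theorem equivalent_iff {q : V → Fin 2 → ℝ} : Equivalent G p q ↔ G.edgeSet ⊆ sameLen p q := by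
  refine ⟨fun h e => ?_, fun h u v huv => mem_sameLen_mk.1 (h huv)⟩
  induction e with
  | _ u v => exact fun huv => mem_sameLen_mk.2 (h u v huv)

theorem edge_not_isDiag (G : SimpleGraph V) : ∀ e ∈ G.edgeSet, ¬ e.IsDiag := fun _ he =>
  G.not_isDiag_of_mem_edgeSet he

/-- Distinct vertices are globally linked exactly when some connected component of the rigidity
matroid spans both and no 2-separator of that component separates them. -/
theorem Generic.globallyLinked_iff (hp : Generic p) (huw : u ≠ w) :
    GloballyLinked 2 G u w ↔ ∃ e ∈ G.edgeSet, u ∈ vertexSpan (comp p G.edgeSet e) ∧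
      w ∈ vertexSpan (comp p G.edgeSet e) ∧ Unsep (comp p G.edgeSet e) u w := by
  refine ⟨fun h => ?_, ?_⟩
  · by_contra! hno
    obtain ⟨p', q, hp', hE, huw'⟩ := hp.exists_flip (edge_not_isDiag G) huw hno
    exact huw' (mem_sameLen_mk.2 (h p' hp' q (equivalent_iff.2 hE)).symm)
  · rintro ⟨e, he, hu, hw, hun⟩ p' hp' q hq
    rw [← hp.comp_eq_comp hp'] at hu hw hun
    have := hp'.closes (L := sameLen p' q) (fun R v a b c hv hR ha hb hc hab hac hbc =>
      hp'.sameLen_of_three hv hR ha hb hc hab hac hbc) ((comp_subset e).trans (equivalent_iff.1 hq))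
      (rconn_class he) (fun f hf => edge_not_isDiag G f hf.1) u hu w hw huw hun
    exact (mem_sameLen_mk.1 this).symm

/-- The pairs spanned and not separated within a connected component. -/
theorem Generic.glc_adj_iff (hp : Generic p) :
    (glc 2 G).Adj u w ↔ u ≠ w ∧ ∃ e ∈ G.edgeSet, u ∈ vertexSpan (comp p G.edgeSet e) ∧
      w ∈ vertexSpan (comp p G.edgeSet e) ∧ Unsep (comp p G.edgeSet e) u w := by
  rw [glc, SimpleGraph.sup_adj, SimpleGraph.fromEdgeSet_adj]
  refine ⟨?_, fun h => Or.inr ⟨⟨u, w, rfl, (hp.globallyLinked_iff h.1).2 h.2⟩, h.1⟩⟩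
  rintro (h | ⟨⟨a, b, hab, h⟩, huw⟩)
  · have := mem_comp_self (p := p) (G.mem_edgeSet.2 h)
    exact ⟨h.ne, _, h, left_mem_vertexSpan this, right_mem_vertexSpan this, unsep_of_mem this⟩
  · refine ⟨huw, ?_⟩
    rcases Sym2.eq_iff.1 hab with ⟨rfl, rfl⟩ | ⟨rfl, rfl⟩
    · exact (hp.globallyLinked_iff huw).1 h
    · obtain ⟨e, he, hu, hw, hun⟩ := (hp.globallyLinked_iff huw.symm).1 h
      exact ⟨e, he, hw, hu, hun.symm⟩

end GlobalLink

section Clique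

variable {V : Type*} {F H : Set (Sym2 V)} {A X : Set V} {s t u w z : V}

/-- Sets of vertices spanned by `F` that are pairwise not separated by 2-separators of `F`. -/
def UClique (F : Set (Sym2 V)) (X : Set V) : Prop :=
  X ⊆ vertexSpan F ∧ ∀ a ∈ X, ∀ b ∈ X, Unsep F a b

theorem UClique.insert (h : UClique F X) (hz : z ∈ vertexSpan F) (hX : ∀ x ∈ X, Unsep F z x) :
    UClique F (insert z X) := by
  refine ⟨Set.insert_subset hz h.1, ?_⟩
  rintro a (rfl | ha) b (rfl | hb)
  · exact unsep_self F _
  · exact hX b hb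
  · exact (hX a ha).symm
  · exact h.2 a ha b hb

theorem exists_isSep_of_maximal (hM : Maximal (UClique F) X) (hz : z ∈ vertexSpan F)
    (hzX : z ∉ X) : ∃ A s t, IsSep F A s t ∧ z ∈ A ∧ (∀ x ∈ X, x ∉ A) ∧ ∃ x ∈ X, x ∈ oside A s t := by
  have : ∃ x ∈ X, ¬ Unsep F z x := by
    by_contra! h
    exact hzX (hM.2 (hM.1.insert hz h) (Set.subset_insert z X) (Set.mem_insert z X))
  obtain ⟨x, hx, h⟩ := this
  simp only [Unsep, not_forall, not_or] at h
  obtain ⟨A, s, t, hA, hzA, hxA⟩ := h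
  exact ⟨A, s, t, hA, hzA, fun y hy hyA => not_or.2 ⟨hxA.1, not_or.2 hxA.2⟩
    (hM.1.2 y hy x hx A s t hA hyA), x, hx, hxA⟩

variable [Fintype V] [DecidableEq V] {p : V → Fin 2 → ℝ}

theorem attached_side (h : IsSep F A s t) : Attached F (side F A s t) {s, t} := by
  have hV : ∀ x ∈ vertexSpan (side F A s t), x ∈ A ∨ x = s ∨ x = t := fun x hx => by
    rw [vertexSpan_side h] at hx
    exact hx.imp_left And.left
  refine ⟨fun x y hxy hx hy => Or.inr ⟨hxy, fun v hv => ?_⟩, fun x y hxy hx hy => ?_, ?_⟩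
  · rcases Sym2.mem_iff.1 hv with rfl | rfl
    exacts [hV _ hx, hV _ hy]
  · refine (hV x hx).resolve_left fun hxA => hy ?_
    rw [vertexSpan_side h]
    exact (h.2.2 x y hxy hxA).imp_left fun hyA => ⟨hyA, right_mem_vertexSpan hxy⟩
  · rintro m (rfl | rfl) n (rfl | rfl) hmn
    exacts [absurd rfl hmn, Or.inl rfl, Or.inl Sym2.eq_swap, absurd rfl hmn]

/-- A vertex outside a maximal unseparated set `X` is cut off from `X` by a 2-separator in `X`. -/
theorem Generic.exists_isSep_of_notMem (hp : Generic p) (hF : Rig p F (vertexSpan F))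
    (hM : Maximal (UClique F) X) (h2 : 2 ≤ X.ncard) (hz : z ∈ vertexSpan F) (hzX : z ∉ X) :
    ∃ A s t, IsSep F A s t ∧ z ∈ A ∧ (∀ x ∈ X, x ∉ A) ∧ (∃ x ∈ X, x ∈ oside A s t) ∧
      s ∈ X ∧ t ∈ X := by
  let fam : Set V → V → V → Prop := fun A s t => IsSep F A s t ∧ z ∈ A ∧ (∀ x ∈ X, x ∉ A) ∧
    ∃ x ∈ X, x ∈ oside A s t
  obtain ⟨A₀, s₀, t₀, h₀⟩ := exists_isSep_of_maximal hM hz hzX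
  obtain ⟨⟨A, s, t⟩, hA, hmax⟩ := Set.exists_max_image
    {T : Set V × V × V | fam T.1 T.2.1 T.2.2} (fun T => T.1.ncard) (Set.toFinite _)
    ⟨(A₀, s₀, t₀), h₀⟩
  suffices key : ∀ s t, fam A s t → s ∈ X by
    refine ⟨A, s, t, hA.1, hA.2.1, hA.2.2.1, hA.2.2.2, key s t hA, key t s
      ⟨hA.1.symm, hA.2.1, hA.2.2.1, hA.2.2.2.imp fun x hx => ⟨hx.1, hx.2.1, hx.2.2.2, hx.2.2.1⟩⟩⟩
  rintro s t ⟨hA, hzA, hXA, x₀, hx₀, hx₀A⟩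
  by_contra hsX
  have hVX : ∀ x ∈ X, x ∈ vertexSpan F := fun x hx => hM.1.1 hx
  obtain ⟨hst, hs, -⟩ := hp.sep_mem hF hA hzA hz hx₀A (hVX x₀ hx₀)
  have hun := hp.noncross hF hA hzA hz hx₀A (hVX x₀ hx₀)
  obtain ⟨A', s', t', hA', hsA', hXA', x₁, hx₁, hx₁A'⟩ := exists_isSep_of_maximal hM hs hsX
  have hun' := hp.noncross hF hA' hsA' hs hx₁A' (hVX x₁ hx₁)
  have hnot : ∀ s' t', IsSep F A' s' t' → Unsep F s' t' → s' ∉ A := by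
    intro s' t' hA' hun' hs'
    have ht' : t' ∈ A ∨ t' = t := by
      rcases hun' A s t hA hs' with h | h | h
      · exact Or.inl h
      · exact absurd (h ▸ hsA') hA'.2.1
      · exact Or.inr h
    obtain ⟨x, hx, hxt⟩ := Set.exists_ne_of_one_lt_ncard h2 t
    have hxs : x ≠ s := fun h => hsX (h ▸ hx)
    have hsep : IsSep F (oside A s t ∩ oside A' s' t') t t := by
      refine ⟨fun h => h.1.2.2 rfl, fun h => h.1.2.2 rfl, fun a b hab ha => ?_⟩
      by_cases hb : b = t
      · exact Or.inr (Or.inl hb)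
      refine Or.inl ?_
      have h1 := hA.compl.2.2 a b hab ha.1
      have h2 := hA'.compl.2.2 a b hab ha.2
      have hbs : b ≠ s := by
        rintro rfl
        rcases h2 with h | h | h
        · exact h.1 hsA'
        · exact hA'.1 (h ▸ hsA')
        · exact hA'.2.1 (h ▸ hsA')
      have hbA : b ∈ oside A s t := h1.resolve_right (by tauto)
      refine ⟨hbA, h2.resolve_right ?_⟩
      rintro (rfl | rfl)
      · exact hbA.1 hs'
      · exact ht'.elim hbA.1 hb
    have hxB : x ∈ oside A s t ∩ oside A' s' t' :=
      ⟨⟨hXA x hx, hxs, hxt⟩, hXA' x hx, fun h => hXA x hx (h ▸ hs'), fun h =>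
        ht'.elim (fun h' => hXA x hx (h ▸ h')) fun h' => hxt (h.trans h')⟩
    rcases hp.sep_one hF hsep with h | h
    · exact h x (hVX x hx) hxB
    · rcases h s hs with h | h
      · exact hst h
      · exact h.1.2.1 rfl
  have hs' := hnot s' t' hA' hun'
  have ht' := hnot t' s' hA'.symm hun'.symm
  have hsep : IsSep F ((A ∪ A') \ {s', t'}) s' t' := by
    refine ⟨fun h => h.2 (by simp), fun h => h.2 (by simp), fun a b hab ha => ?_⟩
    by_cases hb : b = s' ∨ b = t'
    · exact Or.inr hb
    refine Or.inl ⟨?_, hb⟩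
    rcases ha.1 with ha' | ha'
    · rcases hA.2.2 a b hab ha' with h | rfl | rfl
      · exact Or.inl h
      · exact Or.inr hsA'
      · exact Or.inr ((hun A' s' t' hA' hsA').resolve_right hb)
    · exact Or.inr ((hA'.2.2 a b hab ha').resolve_right hb)
  have hss : A ⊆ (A ∪ A') \ {s', t'} := fun a ha => ⟨Or.inl ha, by
    rintro (rfl | rfl)
    exacts [hs' ha, ht' ha]⟩
  have hle := hmax ((A ∪ A') \ {s', t'}, s', t') ⟨hsep, hss hzA, fun x hx h =>
    h.1.elim (hXA x hx) (hXA' x hx), x₁, hx₁, fun h => h.1.elim (hXA x₁ hx₁) hx₁A'.1, hx₁A'.2⟩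
  refine (Set.ncard_lt_ncard (Set.ssubset_iff_of_subset hss |>.2 ⟨s, ⟨Or.inr hsA', ?_⟩, hA.1⟩)
    (Set.toFinite _)).not_ge hle
  rintro (rfl | rfl)
  exacts [hA'.1 hsA', hA'.2.1 hsA']

theorem Generic.four_le_ncard (hp : Generic p) (hF : RConn (row p) F) (hd : ∀ e ∈ F, ¬ e.IsDiag)
    (h2 : 2 ≤ F.ncard) : 4 ≤ (vertexSpan F).ncard := by
  obtain ⟨e, he⟩ := hF.1
  induction e with
  | _ v w =>
  have hv := left_mem_vertexSpan he
  have hn : v ∉ nb F v := fun h => hd _ h rfl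
  calc 4 ≤ (nb F v).ncard + 1 := Nat.succ_le_succ (hp.three_le_nb_rconn hF hd h2 hv)
    _ = (insert v (nb F v)).ncard := (Set.ncard_insert_of_notMem hn).symm
    _ ≤ _ := Set.ncard_le_ncard (Set.insert_subset hv fun n hn => right_mem_vertexSpan hn)

/-- An unseparated pair of a connected set lies in an unseparated quadruple. -/
theorem Generic.exists_uClique (hp : Generic p) (hF : RConn (row p) F) (hd : ∀ e ∈ F, ¬ e.IsDiag)
    (h2 : 2 ≤ F.ncard) (hu : u ∈ vertexSpan F) (hw : w ∈ vertexSpan F) (huw : Unsep F u w) :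
    ∃ X, UClique F X ∧ 4 ≤ X.ncard ∧ u ∈ X ∧ w ∈ X := by
  induction hn : (vertexSpan F).ncard using Nat.strong_induction_on generalizing F with
  | _ n ih =>
  subst hn
  by_cases hsep : ∃ A s t, IsSep F A s t ∧ (∃ a ∈ vertexSpan F, a ∈ A) ∧
      ∃ b ∈ vertexSpan F, b ∈ oside A s t
  swap
  · refine ⟨vertexSpan F, ⟨subset_rfl, fun a ha b hb A s t hA haA => ?_⟩,
      hp.four_le_ncard hF hd h2, hu, hw⟩
    by_contra! hbA
    exact hsep ⟨A, s, t, hA, ⟨a, ha, haA⟩, b, hb, hbA⟩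
  have key : ∀ A s t, IsSep F A s t → (∃ a ∈ vertexSpan F, a ∈ A) →
      (∃ b ∈ vertexSpan F, b ∈ oside A s t) → (u ∈ A ∨ u = s ∨ u = t) → (w ∈ A ∨ w = s ∨ w = t) →
      ∃ X, UClique F X ∧ 4 ≤ X.ncard ∧ u ∈ X ∧ w ∈ X := by
    rintro A s t hA ⟨a, ha, haA⟩ ⟨b, hb, hbA⟩ huA hwA
    have hrig := hp.rig_rconn hF hd
    obtain ⟨hst, hs, ht⟩ := hp.sep_mem hrig hA haA ha hbA hb
    have hun := hp.noncross hrig hA haA ha hbA hb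
    have hV : vertexSpan (side F A s t) ⊆ vertexSpan F := by
      rw [vertexSpan_side hA]
      rintro x (hx | rfl | rfl)
      exacts [hx.2, hs, ht]
    have hlt : vertexSpan (side F A s t) ⊂ vertexSpan F :=
      (Set.ssubset_iff_of_subset hV).2 ⟨b, hb, by
        rw [vertexSpan_side hA]
        rintro (h | h | h)
        exacts [hbA.1 h.1, hbA.2.1 h, hbA.2.2 h]⟩
    have hds : ∀ e ∈ side F A s t, ¬ e.IsDiag := by
      rintro e (rfl | he)
      exacts [hst, hd e he.1]
    have h2s : 2 ≤ (side F A s t).ncard := by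
      have haS : a ∈ vertexSpan (side F A s t) := by
        rw [vertexSpan_side hA]
        exact Or.inl ⟨haA, ha⟩
      obtain ⟨e, he, hae⟩ := haS
      refine (Set.one_lt_ncard (Set.toFinite _)).2 ⟨e, he, s(s, t), Or.inl rfl, ?_⟩
      rintro rfl
      rcases Sym2.mem_iff.1 hae with rfl | rfl
      exacts [hA.1 haA, hA.2.1 haA]
    have hmem : ∀ x ∈ vertexSpan F, (x ∈ A ∨ x = s ∨ x = t) → x ∈ vertexSpan (side F A s t) :=
      fun x hx hxA => by
        rw [vertexSpan_side hA]
        exact hxA.imp_left fun h => ⟨h, hx⟩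
    have hu' := hmem u hu huA
    have hw' := hmem w hw hwA
    obtain ⟨X, hX, h4, huX, hwX⟩ := ih _ (Set.ncard_lt_ncard hlt (Set.toFinite _))
      (hp.side_rconn hF hd hA haA ha hbA hb) hds h2s hu' hw'
      ((attached_side hA).unsep hu' hw' huw) rfl
    refine ⟨X, ⟨hX.1.trans hV, fun x hx y hy A' s' t' hA' hxA' => ?_⟩, h4, huX, hwX⟩
    refine hX.2 x hx y hy A' s' t' ⟨hA'.1, hA'.2.1, fun c d hcd hc => ?_⟩ hxA'
    rcases hcd with hcd | hcd
    · rcases Sym2.eq_iff.1 hcd with ⟨rfl, rfl⟩ | ⟨rfl, rfl⟩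
      exacts [hun A' s' t' hA' hc, hun.symm A' s' t' hA' hc]
    · exact hA'.2.2 c d hcd.1 hc
  obtain ⟨A, s, t, hA, ha, hb⟩ := hsep
  by_cases h : (u ∈ A ∨ u = s ∨ u = t) ∧ (w ∈ A ∨ w = s ∨ w = t)
  · exact key A s t hA ha hb h.1 h.2
  have huA := huw A s t hA
  have hwA := huw.symm A s t hA
  refine key (oside A s t) s t hA.compl hb (by rwa [hA.oside_oside]) ?_ ?_ <;>
    simp only [oside, Set.mem_ofPred_eq] <;> tauto

end Clique

section Blocks

theorem reachable_iff_closed {W : Type*} {K : SimpleGraph W} {x y : W} :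
    K.Reachable x y ↔ ∀ S : Set W, x ∈ S → (∀ a ∈ S, ∀ b, K.Adj a b → b ∈ S) → y ∈ S := by
  refine ⟨?_, fun h => h {z | K.Reachable x z} (SimpleGraph.Reachable.refl x)
    fun a ha b hab => SimpleGraph.Reachable.trans ha hab.reachable⟩
  rintro ⟨P⟩ S hx hS
  induction P with
  | nil => exact hx
  | cons hab _ ih => exact ih (hS _ hx _ hab)

theorem ncard_pair_le {V : Type*} (a b : V) : ({a, b} : Set V).ncard ≤ 2 :=
  (Set.ncard_insert_le a {b}).trans (by simp)

theorem exists_pair_of_ncard_lt_three {V : Type*} [Fintype V] {S : Set V} {x y : V}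
    (hV : 3 ≤ (Set.univ : Set V).ncard) (hS : S.ncard < 3) (hx : x ∉ S) (hy : y ∉ S) :
    ∃ s t, S ⊆ {s, t} ∧ x ≠ s ∧ x ≠ t ∧ y ≠ s ∧ y ≠ t := by
  classical
  obtain ⟨z, -, hz⟩ := Set.exists_mem_notMem_of_ncard_lt_ncard
    ((ncard_pair_le x y).trans_lt hV)
  simp only [Set.mem_insert_iff, Set.mem_singleton_iff, not_or] at hz
  interval_cases h : S.ncard
  · rw [Set.ncard_eq_zero] at h
    exact ⟨z, z, by simp [h], Ne.symm hz.1, Ne.symm hz.1, Ne.symm hz.2, Ne.symm hz.2⟩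
  · obtain ⟨a, rfl⟩ := Set.ncard_eq_one.1 h
    exact ⟨a, a, by simp, hx, hx, hy, hy⟩
  · obtain ⟨a, b, -, rfl⟩ := Set.ncard_eq_two.1 h
    simp only [Set.mem_insert_iff, Set.mem_singleton_iff, not_or] at hx hy
    exact ⟨a, b, subset_rfl, hx.1, hx.2, hy.1, hy.2⟩

variable {V : Type*} {F : Set (Sym2 V)} {A X : Set V} {s t u w : V}

/-- Adjacency, on the vertices of `F`, in the graph augmented by all 2-separators. -/
def Link (F : Set (Sym2 V)) (u w : V) : Prop :=
  u ≠ w ∧ (s(u, w) ∈ F ∨ ∃ A, IsSep F A u w ∧ (∃ a ∈ vertexSpan F, a ∈ A) ∧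
    ∃ b ∈ vertexSpan F, b ∈ oside A u w)

theorem Link.symm (h : Link F u w) : Link F w u := by
  refine ⟨h.1.symm, h.2.imp (fun h => Sym2.eq_swap ▸ h) ?_⟩
  rintro ⟨A, hA, ha, b, hb, h1, h2, h3⟩
  exact ⟨A, hA.symm, ha, b, hb, h1, h3, h2⟩

variable [Fintype V] [DecidableEq V] {p : V → Fin 2 → ℝ}

theorem Generic.unsep_of_link (hp : Generic p) (hF : Rig p F (vertexSpan F)) (h : Link F u w) :
    Unsep F u w := by
  rcases h.2 with h | ⟨A, hA, ⟨a, ha, haA⟩, b, hb, hbA⟩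
  · exact unsep_of_mem h
  · exact hp.noncross hF hA haA ha hbA hb

theorem twoSepPair_iff (hd : ∀ e ∈ F, ¬ e.IsDiag) (h4 : 4 ≤ (vertexSpan F).ncard)
    {a b : vertexSpan F} : TwoSepPair (componentGraph F) s(a, b) ↔
      a ≠ b ∧ ∃ A, IsSep F A a b ∧ (∃ x ∈ vertexSpan F, x ∈ A) ∧
        ∃ y ∈ vertexSpan F, y ∈ oside A a b := by
  refine and_congr (by simp) ⟨fun h => ?_, ?_⟩
  · have hne : Nonempty {v | v ∉ s(a, b)} := by
      obtain ⟨z, hz, hz'⟩ := Set.exists_mem_notMem_of_ncard_lt_ncard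
        (((ncard_pair_le a.1 b.1).trans_lt (by norm_num)).trans_le h4)
      refine ⟨⟨z, hz⟩, fun h => hz' ?_⟩
      rcases Sym2.mem_iff.1 h with rfl | rfl <;> simp
    have : ∃ x y, ¬ ((componentGraph F).induce {v | v ∉ s(a, b)}).Reachable x y := by
      by_contra! h'
      exact h ⟨h'⟩
    obtain ⟨x, y, hxy⟩ := this
    rw [reachable_iff_closed] at hxy
    push Not at hxy
    obtain ⟨S, hx, hS, hy⟩ := hxy
    have hmem : ∀ v : {v | v ∉ s(a, b)}, v.1.1 ≠ a ∧ v.1.1 ≠ b := fun v => by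
      have := v.2
      simp only [Set.mem_ofPred_eq, Sym2.mem_iff, not_or] at this
      exact ⟨fun h => this.1 (Subtype.ext h), fun h => this.2 (Subtype.ext h)⟩
    refine ⟨{v | ∃ z ∈ S, z.1.1 = v}, ⟨?_, ?_, ?_⟩, ⟨x.1, x.1.2, x, hx, rfl⟩, y.1, y.1.2, ?_,
      hmem y⟩
    · rintro ⟨z, -, hz⟩
      exact (hmem z).1 hz
    · rintro ⟨z, -, hz⟩
      exact (hmem z).2 hz
    · rintro _ v hv ⟨z, hz, rfl⟩
      by_cases h : v = a ∨ v = b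
      · exact Or.inr h
      have hv' : (⟨v, right_mem_vertexSpan hv⟩ : vertexSpan F) ∉ s(a, b) := fun h' => h <|
        (Sym2.mem_iff.1 h').imp (congrArg Subtype.val) (congrArg Subtype.val)
      refine Or.inl ⟨⟨⟨v, right_mem_vertexSpan hv⟩, hv'⟩, hS z hz _ ?_, rfl⟩
      exact ⟨hv, hd _ hv⟩
    · rintro ⟨z, hz, hzy⟩
      exact hy (Subtype.ext (Subtype.ext hzy) ▸ hz)
  · rintro ⟨A, hA, ⟨x, hx, hxA⟩, y, hy, hyA⟩ h
    have hx' : (⟨x, hx⟩ : vertexSpan F) ∉ s(a, b) := fun h => by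
      rcases Sym2.mem_iff.1 h with h | h
      exacts [hA.1 (h ▸ hxA), hA.2.1 (h ▸ hxA)]
    have hy' : (⟨y, hy⟩ : vertexSpan F) ∉ s(a, b) := fun h => by
      rcases Sym2.mem_iff.1 h with h | h
      exacts [hyA.2.1 (congrArg Subtype.val h), hyA.2.2 (congrArg Subtype.val h)]
    refine hyA.1 (reachable_iff_closed.1 (h.preconnected ⟨_, hx'⟩ ⟨_, hy'⟩) {v | v.1.1 ∈ A} hxA ?_)
    rintro v hv z ⟨hvz, -⟩
    have hz := z.2
    simp only [Set.mem_ofPred_eq, Sym2.mem_iff, not_or] at hz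
    exact (hA.2.2 _ _ hvz hv).resolve_right fun h' =>
      h'.elim (fun h => hz.1 (Subtype.ext h)) fun h => hz.2 (Subtype.ext h)

theorem aug_adj_iff (hd : ∀ e ∈ F, ¬ e.IsDiag) (h4 : 4 ≤ (vertexSpan F).ncard)
    {a b : vertexSpan F} : (aug (componentGraph F)).Adj a b ↔ Link F a b := by
  have h1 : (componentGraph F).Adj a b ↔ s(a.1, b.1) ∈ F ∧ a.1 ≠ b.1 := Iff.rfl
  have h2 : (aug (componentGraph F)).Adj a b ↔ (componentGraph F).Adj a b ∨
      TwoSepPair (componentGraph F) s(a, b) ∧ a ≠ b := Iff.rfl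
  rw [h2, h1, twoSepPair_iff hd h4, Link, ← Subtype.coe_ne_coe]
  tauto

theorem Generic.uClique_of_threeConnected (hp : Generic p) (hF : RConn (row p) F)
    (hd : ∀ e ∈ F, ¬ e.IsDiag) (h2 : 2 ≤ F.ncard) {J : (aug (componentGraph F)).Subgraph}
    (hJ : IsThreeConnectedSubgraph J) : UClique F (Subtype.val '' J.verts) := by
  refine ⟨by rintro _ ⟨a, -, rfl⟩; exact a.2, ?_⟩
  rintro _ ⟨a, ha, rfl⟩ _ ⟨b, hb, rfl⟩ A s t hA haA
  by_contra! hbA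
  let S : Set (vertexSpan F) := {v | v.1 = s ∨ v.1 = t}
  have hS : S.ncard < 3 := by
    rw [← Set.ncard_image_of_injective S Subtype.val_injective]
    refine (Set.ncard_le_ncard (t := {s, t}) ?_).trans_lt ((ncard_pair_le s t).trans_lt (by norm_num))
    rintro _ ⟨v, hv, rfl⟩
    exact hv
  have ha' : a ∈ (J.deleteVerts S).verts := ⟨ha, fun h =>
    h.elim (fun h => hA.1 (h ▸ haA)) fun h => hA.2.1 (h ▸ haA)⟩
  have hb' : b ∈ (J.deleteVerts S).verts := ⟨hb, fun h => h.elim hbA.2.1 hbA.2.2⟩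
  refine hbA.1 (reachable_iff_closed.1 ((hJ.2 S hS).preconnected ⟨a, ha'⟩ ⟨b, hb'⟩)
    {v | v.1.1 ∈ A} haA fun v hv z hvz => ?_)
  have hlink := (aug_adj_iff hd (hp.four_le_ncard hF hd h2)).1
    ((J.deleteVerts S).adj_sub hvz)
  exact (hp.unsep_of_link (hp.rig_rconn hF hd) hlink A s t hA hv).resolve_right z.2.2

/-- Deleting at most two vertices does not disconnect the augmented graph on `X`. -/
theorem Generic.mem_of_link_closed (hp : Generic p) (hF : Rig p F (vertexSpan F))
    (hd : ∀ e ∈ F, ¬ e.IsDiag) (hM : Maximal (UClique F) X) (h2 : 2 ≤ X.ncard) {T : Set V} {x y : V}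
    (hTX : T ⊆ X) (hT : ∀ a ∈ T, ∀ b ∈ X, b ≠ s → b ≠ t → Link F a b → b ∈ T) (hx : x ∈ T)
    (hxs : x ≠ s) (hxt : x ≠ t) (hy : y ∈ X) (hys : y ≠ s) (hyt : y ≠ t) : y ∈ T := by
  let B : Set V := {v | v ≠ s ∧ v ≠ t ∧ (v ∈ T ∨ v ∉ X ∧ ∃ A a b, IsSep F A a b ∧ v ∈ A ∧
    (∀ x ∈ X, x ∉ A) ∧ (∃ x ∈ X, x ∈ oside A a b) ∧ a ∈ X ∧ b ∈ X ∧ (a ∈ T ∨ b ∈ T))}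
  have hB : IsSep F B s t := by
    refine ⟨fun h => h.1 rfl, fun h => h.2.1 rfl, fun c d hcd hc => ?_⟩
    by_cases hst : d = s ∨ d = t
    · exact Or.inr hst
    push Not at hst
    refine Or.inl ⟨hst.1, hst.2, ?_⟩
    rcases hc.2.2 with hc | ⟨hcX, A, a, b, hA, hcA, hXA, ⟨x, hxX, hxA⟩, ha, hb, hab⟩
    · by_cases hdX : d ∈ X
      · exact Or.inl (hT c hc d hdX hst.1 hst.2 ⟨hd _ hcd, Or.inl hcd⟩)
      obtain ⟨A, a, b, hA, hdA, hXA, hx, ha, hb⟩ :=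
        hp.exists_isSep_of_notMem hF hM h2 (right_mem_vertexSpan hcd) hdX
      refine Or.inr ⟨hdX, A, a, b, hA, hdA, hXA, hx, ha, hb, ?_⟩
      rcases hA.2.2 d c (Sym2.eq_swap ▸ hcd) hdA with h | rfl | rfl
      exacts [absurd h (hXA c (hTX hc)), Or.inl hc, Or.inr hc]
    · have hcF := left_mem_vertexSpan hcd
      have hlink : Link F a b := ⟨(hp.sep_mem hF hA hcA hcF hxA (hM.1.1 hxX)).1,
        Or.inr ⟨A, hA, ⟨c, hcF, hcA⟩, x, hM.1.1 hxX, hxA⟩⟩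
      rcases hA.2.2 c d hcd hcA with hdA | rfl | rfl
      · exact Or.inr ⟨fun h => hXA d h hdA, A, a, b, hA, hdA, hXA, ⟨x, hxX, hxA⟩, ha, hb, hab⟩
      · exact Or.inl (hab.elim id fun h => hT b h d ha hst.1 hst.2 hlink.symm)
      · exact Or.inl (hab.elim (fun h => hT a h d hb hst.1 hst.2 hlink) id)
  have := (hM.1.2 x (hTX hx) y hy B s t hB ⟨hxs, hxt, Or.inl hx⟩).resolve_right (by tauto)
  exact this.2.2.resolve_right fun h => h.1 hy

/-- The subgraph of the augmented graph induced by `X`. -/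
def augInduce (F : Set (Sym2 V)) (X : Set V) : (aug (componentGraph F)).Subgraph :=
  (⊤ : (aug (componentGraph F)).Subgraph).induce {v | v.1 ∈ X}

theorem image_augInduce (hX : X ⊆ vertexSpan F) : Subtype.val '' (augInduce F X).verts = X := by
  ext v
  refine ⟨?_, fun hv => ⟨⟨v, hX hv⟩, hv, rfl⟩⟩
  rintro ⟨v, hv, rfl⟩
  exact hv

theorem le_augInduce {J : (aug (componentGraph F)).Subgraph} (hJ : Subtype.val '' J.verts ⊆ X) :
    J ≤ augInduce F X :=
  ⟨fun v hv => hJ ⟨v, hv, rfl⟩, fun v w h =>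
    ⟨hJ ⟨v, h.fst_mem, rfl⟩, hJ ⟨w, h.snd_mem, rfl⟩, h.adj_sub⟩⟩

theorem Generic.threeConnected_augInduce (hp : Generic p) (hF : RConn (row p) F)
    (hd : ∀ e ∈ F, ¬ e.IsDiag) (h2 : 2 ≤ F.ncard) (hM : Maximal (UClique F) X) (h4 : 4 ≤ X.ncard) :
    IsThreeConnectedSubgraph (augInduce F X) := by
  have h4V := hp.four_le_ncard hF hd h2
  have hcard : (augInduce F X).verts.ncard = X.ncard := by
    rw [← Set.ncard_image_of_injective _ Subtype.val_injective, image_augInduce hM.1.1]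
  refine ⟨by rwa [hcard], fun S hS => ?_⟩
  have hne : Nonempty ((augInduce F X).deleteVerts S).verts := by
    obtain ⟨z, hz, hzS⟩ := Set.exists_mem_notMem_of_ncard_lt_ncard
      (show S.ncard < (augInduce F X).verts.ncard by omega)
    exact ⟨z, hz, hzS⟩
  refine ⟨fun x y => reachable_iff_closed.2 fun T hx hT => ?_⟩
  have hval : ∀ v : ((augInduce F X).deleteVerts S).verts, v.1.1 ∉ Subtype.val '' S := by
    rintro v ⟨z, hz, hzv⟩
    exact v.2.2 (Subtype.ext hzv ▸ hz)
  obtain ⟨s, t, hst, hxs, hxt, hys, hyt⟩ := exists_pair_of_ncard_lt_three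
    ((by omega : 3 ≤ (vertexSpan F).ncard).trans (Set.ncard_le_ncard (Set.subset_univ _)))
    (by rwa [Set.ncard_image_of_injective _ Subtype.val_injective]) (hval x) (hval y)
  suffices h : y.1.1 ∈ {v | (∃ z ∈ T, z.1.1 = v) ∧ v ≠ s ∧ v ≠ t} by
    obtain ⟨⟨z, hz, hzy⟩, -⟩ := h
    exact Subtype.ext (Subtype.ext hzy) ▸ hz
  refine hp.mem_of_link_closed (hp.rig_rconn hF hd) hd hM (by omega) ?_ ?_
    ⟨⟨x, hx, rfl⟩, hxs, hxt⟩ hxs hxt y.2.1 hys hyt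
  · rintro _ ⟨⟨z, -, rfl⟩, -⟩
    exact z.2.1
  · rintro _ ⟨⟨z, hz, rfl⟩, -⟩ b hb hbs hbt hlink
    have hbS : (⟨b, hM.1.1 hb⟩ : vertexSpan F) ∉ S := fun h => by
      rcases hst ⟨_, h, rfl⟩ with h | h
      exacts [hbs h, hbt h]
    refine ⟨⟨⟨⟨b, hM.1.1 hb⟩, hb, hbS⟩, hT z hz _ ?_, rfl⟩, hbs, hbt⟩
    have := (aug_adj_iff hd h4V (a := z.1) (b := ⟨b, hM.1.1 hb⟩)).2 hlink
    exact ⟨z.2, ⟨hb, hbS⟩, z.2.1, hb, this⟩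

/-- The vertex sets of the 3-blocks are the maximal unseparated sets of size at least four. -/
theorem Generic.exists_isThreeBlock_iff (hp : Generic p) (hF : RConn (row p) F)
    (hd : ∀ e ∈ F, ¬ e.IsDiag) (h2 : 2 ≤ F.ncard) :
    (∃ J, IsThreeBlock (componentGraph F) J ∧ X = Subtype.val '' J.verts) ↔
      Maximal (UClique F) X ∧ 4 ≤ X.ncard := by
  refine ⟨?_, fun ⟨hM, h4⟩ => ⟨augInduce F X,
    ⟨hp.threeConnected_augInduce hF hd h2 hM h4, fun J' hJ' hle => ?_⟩,
    (image_augInduce hM.1.1).symm⟩⟩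
  · rintro ⟨J, ⟨hJ, hmax⟩, rfl⟩
    have hX := hp.uClique_of_threeConnected hF hd h2 hJ
    have h4 : 4 ≤ (Subtype.val '' J.verts).ncard := by
      rw [Set.ncard_image_of_injective _ Subtype.val_injective]
      exact hJ.1
    obtain ⟨Y, hXY, hY⟩ := Set.Finite.exists_le_maximal (Set.toFinite {Y | UClique F Y}) hX
    have := hmax _ (hp.threeConnected_augInduce hF hd h2 hY
      (h4.trans (Set.ncard_le_ncard hXY))) (le_augInduce hXY)
    refine ⟨?_, h4⟩
    rw [this, image_augInduce hY.1.1]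
    exact hY
  · refine hle.antisymm (le_augInduce ?_)
    refine hM.2 (hp.uClique_of_threeConnected hF hd h2 hJ') ?_
    rw [← image_augInduce hM.1.1]
    exact Set.image_mono hle.1

end Blocks

section Clusters

variable {V : Type*} [Fintype V] [DecidableEq V] {p : V → Fin 2 → ℝ} {E : Set (Sym2 V)}
  {G : SimpleGraph V} {X : Set V}

theorem two_le_ncard_of_subset {F : Set (Sym2 V)} (hX : X ⊆ vertexSpan F) (h : 3 ≤ X.ncard) :
    2 ≤ F.ncard := by
  replace h := h.trans (Set.ncard_le_ncard hX)
  by_contra! hF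
  have hsub : ∀ e ∈ F, ∀ f ∈ F, e = f := (Set.ncard_le_one (Set.toFinite F)).1 (by omega)
  obtain ⟨v, e, he, -⟩ := (Set.ncard_pos (Set.toFinite _)).1 (by omega : 0 < (vertexSpan F).ncard)
  induction e with
  | _ a b =>
  have : vertexSpan F ⊆ {a, b} := by
    rintro x ⟨f, hf, hx⟩
    exact Sym2.mem_iff.1 (hsub f hf _ he ▸ hx)
  have := (Set.ncard_le_ncard this).trans (ncard_pair_le a b)
  omega

theorem Generic.exists_comp_of_quad (hp : Generic p) (hE : ∀ e ∈ E, ¬ e.IsDiag) {Q : Set V}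
    (h4 : Q.ncard = 4) (hQ : ∀ x ∈ Q, ∀ y ∈ Q, x ≠ y → s(x, y) ∈ plus p E) :
    ∃ e ∈ E, Q ⊆ vertexSpan (comp p E e) := by
  let K : Set (Sym2 V) := {f | ¬ f.IsDiag ∧ f ∈ pairs Q}
  have hK : ∀ x ∈ Q, ∀ y ∈ Q, x ≠ y → s(x, y) ∈ K := fun x hx y hy hxy =>
    ⟨by simpa using hxy, mk_mem_pairs.2 ⟨hx, hy⟩⟩
  have hKE : K ⊆ plus p E := fun f hf => by
    induction f with
    | _ x y =>
    obtain ⟨hxy, h⟩ := hf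
    rw [mk_mem_pairs] at h
    exact hQ x h.1 y h.2 (by simpa using hxy)
  have hC : ∃ C ⊆ K, Circ (row p) C := by
    obtain ⟨a, T, haT, rfl, hT⟩ := Set.eq_insert_of_ncard_eq_succ h4
    obtain ⟨b, c, d, hbc, hbd, hcd, rfl⟩ := Set.ncard_eq_three.1 hT
    simp only [Set.mem_insert_iff, Set.mem_singleton_iff, not_or] at haT
    have hcl : ∀ x ∈ ({a, b, c, d} : Set V), ∀ y ∈ ({a, b, c, d} : Set V), x ≠ y →
        s(x, y) ≠ s(a, b) → Cl (row p) (K \ {s(a, b)}) s(x, y) := fun x hx y hy hxy hne =>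
      Cl.of_mem ⟨hK x hx y hy hxy, hne⟩
    have hacd : Rig p (K \ {s(a, b)}) {a, c, d} := by
      refine rig_triple (hcl _ ?_ _ ?_ ?_ ?_) (hcl _ ?_ _ ?_ ?_ ?_) (hcl _ ?_ _ ?_ ?_ ?_) <;>
        simp [*] <;> grind
    have hbcd : Rig p (K \ {s(a, b)}) {b, c, d} := by
      refine rig_triple (hcl _ ?_ _ ?_ ?_ ?_) (hcl _ ?_ _ ?_ ?_ ?_) (hcl _ ?_ _ ?_ ?_ ?_) <;>
        simp [*] <;> grind
    have hab := hp.rig_union hacd hbcd hcd (by simp) (by simp) (by simp) (by simp) a (by simp)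
      b (by simp)
    obtain ⟨C, hCK, -, hC⟩ := exists_circ_of_cl hab (by simp)
    refine ⟨C, hCK.trans (Set.insert_subset (hK a (by simp) b (by simp) haT.1) Set.sdiff_subset), hC⟩
  obtain ⟨C, hCK, hC⟩ := hC
  have hd : ∀ f ∈ C, ¬ f.IsDiag := fun f hf => (hCK hf).1
  have hCQ : vertexSpan C = Q := by
    refine Set.eq_of_subset_of_ncard_le ?_ ?_ (Set.toFinite Q)
    · rintro v ⟨f, hf, hv⟩
      exact (hCK hf).2 v hv
    · rw [h4]
      exact hp.four_le_ncard hC.rconn hd (hp.two_le_ncard hC hd)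
  obtain ⟨e, he, hCe⟩ := hp.circ_subset_pairs hE hC (hCK.trans hKE)
  refine ⟨e, he, ?_⟩
  rw [← hCQ]
  rintro v ⟨f, hf, hv⟩
  exact hCe hf v hv

theorem Generic.exists_comp_of_clique (hp : Generic p) (hE : ∀ e ∈ E, ¬ e.IsDiag)
    (h4 : 4 ≤ X.ncard) (hX : ∀ x ∈ X, ∀ y ∈ X, x ≠ y → s(x, y) ∈ plus p E) :
    ∃ e ∈ E, X ⊆ vertexSpan (comp p E e) := by
  obtain ⟨Q, hQX, hQ⟩ := Set.exists_subset_card_eq h4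
  have hsub : ∀ Q ⊆ X, Q.ncard = 4 → ∃ e ∈ E, Q ⊆ vertexSpan (comp p E e) := fun Q hQX hQ =>
    hp.exists_comp_of_quad hE hQ fun x hx y hy => hX x (hQX hx) y (hQX hy)
  obtain ⟨e, he, hQe⟩ := hsub Q hQX hQ
  refine ⟨e, he, fun x hx => ?_⟩
  by_cases hxQ : x ∈ Q
  · exact hQe hxQ
  obtain ⟨T, hTQ, hT⟩ := Set.exists_subset_card_eq (by omega : 3 ≤ Q.ncard)
  obtain ⟨f, hf, hTf⟩ := hsub (insert x T) (Set.insert_subset hx (hTQ.trans hQX))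
    (by rw [Set.ncard_insert_of_notMem fun h => hxQ (hTQ h), hT])
  obtain ⟨a, ha, b, hb, hab⟩ := (Set.one_lt_ncard (Set.toFinite T)).1 (by omega)
  rw [hp.comp_eq_of_share hE he hf hab (hQe (hTQ ha)) (hQe (hTQ hb)) (hTf (Or.inr ha))
    (hTf (Or.inr hb))]
  exact hTf (Or.inl rfl)

/-- Large cliques of the globally linked closure are the unseparated sets of components. -/
theorem Generic.clique_iff (hp : Generic p) (h4 : 4 ≤ X.ncard) :
    (∀ a ∈ X, ∀ b ∈ X, a ≠ b → (glc 2 G).Adj a b) ↔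
      ∃ e ∈ G.edgeSet, UClique (comp p G.edgeSet e) X := by
  have hE := edge_not_isDiag G
  refine ⟨fun h => ?_, fun ⟨e, he, hX⟩ a ha b hb hab => hp.glc_adj_iff.2
    ⟨hab, e, he, hX.1 ha, hX.1 hb, hX.2 a ha b hb⟩⟩
  obtain ⟨e, he, hXe⟩ := hp.exists_comp_of_clique hE h4 fun a ha b hb hab => by
    obtain ⟨-, e, he, hae, hbe, -⟩ := hp.glc_adj_iff.1 (h a ha b hb hab)
    exact ⟨by simpa using hab, e, he, mk_mem_pairs.2 ⟨hae, hbe⟩⟩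
  refine ⟨e, he, hXe, fun a ha b hb => ?_⟩
  by_cases hab : a = b
  · exact hab ▸ unsep_self _ a
  obtain ⟨-, f, hf, haf, hbf, hun⟩ := hp.glc_adj_iff.1 (h a ha b hb hab)
  rwa [hp.comp_eq_of_share hE he hf hab (hXe ha) (hXe hb) haf hbf]

theorem Generic.isCluster_iff (hp : Generic p) (h4 : 4 ≤ X.ncard) :
    IsCluster 2 G X ↔ ∃ e ∈ G.edgeSet, Maximal (UClique (comp p G.edgeSet e)) X := by
  have h4' : ∀ Y, X ⊆ Y → 4 ≤ Y.ncard := fun Y hY => h4.trans (Set.ncard_le_ncard hY)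
  constructor
  · rintro ⟨h, hmax⟩
    obtain ⟨e, he, hX⟩ := (hp.clique_iff h4).1 h
    exact ⟨e, he, hX, fun Y hY hXY => (hmax Y hXY ((hp.clique_iff (h4' Y hXY)).2 ⟨e, he, hY⟩)).le⟩
  · rintro ⟨e, he, hX⟩
    refine ⟨(hp.clique_iff h4).2 ⟨e, he, hX.1⟩, fun Y hXY hY => ?_⟩
    obtain ⟨f, hf, hYf⟩ := (hp.clique_iff (h4' Y hXY)).1 hY
    obtain ⟨a, ha, b, hb, hab⟩ := (Set.one_lt_ncard (Set.toFinite X)).1 (by omega)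
    have := hp.comp_eq_of_share (edge_not_isDiag G) he hf hab (hX.1.1 ha) (hX.1.1 hb)
      (hYf.1 (hXY ha)) (hYf.1 (hXY hb))
    rw [← this] at hYf
    exact (hX.2 hYf hXY).antisymm hXY

theorem Generic.isCluster_iff_isRdBlockVerts (hp : Generic p) :
    IsCluster 2 G X ∧ 4 ≤ X.ncard ↔ IsRdBlockVerts 2 G X := by
  have hE : ∀ e, ∀ f ∈ comp p G.edgeSet e, ¬ f.IsDiag := fun e f hf => edge_not_isDiag G f hf.1
  simp only [IsRdBlockVerts, hp.isRdComponent_iff]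
  constructor
  · rintro ⟨h, h4⟩
    obtain ⟨e, he, hX⟩ := (hp.isCluster_iff h4).1 h
    have h2 := two_le_ncard_of_subset hX.1.1 (by omega)
    exact ⟨_, ⟨e, he, rfl⟩, h2,
      (hp.exists_isThreeBlock_iff (rconn_class he) (hE e) h2).2 ⟨hX, h4⟩⟩
  · rintro ⟨_, ⟨e, he, rfl⟩, h2, h⟩
    obtain ⟨hX, h4⟩ := (hp.exists_isThreeBlock_iff (rconn_class he) (hE e) h2).1 h
    exact ⟨(hp.isCluster_iff h4).2 ⟨e, he, hX⟩, h4⟩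

theorem Generic.exists_isCluster_iff (hp : Generic p) {u w : V} (huw : (glc 2 G).Adj u w) :
    (∃ X, IsCluster 2 G X ∧ 4 ≤ X.ncard ∧ u ∈ X ∧ w ∈ X) ↔ ¬ IsRdBridge 2 G s(u, w) := by
  have hE := edge_not_isDiag G
  rw [hp.isRdBridge_iff]
  constructor
  · rintro ⟨X, hX, h4, hu, hw⟩ ⟨hG, hcl⟩
    obtain ⟨e, he, hXe⟩ := (hp.isCluster_iff h4).1 hX
    have hmem := hp.mem_comp_of_pairs hE he hG (mk_mem_pairs.2 ⟨hXe.1.1 hu, hXe.1.1 hw⟩)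
    have h2 := two_le_ncard_of_subset hXe.1.1 (by omega)
    exact hcl (((rconn_class he).cl h2 hmem).mono (Set.sdiff_subset_sdiff_left (comp_subset e)))
  · intro hb
    obtain ⟨hne, e, he, hu, hw, hun⟩ := hp.glc_adj_iff.1 huw
    have h2 : 2 ≤ (comp p G.edgeSet e).ncard := by
      by_contra! h2
      have hsub : ∀ f ∈ comp p G.edgeSet e, ∀ g ∈ comp p G.edgeSet e, f = g :=
        (Set.ncard_le_one (Set.toFinite _)).1 (by omega)
      have hee := mem_comp_self (p := p) he
      obtain ⟨f, hf, huf⟩ := hu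
      obtain ⟨g, hg, hwg⟩ := hw
      have heq : e = s(u, w) := (Sym2.mem_and_mem_iff hne).1
        ⟨hsub f hf e hee ▸ huf, hsub g hg e hee ▸ hwg⟩
      subst heq
      have hcl : Cl (row p) (G.edgeSet \ {s(u, w)}) s(u, w) := by
        by_contra h
        exact hb ⟨he, h⟩
      obtain ⟨C, hCE, heC, hC⟩ := exists_circ_of_cl hcl (by simp)
      rw [Set.insert_sdiff_singleton, Set.insert_eq_of_mem he] at hCE
      have h3 := Set.ncard_le_ncard (circ_subset_comp hC hCE heC hee)
      have := hp.two_le_ncard hC fun f hf => hE f (hCE hf)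
      omega
    obtain ⟨X, hX, h4, huX, hwX⟩ := hp.exists_uClique (rconn_class he)
      (fun f hf => hE f hf.1) h2 hu hw hun
    obtain ⟨Y, hXY, hY⟩ := Set.Finite.exists_le_maximal
      (Set.toFinite {Y | UClique (comp p G.edgeSet e) Y}) hX
    have h4Y := h4.trans (Set.ncard_le_ncard hXY)
    exact ⟨Y, (hp.isCluster_iff h4Y).2 ⟨e, he, hY⟩, h4Y, hXY huX, hXY hwX⟩

end Clusters

/-- The globally 2-linked clusters of `G` of size at least four are precisely the
vertex sets of the `ℛ₂`-blocks of `G`; moreover an edge of `glc₂(G)` is induced by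
no globally 2-linked cluster of size at least four iff it is an `ℛ₂`-bridge of
`G`. -/
theorem clusters_eq_blocks {V : Type*} [Fintype V] [DecidableEq V]
    (G : SimpleGraph V) :
    ({X : Set V | IsCluster 2 G X ∧ 4 ≤ X.ncard} =
      {X : Set V | IsRdBlockVerts 2 G X}) ∧
    ∀ e ∈ (glc 2 G).edgeSet,
      ((¬ ∃ X : Set V, IsCluster 2 G X ∧ 4 ≤ X.ncard ∧ ∀ w ∈ e, w ∈ X) ↔
        IsRdBridge 2 G e) := by
  obtain ⟨p, hp⟩ := exists_generic (V := V)
  refine ⟨Set.ext fun X => hp.isCluster_iff_isRdBlockVerts, fun e he => ?_⟩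
  induction e with
  | _ u w =>
  rw [not_iff_comm, ← hp.exists_isCluster_iff he]
  simp

end Rigidity
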